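/- arXiv:1302.3448 — 3 statements merged into one kernel-verified Lean document; each statement's English description precedes it below -/
import Mathlib

section
/- Let ω ∈ ℝ \ {0} satisfy a·m − 2·M·r₊·ω = 0 and let λ ∈ ℝ. Then there exists δ > 0 such that for every real μ with ω² < μ² < ω² + δ there is a smooth real-valued function f compactly supported in (r₊, ∞) with ∫_{r₊}^{∞} ( Δ(r)·f'(r)² + (V(r)/Δ(r))·f(r)² ) dr < 0. -/
open Real Set MeasureTheory Filter Topology ComplexConjugate

/-- The larger root `r₊ = M + √(M² − a²)`. -/
noncomputable def rPlus (M a : ℝ) : ℝ := M + Real.sqrt (M ^ 2 - a ^ 2)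

/-- The smaller root `r₋ = M − √(M² − a²)`. -/
noncomputable def rMinus (M a : ℝ) : ℝ := M - Real.sqrt (M ^ 2 - a ^ 2)

/-- `Δ(r) = (r − r₊)(r − r₋)`. -/
noncomputable def Delta (M a r : ℝ) : ℝ := (r - rPlus M a) * (r - rMinus M a)

/-- The radial potential with real parameters `ω, λ, μ`. -/
noncomputable def Vpot (M a : ℝ) (m : ℤ) (ω lam μ r : ℝ) : ℝ :=
  -(r ^ 2 + a ^ 2) ^ 2 * ω ^ 2 + 4 * M * a * m * r * ω - a ^ 2 * m ^ 2
    + Delta M a r * (lam + a ^ 2 * ω ^ 2 + μ ^ 2 * r ^ 2)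

/-- The radial ODE `Δ (Δ R')' − V R = 0` on `(r₊, ∞)`. -/
def RadialODE (M a : ℝ) (m : ℤ) (ω lam μ : ℝ) (R : ℝ → ℂ) : Prop :=
  ∀ r ∈ Ioi (rPlus M a),
    (Delta M a r : ℂ) * deriv (fun s => (Delta M a s : ℂ) * deriv R s) r
      - (Vpot M a m ω lam μ r : ℂ) * R r = 0

/-- Exponential decay at infinity of `h` together with its derivative. -/
def ExpDecay (rp : ℝ) (h : ℝ → ℂ) : Prop :=
  ∃ C c : ℝ, 0 < C ∧ 0 < c ∧ ∀ r : ℝ, rp + 1 ≤ r →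
    ‖h r‖ + ‖deriv h r‖ ≤ C * Real.exp (-c * r)

lemma cubic_neg (c A B C : ℝ) (hc : 0 < c) :
    ∃ R0 : ℝ, 1 ≤ R0 ∧ ∀ r ≥ R0, -c * r ^ 3 + A * r ^ 2 + B * r + C ≤ 0 := by
  refine ⟨max 1 ((|A| + |B| + |C|) / c), le_max_left _ _, fun r hr => ?_⟩
  have h1 : 1 ≤ r := le_trans (le_max_left _ _) hr
  have h2 : (|A| + |B| + |C|) / c ≤ r := le_trans (le_max_right _ _) hr
  rw [div_le_iff₀ hc] at h2
  have hr2 : r ≤ r ^ 2 := by nlinarith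
  have hr1 : 1 ≤ r ^ 2 := by nlinarith
  have hA : A * r ^ 2 ≤ |A| * r ^ 2 := by gcongr; exact le_abs_self A
  have hB : B * r ≤ |B| * r ^ 2 :=
    calc B * r ≤ |B| * r := by gcongr; exact le_abs_self B
      _ ≤ |B| * r ^ 2 := by gcongr
  have hC : C ≤ |C| * r ^ 2 := le_trans (le_abs_self C) (by nlinarith [abs_nonneg C])
  have := mul_le_mul_of_nonneg_right h2 (by positivity : (0:ℝ) ≤ r ^ 2)
  nlinarith

lemma delta_expand (M a r : ℝ) (ha : |a| < M) : Delta M a r = r ^ 2 - 2 * M * r + a ^ 2 := by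
  have h : 0 ≤ M ^ 2 - a ^ 2 := by
    have := sq_lt_sq' (by linarith [abs_nonneg a, neg_abs_le a]) ha
    rw [sq_abs] at this
    linarith
  have := Real.sq_sqrt h
  unfold Delta rPlus rMinus
  linear_combination -this

lemma asymp (M a : ℝ) (hM : 0 < M) (ha : |a| < M) (m : ℤ) (ω lam : ℝ) (hω : ω ≠ 0) :
    ∃ R0 : ℝ, 1 ≤ R0 ∧ ∀ r ≥ R0, rPlus M a < r ∧ 0 < Delta M a r ∧ Delta M a r ≤ r ^ 2 ∧
      Vpot M a m ω lam ω r / Delta M a r ≤ -(M * ω ^ 2) * r := by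
  have hc : 0 < M * ω ^ 2 := by positivity
  obtain ⟨R0, h0, h⟩ := cubic_neg (M * ω ^ 2)
    (-2 * a ^ 2 * ω ^ 2 + lam + a ^ 2 * ω ^ 2 + a ^ 2 * ω ^ 2 - 2 * M ^ 2 * ω ^ 2)
    (4 * M * a * m * ω - 2 * M * (lam + a ^ 2 * ω ^ 2) + M * ω ^ 2 * a ^ 2)
    (-a ^ 4 * ω ^ 2 - a ^ 2 * m ^ 2 + a ^ 2 * (lam + a ^ 2 * ω ^ 2)) hc
  refine ⟨max R0 (2 * M + 1), le_trans h0 (le_max_left _ _), fun r hr => ?_⟩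
  have h1 : R0 ≤ r := le_trans (le_max_left _ _) hr
  have h2 : 2 * M + 1 ≤ r := le_trans (le_max_right _ _) hr
  have hs : Real.sqrt (M ^ 2 - a ^ 2) ≤ M := by
    rw [Real.sqrt_le_left hM.le]; nlinarith [sq_nonneg a]
  have ha2 : a ^ 2 < M ^ 2 := by
    have := sq_lt_sq' (by linarith [abs_nonneg a]) ha
    rwa [sq_abs] at this
  have hD : 0 < Delta M a r := by rw [delta_expand M a r ha]; nlinarith [sq_nonneg a]
  refine ⟨by unfold rPlus; linarith, hD, ?_, ?_⟩
  · rw [delta_expand M a r ha]; nlinarith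
  · rw [div_le_iff₀ hD]
    have := h r h1
    unfold Vpot
    rw [delta_expand M a r ha]
    nlinarith

lemma zero_off_integrable (g : ℝ → ℝ) (u v : ℝ) (hg : ContinuousOn g (Icc u v))
    (h0 : ∀ x, x ∉ Icc u v → g x = 0) : Integrable g := by
  rw [← integrableOn_iff_integrable_of_support_subset (s := Icc u v)]
  · exact hg.integrableOn_Icc
  · intro x hx
    by_contra h
    exact hx (h0 x h)

/-- for `ω ≠ 0` with `a m − 2 M r₊ ω = 0`, and any real `λ`, for all `μ` with
`μ²` slightly above `ω²` there is a smooth compactly supported test function making the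
Lagrangian `∫ (Δ f'² + (V/Δ) f²)` negative. -/
theorem stmt4 (M a : ℝ) (hM : 0 < M) (ha : |a| < M) (m : ℤ)
    (ω lam : ℝ) (hω : ω ≠ 0) (hsup : a * m - 2 * M * rPlus M a * ω = 0) :
    ∃ δ > 0, ∀ μ : ℝ, ω ^ 2 < μ ^ 2 → μ ^ 2 < ω ^ 2 + δ →
      ∃ f : ℝ → ℝ, ContDiff ℝ (⊤ : ℕ∞) f ∧ HasCompactSupport f ∧
        tsupport f ⊆ Ioi (rPlus M a) ∧
        (∫ r in Ioi (rPlus M a),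
          (Delta M a r * (deriv f r) ^ 2
            + Vpot M a m ω lam μ r / Delta M a r * (f r) ^ 2)) < 0 := by
  obtain ⟨R0, hR0, has⟩ := asymp M a hM ha m ω lam hω
  let φ : ContDiffBump (3 : ℝ) := ⟨1 / 2, 1, by norm_num, by norm_num⟩
  have hφs : ContDiff ℝ (⊤ : ℕ∞) (φ : ℝ → ℝ) := φ.contDiff
  have hts : tsupport (φ : ℝ → ℝ) = Icc 2 4 := by
    rw [φ.tsupport_eq, Real.closedBall_eq_Icc]; norm_num [φ]
  have hφ0 : ∀ x, x ∉ Icc (2 : ℝ) 4 → φ x = 0 := fun x hx =>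
    image_eq_zero_of_notMem_tsupport (by rwa [hts])
  have hdφ0 : ∀ x, x ∉ Icc (2 : ℝ) 4 → deriv φ x = 0 := fun x hx => by
    by_contra h
    exact hx (hts ▸ support_deriv_subset (f := (φ : ℝ → ℝ)) h)
  have hφc : Continuous (φ : ℝ → ℝ) := hφs.continuous
  have hdφc : Continuous (deriv (φ : ℝ → ℝ)) := hφs.continuous_deriv (by simp)
  have iA : Integrable (fun x => (deriv φ x) ^ 2) :=
    zero_off_integrable _ 2 4 (by fun_prop) (fun x hx => by simp [hdφ0 x hx])
  have iB : Integrable (fun x => (φ x) ^ 2) :=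
    zero_off_integrable _ 2 4 (by fun_prop) (fun x hx => by simp [hφ0 x hx])
  have hB : 0 < ∫ x, (φ x) ^ 2 := by
    refine integral_pos_of_integrable_nonneg_nonzero (x := 3) (by fun_prop) iB
      (fun x => by positivity) ?_
    have : φ 3 = 1 := φ.one_of_mem_closedBall (by simp [φ])
    simp [this]
  set A := ∫ x, (deriv φ x) ^ 2 with hAdef
  set B := ∫ x, (φ x) ^ 2 with hBdef
  have hc : 0 < M * ω ^ 2 := by positivity
  obtain ⟨R, hR1, hR2⟩ : ∃ R, R0 ≤ R ∧ 16 * A < (M * ω ^ 2) * R * B := by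
    refine ⟨max R0 (16 * A / (M * ω ^ 2 * B) + 1), le_max_left _ _, ?_⟩
    have h : 16 * A / (M * ω ^ 2 * B) < max R0 (16 * A / (M * ω ^ 2 * B) + 1) :=
      lt_of_lt_of_le (by linarith) (le_max_right _ _)
    rw [div_lt_iff₀ (by positivity)] at h
    linarith
  have hRpos : 0 < R := by linarith
  let f : ℝ → ℝ := fun r => φ (r / R)
  have hf : ContDiff ℝ (⊤ : ℕ∞) f := hφs.comp (contDiff_id.div_const R)
  have hmem : ∀ r, r / R ∈ Icc (2 : ℝ) 4 ↔ r ∈ Icc (2 * R) (4 * R) := fun r => by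
    simp only [mem_Icc, le_div_iff₀ hRpos, div_le_iff₀ hRpos]
  have hf0 : ∀ r, r ∉ Icc (2 * R) (4 * R) → f r = 0 := fun r hr =>
    hφ0 _ (by rwa [hmem])
  have hdf : ∀ r, deriv f r = deriv φ (r / R) / R := fun r => by
    have h1 : HasDerivAt φ (deriv φ (r / R)) (r / R) :=
      (hφs.differentiable (by simp) _).hasDerivAt
    have h2 := h1.comp r ((hasDerivAt_id r).div_const R)
    rw [show f = φ ∘ (fun r => id r / R) from rfl, h2.deriv]
    ring
  have hdf0 : ∀ r, r ∉ Icc (2 * R) (4 * R) → deriv f r = 0 := fun r hr => by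
    rw [hdf, hdφ0 _ (by rwa [hmem])]; simp
  have hfc : Continuous f := hf.continuous
  have hdfc : Continuous (deriv f) := hf.continuous_deriv (by simp)
  have hfts : tsupport f ⊆ Icc (2 * R) (4 * R) :=
    closure_minimal (fun x hx => by by_contra h; exact hx (hf0 x h)) isClosed_Icc
  have hIcc : ∀ r ∈ Icc (2 * R) (4 * R), R0 ≤ r := fun r hr => by
    linarith [hr.1]
  have hsub : tsupport f ⊆ Ioi (rPlus M a) := fun r hr =>
    (has r (hIcc r (hfts hr))).1
  have hcs : HasCompactSupport f :=
    HasCompactSupport.intro isCompact_Icc (fun x hx => hf0 x hx)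
  have hDc : Continuous (fun r => Delta M a r) := by unfold Delta; fun_prop
  have hVc : Continuous (fun r => Vpot M a m ω lam ω r) := by
    unfold Vpot Delta; fun_prop
  let g : ℝ → ℝ := fun r => Delta M a r * (deriv f r) ^ 2
            + Vpot M a m ω lam ω r / Delta M a r * (f r) ^ 2
  have ig : Integrable g := by
    refine zero_off_integrable _ (2 * R) (4 * R) ?_ (fun r hr => by simp [g, hf0 r hr, hdf0 r hr])
    refine ContinuousOn.add (by fun_prop) (ContinuousOn.mul ?_ (by fun_prop))
    exact hVc.continuousOn.div hDc.continuousOn (fun r hr => (has r (hIcc r hr)).2.1.ne')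
  have iq : Integrable (fun r => r ^ 2 * (f r) ^ 2) :=
    zero_off_integrable _ (2 * R) (4 * R) (by fun_prop) (fun r hr => by simp [hf0 r hr])
  have hle : ∀ r, g r ≤ (fun x => 16 * (deriv φ x) ^ 2 - (M * ω ^ 2 * R) * (φ x) ^ 2) (r / R) := by
    intro r
    by_cases hr : r ∈ Icc (2 * R) (4 * R)
    · obtain ⟨-, h1, h2, h3⟩ := has r (hIcc r hr)
      have e1 : Delta M a r * (deriv f r) ^ 2 ≤ 16 * (deriv φ (r / R)) ^ 2 := by
        rw [hdf, div_pow, mul_div_assoc', div_le_iff₀ (by positivity)]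
        have : Delta M a r ≤ 16 * R ^ 2 := by nlinarith [hr.1, hr.2]
        nlinarith [mul_le_mul_of_nonneg_right this (sq_nonneg (deriv φ (r / R)))]
      have e2 : Vpot M a m ω lam ω r / Delta M a r * (f r) ^ 2
          ≤ -(M * ω ^ 2 * R) * (f r) ^ 2 := by
        gcongr
        nlinarith [hr.1]
      change Delta M a r * (deriv f r) ^ 2 + Vpot M a m ω lam ω r / Delta M a r * (f r) ^ 2
        ≤ 16 * (deriv φ (r / R)) ^ 2 - (M * ω ^ 2 * R) * (f r) ^ 2
      linarith
    · have hr' : r / R ∉ Icc (2 : ℝ) 4 := by rwa [hmem]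
      simp [g, hf0 r hr, hdf0 r hr, hφ0 _ hr', hdφ0 _ hr']
  have hneg : ∫ r, g r < 0 := by
    have iG : Integrable (fun x => 16 * (deriv φ x) ^ 2 - (M * ω ^ 2 * R) * (φ x) ^ 2) :=
      (iA.const_mul _).sub (iB.const_mul _)
    have h1 := integral_mono ig (iG.comp_div hRpos.ne') hle
    rw [Measure.integral_comp_div
      (fun x => 16 * (deriv φ x) ^ 2 - (M * ω ^ 2 * R) * (φ x) ^ 2) R, integral_sub (iA.const_mul _) (iB.const_mul _),
      integral_const_mul, integral_const_mul, ← hAdef, ← hBdef, abs_of_pos hRpos,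
      smul_eq_mul] at h1
    nlinarith
  set Q := ∫ r, r ^ 2 * (f r) ^ 2 with hQ
  have hQ0 : 0 ≤ Q := integral_nonneg (fun r => by positivity)
  refine ⟨-(∫ r, g r) / (Q + 1), div_pos (by linarith) (by linarith), fun μ h1 h2 => ?_⟩
  refine ⟨f, hf, hcs, hsub, ?_⟩
  rw [setIntegral_eq_integral_of_forall_compl_eq_zero]
  · have : (fun r => Delta M a r * (deriv f r) ^ 2
            + Vpot M a m ω lam μ r / Delta M a r * (f r) ^ 2)
          = fun r => g r + (μ ^ 2 - ω ^ 2) * (r ^ 2 * (f r) ^ 2) := by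
      funext r
      by_cases hr : r ∈ Icc (2 * R) (4 * R)
      · have hD := (has r (hIcc r hr)).2.1.ne'
        have : Vpot M a m ω lam μ r
            = Vpot M a m ω lam ω r + Delta M a r * ((μ ^ 2 - ω ^ 2) * r ^ 2) := by
          unfold Vpot; ring
        simp only [g]
        rw [this, add_div, mul_div_cancel_left₀ _ hD]
        ring
      · simp [g, hf0 r hr, hdf0 r hr]
    rw [this, integral_add ig (iq.const_mul _), integral_const_mul, ← hQ]
    have h3 : μ ^ 2 - ω ^ 2 < -(∫ r, g r) / (Q + 1) := by linarith
    rw [lt_div_iff₀ (by linarith)] at h3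
    nlinarith
  · intro r hr
    have hr' : r ∉ Icc (2 * R) (4 * R) := fun h => hr (has r (hIcc r h)).1
    simp [hf0 r hr', hdf0 r hr']
end

section
/- Let ω ∈ ℝ \ {0} satisfy a·m − 2·M·r₊·ω = 0, let λ ∈ ℝ satisfy λ + a²·ω² ≥ |m|·(|m|+1), let μ be real with μ² > ω², and let ε > 0. Then the infimum ν := ν_μ^{(ε)} is finite and is attained by a minimizer solving the Euler–Lagrange equation: there exists f : [r₊+ε, ∞) → ℝ, continuous with f(r₊+ε) = 0, C² on (r₊+ε, ∞), with ∫_{r₊+ε}^{∞} f² dr = 1, ∫_{r₊+ε}^{∞} ( Δ·(f')² + (V/Δ)·f² ) dr = ν, and Δ·(Δ·f')' − V·f + ν·Δ·f = 0 on (r₊+ε, ∞). -/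
open Real Set MeasureTheory Filter Topology ComplexConjugate

/-- The regularized Lagrangian `∫_{r₊+ε}^∞ (Δ |f'|² + (V/Δ) |f|²)`. -/
noncomputable def Lag (M a : ℝ) (m : ℤ) (ω lam μ ε : ℝ) (f : ℝ → ℂ) : ℝ :=
  ∫ r in Ioi (rPlus M a + ε),
    (Delta M a r * ‖deriv f r‖ ^ 2
      + Vpot M a m ω lam μ r / Delta M a r * ‖f r‖ ^ 2)

/-- The set of values of the regularized Lagrangian over smooth test functions compactly
supported in `(r₊+ε, ∞)` with unit `L²` norm. -/
def LagVals (M a : ℝ) (m : ℤ) (ω lam μ ε : ℝ) : Set ℝ :=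
  {x : ℝ | ∃ f : ℝ → ℂ, ContDiff ℝ (⊤ : ℕ∞) f ∧ HasCompactSupport f ∧
    tsupport f ⊆ Ioi (rPlus M a + ε) ∧
    (∫ r in Ioi (rPlus M a + ε), ‖f r‖ ^ 2) = 1 ∧
    x = Lag M a m ω lam μ ε f}


/-- Completeness of `L²` in concrete form. -/
lemma L2_complete {μ : Measure ℝ} (u : ℕ → ℝ → ℝ) (hu : ∀ n, MemLp (u n) 2 μ)
    (hc : ∀ η > 0, ∃ N, ∀ n ≥ N, ∀ k ≥ N, ∫ x, (u n x - u k x) ^ 2 ∂μ ≤ η) :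
    ∃ G : ℝ → ℝ, MemLp G 2 μ ∧
      (∀ v, MemLp v 2 μ → Tendsto (fun n => ∫ x, u n x * v x ∂μ) atTop (𝓝 (∫ x, G x * v x ∂μ))) ∧
      Tendsto (fun n => ∫ x, u n x ^ 2 ∂μ) atTop (𝓝 (∫ x, G x ^ 2 ∂μ)) ∧
      ∃ ns : ℕ → ℕ, StrictMono ns ∧
        ∀ᵐ x ∂μ, Tendsto (fun i => u (ns i) x) atTop (𝓝 (G x)) := by
  have hin : ∀ (f g : ℝ → ℝ) (hf : MemLp f 2 μ) (hg : MemLp g 2 μ),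
      inner ℝ (hf.toLp f) (hg.toLp g) = ∫ x, f x * g x ∂μ := by
    intro f g hf hg
    rw [L2.inner_def]
    refine integral_congr_ae ?_
    filter_upwards [hf.coeFn_toLp, hg.coeFn_toLp] with x h1 h2
    rw [h1, h2]
    simp [mul_comm]
  set U : ℕ → Lp ℝ 2 μ := fun n => (hu n).toLp (u n) with hU
  have hcau : CauchySeq U := by
    rw [Metric.cauchySeq_iff]
    intro e he
    obtain ⟨N, hN⟩ := hc (e ^ 2 / 2) (by positivity)
    refine ⟨N, fun n hn k hk => ?_⟩
    have h1 : U n - U k = ((hu n).sub (hu k)).toLp (u n - u k) := (MemLp.toLp_sub _ _).symm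
    have h2 : dist (U n) (U k) ^ 2 = ∫ x, (u n x - u k x) ^ 2 ∂μ := by
      rw [dist_eq_norm, ← real_inner_self_eq_norm_sq, h1, hin]
      simp [pow_two]
    have h3 := hN n hn k hk
    have h4 : dist (U n) (U k) ^ 2 < e ^ 2 := by
      rw [h2]; have : 0 < e ^ 2 := by positivity
      linarith
    exact lt_of_pow_lt_pow_left₀ 2 he.le h4
  obtain ⟨L, hL⟩ := cauchySeq_tendsto_of_complete hcau
  have hLm : MemLp L 2 μ := Lp.memLp L
  have hLL : hLm.toLp L = L := Lp.toLp_coeFn L hLm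
  refine ⟨L, hLm, ?_, ?_, ?_⟩
  · intro v hv
    have h := (hL.inner (tendsto_const_nhds (x := hv.toLp v)) : Tendsto (fun n => inner ℝ (U n) (hv.toLp v)) atTop _)
    rw [← hLL, hin] at h
    simpa only [hU, hin] using h
  · have h := (hL.inner hL : Tendsto (fun n => inner ℝ (U n) (U n)) atTop _)
    rw [← hLL, hin] at h
    simpa only [hU, hin, pow_two] using h
  · obtain ⟨ns, h1, h2⟩ := (tendstoInMeasure_of_tendsto_Lp hL).exists_seq_tendsto_ae
    refine ⟨ns, h1, ?_⟩
    have h3 : ∀ᵐ x ∂μ, ∀ n, U n x = u n x := ae_all_iff.2 fun n => (hu n).coeFn_toLp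
    filter_upwards [h2, h3] with x hx hx3
    simpa only [hx3] using hx

/-- Test functions. -/
structure TF (b : ℝ) (φ : ℝ → ℝ) : Prop where
  smooth : ContDiff ℝ (⊤ : ℕ∞) φ
  cpt : HasCompactSupport φ
  supp : tsupport φ ⊆ Ioi b

namespace TF
variable {b : ℝ} {φ ψ : ℝ → ℝ}

lemma cont (h : TF b φ) : Continuous φ := h.smooth.continuous

lemma diff (h : TF b φ) : Differentiable ℝ φ := h.smooth.differentiable (by simp)

lemma contd (h : TF b φ) : Continuous (deriv φ) :=
  h.smooth.continuous_deriv (by exact_mod_cast le_top)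

lemma cptd (h : TF b φ) : HasCompactSupport (deriv φ) := h.cpt.deriv

lemma suppd (h : TF b φ) : tsupport (deriv φ) ⊆ Ioi b :=
  (tsupport_deriv_subset).trans h.supp

lemma zero (h : TF b φ) {x : ℝ} (hx : x ≤ b) : φ x = 0 :=
  image_eq_zero_of_notMem_tsupport fun hh => absurd (h.supp hh) (by simpa using hx)

lemma zerod (h : TF b φ) {x : ℝ} (hx : x ≤ b) : deriv φ x = 0 :=
  image_eq_zero_of_notMem_tsupport fun hh => absurd (h.suppd hh) (by simpa using hx)

lemma add (h : TF b φ) (h' : TF b ψ) : TF b (fun x => φ x + ψ x) :=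
  ⟨h.smooth.add h'.smooth, h.cpt.add h'.cpt,
    (tsupport_add φ ψ).trans (union_subset h.supp h'.supp)⟩

lemma smul (h : TF b φ) (t : ℝ) : TF b (fun x => t * φ x) :=
  ⟨contDiff_const.mul h.smooth, h.cpt.mul_left,
    (tsupport_mul_subset_right (f := fun _ => t) (g := φ)).trans h.supp⟩

lemma sub (h : TF b φ) (h' : TF b ψ) : TF b (fun x => φ x - ψ x) := by
  have := h.add (h'.smul (-1))
  have e : (fun x => φ x - ψ x) = fun x => φ x + -1 * ψ x := by
    funext x; ring
  rw [e]; exact this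

lemma deriv_add' (h : TF b φ) (h' : TF b ψ) (x : ℝ) :
    deriv (fun x => φ x + ψ x) x = deriv φ x + deriv ψ x :=
  deriv_fun_add (h.diff x) (h'.diff x)

lemma deriv_sub' (h : TF b φ) (h' : TF b ψ) (x : ℝ) :
    deriv (fun x => φ x - ψ x) x = deriv φ x - deriv ψ x :=
  deriv_fun_sub (h.diff x) (h'.diff x)

lemma deriv_smul' (h : TF b φ) (t : ℝ) (x : ℝ) :
    deriv (fun x => t * φ x) x = t * deriv φ x :=
  deriv_const_mul _ (h.diff x)

/-- The primitive of a mean zero test function is a test function. -/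
lemma prim (h : TF b φ) (h0 : ∫ x, φ x = 0) :
    TF b (fun x => ∫ t in b..x, φ t) ∧ ∀ x, deriv (fun x => ∫ t in b..x, φ t) x = φ x := by
  have hd : ∀ x, HasDerivAt (fun x => ∫ t in b..x, φ t) (φ x) x := fun x =>
    intervalIntegral.integral_hasDerivAt_right (h.cont.intervalIntegrable _ _)
      (h.cont.stronglyMeasurableAtFilter _ _) h.cont.continuousAt
  have hdd : deriv (fun x => ∫ t in b..x, φ t) = φ := funext fun x => (hd x).deriv
  obtain ⟨c, d, hc, hsub⟩ : ∃ c d, b < c ∧ tsupport φ ⊆ Icc c d := by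
    rcases (tsupport φ).eq_empty_or_nonempty with he | hne
    · exact ⟨b + 1, b + 1, by linarith, by simp [he]⟩
    · have hK : IsCompact (tsupport φ) := h.cpt
      refine ⟨sInf (tsupport φ), sSup (tsupport φ), h.supp (hK.sInf_mem hne), fun x hx => ?_⟩
      exact ⟨csInf_le hK.bddBelow hx, le_csSup hK.bddAbove hx⟩
  have hz : ∀ x, x ∉ Icc c d → φ x = 0 := fun x hx =>
    image_eq_zero_of_notMem_tsupport fun hh => hx (hsub hh)
  have hsupp : ∀ x, x ∉ Icc c d → ∫ t in b..x, φ t = 0 := by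
    intro x hx
    rcases lt_or_ge x c with hxc | hxc
    · refine intervalIntegral.integral_zero_ae (Eventually.of_forall fun t ht => hz t fun hh => ?_)
      have := ht.2
      have h2 : max b x < c := max_lt hc hxc
      linarith [hh.1]
    · have hxd : d < x := by
        by_contra hh; exact hx ⟨hxc, not_lt.1 hh⟩
      rw [intervalIntegral.integral_of_le (by linarith), ← h0]
      refine setIntegral_eq_integral_of_forall_compl_eq_zero fun t ht => hz t fun hh => ht ?_
      exact ⟨by linarith [hh.1], by linarith [hh.2]⟩
  have hts : tsupport (fun x => ∫ t in b..x, φ t) ⊆ Icc c d := by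
    refine closure_minimal (fun x hx => ?_) isClosed_Icc
    by_contra hh
    exact hx (hsupp x hh)
  refine ⟨⟨?_, ?_, ?_⟩, fun x => (hd x).deriv⟩
  · rw [contDiff_infty_iff_deriv]
    refine ⟨fun x => (hd x).differentiableAt, ?_⟩
    rw [hdd]; exact h.smooth
  · exact HasCompactSupport.of_support_subset_isCompact isCompact_Icc (subset_closure.trans hts)
  · exact hts.trans fun x hx => lt_of_lt_of_le hc hx.1

lemma exists_unit (b : ℝ) : ∃ φ, TF b φ ∧ ∫ x, φ x = 1 := by
  let B : ContDiffBump (b + 3) := ⟨1, 2, by norm_num, by norm_num⟩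
  refine ⟨B.normed volume, ⟨B.contDiff_normed, B.hasCompactSupport_normed, ?_⟩, B.integral_normed⟩
  rw [B.tsupport_normed_eq]
  intro x hx
  rw [Metric.mem_closedBall, Real.dist_eq] at hx
  have := (abs_le.1 hx).1
  show b < x
  have h2 : B.rOut = 2 := rfl
  linarith

end TF

/-- du Bois-Reymond. -/
lemma duBois (b : ℝ) (h : ℝ → ℝ) (hl : LocallyIntegrable h)
    (hz : ∀ φ, TF b φ → ∫ x, h x * deriv φ x = 0) :
    ∃ c, ∀ᵐ x, x ∈ Ioi b → h x = c := by
  obtain ⟨φ0, h0, hi0⟩ := TF.exists_unit b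
  have hint : ∀ ψ, TF b ψ → Integrable (fun x => ψ x * h x) := fun ψ hψ => by
    simpa using hl.integrable_smul_left_of_hasCompactSupport hψ.cont hψ.cpt
  refine ⟨∫ x, φ0 x * h x, ?_⟩
  set c := ∫ x, φ0 x * h x with hc
  have := IsOpen.ae_eq_zero_of_integral_contDiff_smul_eq_zero (U := Ioi b) (μ := volume)
    (f := fun x => h x - c) isOpen_Ioi
    ((hl.sub (locallyIntegrable_const c)).locallyIntegrableOn _) ?_
  · filter_upwards [this] with x hx hxb
    linarith [hx hxb]
  · intro g g1 g2 g3
    have hg : TF b g := ⟨g1, g2, g3⟩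
    have hgi : Integrable g := hg.cont.integrable_of_hasCompactSupport hg.cpt
    have h0i : Integrable φ0 := h0.cont.integrable_of_hasCompactSupport h0.cpt
    have hχ := hg.sub (h0.smul (∫ x, g x))
    have hmean : ∫ x, (g x - (∫ x, g x) * φ0 x) = 0 := by
      rw [integral_sub hgi (h0i.const_mul _), integral_const_mul, hi0]; ring
    obtain ⟨hp, hd⟩ := hχ.prim hmean
    have := hz _ hp
    simp only [hd] at this
    have e1 : ∀ x, h x * (g x - (∫ x, g x) * φ0 x) = g x * h x - (∫ x, g x) * (φ0 x * h x) := by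
      intro x; ring
    simp only [e1] at this
    rw [integral_sub (hint g hg) ((hint φ0 h0).const_mul _), integral_const_mul] at this
    have e2 : ∀ x, g x • (h x - c) = g x * h x - c * g x := by intro x; simp; ring
    simp only [e2]
    rw [integral_sub (hint g hg) (hgi.const_mul _), integral_const_mul]
    linarith

/-- Hölder-type bound. -/
lemma TF.holder {b : ℝ} {φ : ℝ → ℝ} (h : TF b φ) {A t : ℝ} (ht : 0 < t)
    (hA : ∫ x in Ioi b, deriv φ x ^ 2 ≤ A) (x y : ℝ) :
    |φ y - φ x| ≤ t * A / 2 + |y - x| / (2 * t) := by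
  wlog hxy : x ≤ y generalizing x y
  · rw [abs_sub_comm, abs_sub_comm y x]; exact this y x (not_le.1 hxy).le
  have hint : Integrable (fun x => deriv φ x ^ 2) := by
    refine (h.contd.pow 2).integrable_of_hasCompactSupport ?_
    simpa [pow_two] using h.cptd.mul_left (f := deriv φ)
  have hA' : ∫ x, deriv φ x ^ 2 ≤ A := by
    rwa [setIntegral_eq_integral_of_forall_compl_eq_zero] at hA
    intro x hx
    rw [h.zerod (by simpa using hx)]; simp
  rw [← intervalIntegral.integral_deriv_eq_sub (fun x _ => h.diff x) (h.contd.intervalIntegrable _ _)]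
  have h1 : |∫ s in x..y, deriv φ s| ≤ ∫ s in x..y, |deriv φ s| :=
    intervalIntegral.abs_integral_le_integral_abs hxy
  have h2 : ∫ s in x..y, |deriv φ s| ≤ ∫ s in x..y, (t / 2 * deriv φ s ^ 2 + 1 / (2 * t)) := by
    refine intervalIntegral.integral_mono_on hxy (h.contd.abs.intervalIntegrable _ _)
      (((continuous_const.mul (h.contd.pow 2)).add continuous_const).intervalIntegrable _ _)
      fun s _ => ?_
    have h3 : 0 ≤ (t * |deriv φ s| - 1) ^ 2 / (2 * t) := by positivity
    have h4 : (t * |deriv φ s| - 1) ^ 2 / (2 * t) =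
        t / 2 * deriv φ s ^ 2 + 1 / (2 * t) - |deriv φ s| := by
      rw [← sq_abs (deriv φ s)]; field_simp; ring
    linarith
  have h5 : ∫ s in x..y, (t / 2 * deriv φ s ^ 2 + 1 / (2 * t)) =
      t / 2 * (∫ s in x..y, deriv φ s ^ 2) + (y - x) / (2 * t) := by
    have hcc : Continuous fun s => t / 2 * deriv φ s ^ 2 := continuous_const.mul (h.contd.pow 2)
    rw [intervalIntegral.integral_add (hcc.intervalIntegrable _ _)
      (continuous_const.intervalIntegrable _ _), intervalIntegral.integral_const_mul,
      intervalIntegral.integral_const]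
    simp; ring
  have h6 : ∫ s in x..y, deriv φ s ^ 2 ≤ A := by
    rw [intervalIntegral.integral_of_le hxy]
    exact (setIntegral_le_integral hint (Eventually.of_forall fun x => by positivity)).trans hA'
  have h7 : t / 2 * (∫ s in x..y, deriv φ s ^ 2) ≤ t / 2 * A := by gcongr
  rw [abs_of_nonneg (by linarith : 0 ≤ y - x)]
  linarith

/-- Subsequence converging pointwise (Cauchy form). -/
lemma exists_subseq {b A : ℝ} (f : ℕ → ℝ → ℝ) (hf : ∀ n, TF b (f n))
    (hA : ∀ n, ∫ x in Ioi b, deriv (f n) x ^ 2 ≤ A) :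
    ∃ ns : ℕ → ℕ, StrictMono ns ∧ ∃ l : ℝ → ℝ,
      ∀ x, Tendsto (fun i => f (ns i) x) atTop (𝓝 (l x)) := by
  have hA0 : 0 ≤ A := (integral_nonneg fun x => by positivity).trans (hA 0)
  have hbd : ∀ n x, |f n x| ≤ A / 2 + |x - b| / 2 := by
    intro n x
    have := (hf n).holder one_pos (hA n) b x
    rw [(hf n).zero le_rfl] at this
    simpa using this
  have hcomp : IsCompact (Set.pi univ fun q : ℚ => Icc (-(A / 2 + |(q:ℝ) - b| / 2)) (A / 2 + |(q:ℝ) - b| / 2)) :=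
    isCompact_univ_pi fun q => isCompact_Icc
  obtain ⟨L, -, ns, hns, hL⟩ := hcomp.isSeqCompact (x := fun n (q : ℚ) => f n q)
    (fun n q _ => abs_le.1 (hbd n q))
  refine ⟨ns, hns, ?_⟩
  rw [tendsto_pi_nhds] at hL
  have : ∀ x, ∃ y, Tendsto (fun i => f (ns i) x) atTop (𝓝 y) := by
    intro x
    refine cauchySeq_tendsto_of_complete (Metric.cauchySeq_iff.2 fun e he => ?_)
    set t := e / (4 * (A + 1)) with ht
    have htp : 0 < t := by positivity
    have htA : t * A / 2 ≤ e / 8 := by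
      rw [ht]
      have : A / (A + 1) ≤ 1 := (div_le_one (by positivity)).2 (by linarith)
      calc e / (4 * (A + 1)) * A / 2 = e / 8 * (A / (A + 1)) := by field_simp; ring
        _ ≤ e / 8 * 1 := by gcongr
        _ = e / 8 := by ring
    obtain ⟨q, hq1, hq2⟩ := exists_rat_btwn (show x < x + t * e / 4 by linarith [mul_pos htp he])
    have hclose : ∀ n, |f n q - f n x| ≤ e / 4 := by
      intro n
      refine ((hf n).holder htp (hA n) x q).trans ?_
      have h1 : |(q:ℝ) - x| ≤ t * e / 4 := by
        rw [abs_of_pos (by linarith)]; linarith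
      have h2 : |(q:ℝ) - x| / (2 * t) ≤ (t * e / 4) / (2 * t) := by gcongr
      have h3 : (t * e / 4) / (2 * t) = e / 8 := by field_simp; ring
      linarith
    obtain ⟨N, hN⟩ := Metric.cauchySeq_iff.1 (hL q).cauchySeq (e / 4) (by linarith)
    refine ⟨N, fun n hn k hk => ?_⟩
    have h1 := hN n hn k hk
    rw [Real.dist_eq] at h1 ⊢
    have h2 := hclose (ns n)
    have h3 := hclose (ns k)
    simp only [Function.comp] at h1
    rw [abs_lt] at h1 ⊢
    rw [abs_le] at h2 h3
    constructor <;> linarith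
  choose l hl using this
  exact ⟨l, hl⟩

lemma TF.int0 {b : ℝ} {φ : ℝ → ℝ} (h : TF b φ) {c : ℝ → ℝ} (hc : Continuous c) :
    IntegrableOn (fun x => c x * φ x) (Ioi b) :=
  ((hc.mul h.cont).integrable_of_hasCompactSupport h.cpt.mul_left).integrableOn

lemma TF.int1 {b : ℝ} {φ : ℝ → ℝ} (h : TF b φ) {c : ℝ → ℝ} (hc : Continuous c) :
    IntegrableOn (fun x => c x * deriv φ x) (Ioi b) :=
  ((hc.mul h.contd).integrable_of_hasCompactSupport h.cptd.mul_left).integrableOn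

lemma TF.int00 {b : ℝ} {φ ψ : ℝ → ℝ} (h : TF b φ) (h' : TF b ψ) {c : ℝ → ℝ} (hc : Continuous c) :
    IntegrableOn (fun x => c x * (φ x * ψ x)) (Ioi b) := by
  simpa only [Pi.mul_apply, mul_assoc] using h'.int0 (hc.mul h.cont)

lemma TF.int11 {b : ℝ} {φ ψ : ℝ → ℝ} (h : TF b φ) (h' : TF b ψ) {c : ℝ → ℝ} (hc : Continuous c) :
    IntegrableOn (fun x => c x * (deriv φ x * deriv ψ x)) (Ioi b) := by
  simpa only [Pi.mul_apply, mul_assoc] using h'.int1 (hc.mul h.contd)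

lemma TF.int00s {b : ℝ} {φ : ℝ → ℝ} (h : TF b φ) {c : ℝ → ℝ} (hc : Continuous c) :
    IntegrableOn (fun x => c x * φ x ^ 2) (Ioi b) := by
  simpa only [pow_two] using h.int00 h hc

lemma TF.int11s {b : ℝ} {φ : ℝ → ℝ} (h : TF b φ) {c : ℝ → ℝ} (hc : Continuous c) :
    IntegrableOn (fun x => c x * deriv φ x ^ 2) (Ioi b) := by
  simpa only [pow_two] using h.int11 h hc

/-- Quadratic form. -/
noncomputable def QF (b : ℝ) (p W φ : ℝ → ℝ) : ℝ :=
  ∫ x in Ioi b, (p x * deriv φ x ^ 2 + W x * φ x ^ 2)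

/-- Bilinear form. -/
noncomputable def BF (b : ℝ) (p W φ ψ : ℝ → ℝ) : ℝ :=
  ∫ x in Ioi b, (p x * (deriv φ x * deriv ψ x) + W x * (φ x * ψ x))

lemma QF_comb {b : ℝ} {p W φ ψ : ℝ → ℝ} (hp : Continuous p) (hW : Continuous W)
    (h : TF b φ) (h' : TF b ψ) (t : ℝ) :
    QF b p W (fun x => φ x + t * ψ x) = QF b p W φ + 2 * t * BF b p W φ ψ + t ^ 2 * QF b p W ψ := by
  unfold QF BF
  have e1 : IntegrableOn (fun x => p x * deriv φ x ^ 2 + W x * φ x ^ 2) (Ioi b) :=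
    (h.int11s hp).add (h.int00s hW)
  have e2 : IntegrableOn (fun x => p x * deriv ψ x ^ 2 + W x * ψ x ^ 2) (Ioi b) :=
    (h'.int11s hp).add (h'.int00s hW)
  have e3 : IntegrableOn (fun x => p x * (deriv φ x * deriv ψ x) + W x * (φ x * ψ x)) (Ioi b) :=
    (h.int11 h' hp).add (h.int00 h' hW)
  have e4 : ∀ x, p x * deriv (fun x => φ x + t * ψ x) x ^ 2 + W x * (φ x + t * ψ x) ^ 2 =
      (p x * deriv φ x ^ 2 + W x * φ x ^ 2) +
      (2 * t) * (p x * (deriv φ x * deriv ψ x) + W x * (φ x * ψ x)) +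
      t ^ 2 * (p x * deriv ψ x ^ 2 + W x * ψ x ^ 2) := by
    intro x
    rw [h.deriv_add' (h'.smul t), h'.deriv_smul']; ring
  simp only [e4]
  have e13 : IntegrableOn (fun x => (p x * deriv φ x ^ 2 + W x * φ x ^ 2) +
      (2 * t) * (p x * (deriv φ x * deriv ψ x) + W x * (φ x * ψ x))) (Ioi b) :=
    e1.add (e3.const_mul _)
  rw [integral_add e13 (e2.const_mul _), integral_add e1 (e3.const_mul _), integral_const_mul,
    integral_const_mul]

lemma BF_sq_le {b : ℝ} {p W φ ψ : ℝ → ℝ} (hp : Continuous p) (hW : Continuous W)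
    (hpos : ∀ φ, TF b φ → 0 ≤ QF b p W φ)
    (h : TF b φ) (h' : TF b ψ) : BF b p W φ ψ ^ 2 ≤ QF b p W φ * QF b p W ψ := by
  have := discrim_le_zero (a := QF b p W ψ) (b := 2 * BF b p W φ ψ) (c := QF b p W φ) fun t => by
    have h1 := hpos _ (h.add (h'.smul t))
    rw [QF_comb hp hW h h'] at h1
    linarith
  unfold discrim at this
  linarith

lemma QF_sub_le {b : ℝ} {p W φ ψ : ℝ → ℝ} (hp : Continuous p) (hW : Continuous W)
    (hpos : ∀ φ, TF b φ → 0 ≤ QF b p W φ)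
    (h : TF b φ) (h' : TF b ψ) :
    QF b p W (fun x => φ x - ψ x) ≤ 2 * QF b p W φ + 2 * QF b p W ψ := by
  have h1 := hpos _ (h.add (h'.smul 1))
  have h2 := QF_comb hp hW h h' (-1)
  rw [QF_comb hp hW h h'] at h1
  have e : (fun x => φ x - ψ x) = fun x => φ x + -1 * ψ x := by
    funext x; ring
  rw [e, h2]
  linarith

/-- `L²` Cauchy property from pointwise convergence and tightness. -/
lemma L2_cauchy {b A C : ℝ} {w : ℝ → ℝ} (f : ℕ → ℝ → ℝ) (hf : ∀ n, TF b (f n))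
    (hA : ∀ n, ∫ x in Ioi b, deriv (f n) x ^ 2 ≤ A)
    (hw : Continuous w) (hw1 : ∀ x, 1 ≤ w x) (hwt : Tendsto w atTop atTop)
    (hC : ∀ n, ∫ x in Ioi b, w x * f n x ^ 2 ≤ C)
    (l : ℝ → ℝ) (hl : ∀ x, Tendsto (fun i => f i x) atTop (𝓝 (l x))) :
    ∀ η > 0, ∃ N, ∀ n ≥ N, ∀ k ≥ N, ∫ x in Ioi b, (f n x - f k x) ^ 2 ≤ η := by
  intro η hη
  have hC0 : 0 ≤ C := (integral_nonneg fun x => mul_nonneg (by linarith [hw1 x]) (by positivity)).trans (hC 0)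
  have hA0 : 0 ≤ A := (integral_nonneg fun x => by positivity).trans (hA 0)
  set δ := η / (8 * (C + 1)) with hδ
  have hδ0 : 0 < δ := by positivity
  obtain ⟨R, hR⟩ := (tendsto_atTop.1 hwt (1 / δ)).exists_forall_of_atTop
  have hdom : Tendsto (fun q : ℕ × ℕ => ∫ x in Icc b R, (f q.1 x - f q.2 x) ^ 2)
      (atTop ×ˢ atTop) (𝓝 (∫ x in Icc b R, (0:ℝ))) := by
    refine tendsto_integral_filter_of_dominated_convergence (fun _ => (A + |R - b|) ^ 2) ?_ ?_ ?_ ?_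
    · exact Eventually.of_forall fun q =>
        (((hf q.1).cont.sub (hf q.2).cont).pow 2).aestronglyMeasurable
    · refine Eventually.of_forall fun q => ?_
      refine (ae_restrict_iff' measurableSet_Icc).2 (Eventually.of_forall fun x hx => ?_)
      have hb : ∀ n, |f n x| ≤ A / 2 + |R - b| / 2 := by
        intro n
        have := (hf n).holder one_pos (hA n) b x
        rw [(hf n).zero le_rfl] at this
        have h2 : |x - b| ≤ |R - b| := by
          rw [abs_of_nonneg (by linarith [hx.1]), abs_of_nonneg (by linarith [hx.1, hx.2])]
          linarith [hx.2]
        simp at this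
        linarith
      rw [Real.norm_of_nonneg (by positivity), ← sq_abs]
      refine pow_le_pow_left₀ (abs_nonneg _) ?_ 2
      have := abs_sub (f q.1 x) (f q.2 x)
      linarith [hb q.1, hb q.2]
    · exact integrable_const _
    · refine Eventually.of_forall fun x => ?_
      have h1 : Tendsto (fun q : ℕ × ℕ => f q.1 x) (atTop ×ˢ atTop) (𝓝 (l x)) :=
        (hl x).comp tendsto_fst
      have h2 : Tendsto (fun q : ℕ × ℕ => f q.2 x) (atTop ×ˢ atTop) (𝓝 (l x)) :=
        (hl x).comp tendsto_snd
      simpa using (h1.sub h2).pow 2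
  simp only [integral_zero] at hdom
  have hev := hdom.eventually (gt_mem_nhds (show (0:ℝ) < η / 2 by linarith))
  rw [prod_atTop_atTop_eq, eventually_atTop] at hev
  obtain ⟨⟨N1, N2⟩, hN⟩ := hev
  refine ⟨max N1 N2, fun n hn k hk => ?_⟩
  have h1 := hN (n, k) ⟨le_trans (le_max_left _ _) hn, le_trans (le_max_right _ _) hk⟩
  simp only at h1
  have hsub := (hf n).sub (hf k)
  have hi1 : Integrable (fun x => (f n x - f k x) ^ 2) := by
    refine (hsub.cont.pow 2).integrable_of_hasCompactSupport ?_
    simpa [pow_two] using hsub.cpt.mul_left (f := fun x => f n x - f k x)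
  have hn' := (hf n).int00s hw
  have hk' := (hf k).int00s hw
  have hpt : ∀ x ∈ Ioi b, (f n x - f k x) ^ 2 ≤
      (Icc b R).indicator (fun x => (f n x - f k x) ^ 2) x +
        (2 * δ * (w x * f n x ^ 2) + 2 * δ * (w x * f k x ^ 2)) := by
    intro x hx
    have hw0 : 0 < w x := by linarith [hw1 x]
    by_cases hxR : x ≤ R
    · rw [indicator_of_mem (show x ∈ Icc b R from ⟨le_of_lt hx, hxR⟩)]
      have : 0 ≤ 2 * δ * (w x * f n x ^ 2) + 2 * δ * (w x * f k x ^ 2) := by positivity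
      linarith
    · rw [indicator_of_notMem (fun hh => hxR hh.2)]
      have h3 : 1 ≤ δ * w x := by
        have := hR x (not_le.1 hxR).le
        rw [div_le_iff₀ hδ0] at this
        linarith
      have h4 : (f n x - f k x) ^ 2 ≤ 2 * (f n x ^ 2 + f k x ^ 2) := by
        nlinarith [sq_nonneg (f n x + f k x)]
      have h5 : 1 * (2 * (f n x ^ 2 + f k x ^ 2)) ≤ δ * w x * (2 * (f n x ^ 2 + f k x ^ 2)) := by
        gcongr
      linarith
  have hind : Integrable ((Icc b R).indicator (fun x => (f n x - f k x) ^ 2)) (volume.restrict (Ioi b)) :=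
    ((hi1.indicator measurableSet_Icc)).restrict
  have hrhs : Integrable (fun x => 2 * δ * (w x * f n x ^ 2) + 2 * δ * (w x * f k x ^ 2)) (volume.restrict (Ioi b)) :=
    (hn'.const_mul _).add (hk'.const_mul _)
  have hsum : IntegrableOn (fun x => (Icc b R).indicator (fun x => (f n x - f k x) ^ 2) x +
        (2 * δ * (w x * f n x ^ 2) + 2 * δ * (w x * f k x ^ 2))) (Ioi b) := hind.add hrhs
  have h6 := setIntegral_mono_on hi1.integrableOn hsum measurableSet_Ioi hpt
  have h7 : ∫ x in Ioi b, (Icc b R).indicator (fun x => (f n x - f k x) ^ 2) x ≤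
      ∫ x in Icc b R, (f n x - f k x) ^ 2 := by
    rw [← integral_indicator measurableSet_Icc]
    exact setIntegral_le_integral (hi1.indicator measurableSet_Icc)
      (Eventually.of_forall fun x => indicator_nonneg (fun x _ => by positivity) x)
  have h8 : ∫ x in Ioi b, ((Icc b R).indicator (fun x => (f n x - f k x) ^ 2) x +
      (2 * δ * (w x * f n x ^ 2) + 2 * δ * (w x * f k x ^ 2))) =
      (∫ x in Ioi b, (Icc b R).indicator (fun x => (f n x - f k x) ^ 2) x) +
      (2 * δ * (∫ x in Ioi b, w x * f n x ^ 2) + 2 * δ * (∫ x in Ioi b, w x * f k x ^ 2)) := by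
    rw [integral_add hind hrhs, integral_add (hn'.const_mul _) (hk'.const_mul _),
      integral_const_mul, integral_const_mul]
  rw [h8] at h6
  have h9 : 2 * δ * (∫ x in Ioi b, w x * f n x ^ 2) ≤ 2 * δ * C := by gcongr; exact hC n
  have h10 : 2 * δ * (∫ x in Ioi b, w x * f k x ^ 2) ≤ 2 * δ * C := by gcongr; exact hC k
  have h11 : 2 * δ * C + 2 * δ * C ≤ η / 2 := by
    have : C / (C + 1) ≤ 1 := (div_le_one (by positivity)).2 (by linarith)
    calc 2 * δ * C + 2 * δ * C = η / 2 * (C / (C + 1)) := by rw [hδ]; field_simp; ring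
      _ ≤ η / 2 * 1 := by gcongr
      _ = η / 2 := by ring
  linarith

lemma TF.int2 {b : ℝ} {φ : ℝ → ℝ} (h : TF b φ) : IntegrableOn (fun x => φ x ^ 2) (Ioi b) := by
  simpa using h.int00s (c := fun _ => 1) continuous_const

lemma QF_shift {b K : ℝ} {p W φ : ℝ → ℝ} (hp : Continuous p) (hW : Continuous W) (h : TF b φ) :
    (∫ x in Ioi b, p x * deriv φ x ^ 2) + ∫ x in Ioi b, (W x + K) * φ x ^ 2 =
      QF b p W φ + K * ∫ x in Ioi b, φ x ^ 2 := by
  unfold QF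
  have e1 : IntegrableOn (fun x => p x * deriv φ x ^ 2 + W x * φ x ^ 2) (Ioi b) :=
    (h.int11s hp).add (h.int00s hW)
  rw [← integral_const_mul, ← integral_add e1 (h.int2.const_mul K),
    ← integral_add (h.int11s hp) (h.int00s (c := fun x => W x + K) (hW.add continuous_const))]
  refine integral_congr_ae (Eventually.of_forall fun x => ?_)
  simp only; ring

theorem core (b c0 K : ℝ) (p W : ℝ → ℝ) (hp : Continuous p) (hc0 : 0 < c0) (hpc : ∀ x, c0 ≤ p x)
    (hW : Continuous W) (hWt : Tendsto W atTop atTop) (hK : 0 ≤ K) (hWK : ∀ x, 1 ≤ W x + K)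
    (hpos : ∀ φ, TF b φ → 0 ≤ QF b p W φ)
    (hseq : ∀ η > 0, ∃ φ, TF b φ ∧ (∫ x in Ioi b, φ x ^ 2 = 1) ∧ QF b p W φ < η) :
    ∃ f F : ℝ → ℝ, f b = 0 ∧ (∀ x, HasDerivAt f (F x / p x) x) ∧
      (∀ x ∈ Ioi b, HasDerivAt F (W x * f x) x) ∧
      (∫ x in Ioi b, f x ^ 2) = 1 ∧
      IntegrableOn (fun x => p x * (deriv f x) ^ 2 + W x * f x ^ 2) (Ioi b) ∧
      ∫ x in Ioi b, (p x * (deriv f x) ^ 2 + W x * f x ^ 2) = 0 := by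
  have hp0 : ∀ x, 0 < p x := fun x => hc0.trans_le (hpc x)
  set w : ℝ → ℝ := fun x => W x + K with hw
  have hwc : Continuous w := hW.add continuous_const
  have hw0 : ∀ x, 0 < w x := fun x => one_pos.trans_le (hWK x)
  have hwt : Tendsto w atTop atTop := tendsto_atTop_add_const_right _ _ hWt
  have hwn : ∀ φ : ℝ → ℝ, 0 ≤ ∫ x in Ioi b, w x * φ x ^ 2 := fun φ =>
    integral_nonneg fun x => mul_nonneg (hw0 x).le (sq_nonneg _)
  have hpn : ∀ φ : ℝ → ℝ, 0 ≤ ∫ x in Ioi b, p x * deriv φ x ^ 2 := fun φ =>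
    integral_nonneg fun x => mul_nonneg (hp0 x).le (sq_nonneg _)
  have hE : ∀ φ, TF b φ → (∫ x in Ioi b, p x * deriv φ x ^ 2) + ∫ x in Ioi b, w x * φ x ^ 2 =
      QF b p W φ + K * ∫ x in Ioi b, φ x ^ 2 := fun φ h => QF_shift hp hW h
  choose s hsT hsI hsQ using fun n : ℕ => hseq (1 / ((n:ℝ) + 1)) (by positivity)
  have hle1 : ∀ n : ℕ, 1 / ((n:ℝ) + 1) ≤ 1 := fun n =>
    (div_le_one (by positivity)).2 (by linarith [(Nat.cast_nonneg n : (0:ℝ) ≤ n)])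
  have hEb : ∀ n, (∫ x in Ioi b, p x * deriv (s n) x ^ 2) + ∫ x in Ioi b, w x * s n x ^ 2 ≤ 1 + K := by
    intro n
    rw [hE _ (hsT n), hsI n]
    linarith [hsQ n, hle1 n]
  have hA : ∀ n, ∫ x in Ioi b, deriv (s n) x ^ 2 ≤ (1 + K) / c0 := by
    intro n
    rw [le_div_iff₀ hc0, mul_comm, ← integral_const_mul]
    have h1 : ∫ x in Ioi b, c0 * deriv (s n) x ^ 2 ≤ ∫ x in Ioi b, p x * deriv (s n) x ^ 2 := by
      refine integral_mono ((hsT n).int11s continuous_const) ((hsT n).int11s hp) fun x => ?_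
      exact mul_le_mul_of_nonneg_right (hpc x) (sq_nonneg _)
    linarith [hEb n, hwn (s n)]
  obtain ⟨ns, hns, l, hl⟩ := exists_subseq s hsT hA
  set f : ℕ → ℝ → ℝ := fun i => s (ns i) with hf
  have hfT : ∀ n, TF b (f n) := fun n => hsT _
  have hfI : ∀ n, ∫ x in Ioi b, f n x ^ 2 = 1 := fun n => hsI _
  have hfQ : ∀ n, QF b p W (f n) ≤ 1 / ((n:ℝ) + 1) := by
    intro n
    refine (hsQ (ns n)).le.trans ?_
    have : (n:ℝ) ≤ ns n := by exact_mod_cast hns.id_le n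
    gcongr
  have hlim0 : Tendsto (fun n : ℕ => 1 / ((n:ℝ) + 1)) atTop (𝓝 0) :=
    tendsto_one_div_add_atTop_nhds_zero_nat
  have hfQ0 : Tendsto (fun n => QF b p W (f n)) atTop (𝓝 0) :=
    squeeze_zero (fun n => hpos _ (hfT n)) hfQ hlim0
  have hcau := L2_cauchy (A := (1 + K) / c0) (C := 1 + K) f hfT (fun n => hA _) hwc hWK hwt
    (fun n => by linarith [hEb (ns n), hpn (s (ns n))]) l hl
  have hcauE : ∀ η > 0, ∃ N, ∀ n ≥ N, ∀ k ≥ N,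
      (∫ x in Ioi b, p x * deriv (fun x => f n x - f k x) x ^ 2) +
        ∫ x in Ioi b, w x * (f n x - f k x) ^ 2 ≤ η := by
    intro η hη
    obtain ⟨N1, hN1⟩ := hcau (η / (2 * (K + 1))) (by positivity)
    obtain ⟨N2, hN2⟩ := eventually_atTop.1 (hfQ0.eventually (gt_mem_nhds (show (0:ℝ) < η / 8 by linarith)))
    refine ⟨max N1 N2, fun n hn k hk => ?_⟩
    rw [hE _ ((hfT n).sub (hfT k))]
    have h1 := hN1 n (le_trans (le_max_left _ _) hn) k (le_trans (le_max_left _ _) hk)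
    have h2 := hN2 n (le_trans (le_max_right _ _) hn)
    have h3 := hN2 k (le_trans (le_max_right _ _) hk)
    have h4 := QF_sub_le hp hW hpos (hfT n) (hfT k)
    have h5 : K * ∫ x in Ioi b, (f n x - f k x) ^ 2 ≤ K * (η / (2 * (K + 1))) := by gcongr
    have h6 : K * (η / (2 * (K + 1))) ≤ η / 2 := by
      have : K / (K + 1) ≤ 1 := (div_le_one (by positivity)).2 (by linarith)
      calc K * (η / (2 * (K + 1))) = η / 2 * (K / (K + 1)) := by field_simp
        _ ≤ η / 2 * 1 := by gcongr
        _ = η / 2 := by ring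
    linarith
  set sp : ℝ → ℝ := fun x => √(p x) with hsp
  have hspc : Continuous sp := hp.sqrt
  have hsp0 : ∀ x, 0 < sp x := fun x => Real.sqrt_pos.2 (hp0 x)
  have hspsq : ∀ x, sp x ^ 2 = p x := fun x => Real.sq_sqrt (hp0 x).le
  set sw : ℝ → ℝ := fun x => √(w x) with hsw
  have hswc : Continuous sw := hwc.sqrt
  have hswsq : ∀ x, sw x ^ 2 = w x := fun x => Real.sq_sqrt (hw0 x).le
  set μ : Measure ℝ := volume.restrict (Ioi b) with hμ
  have m1 : ∀ (φ : ℝ → ℝ) (c : ℝ → ℝ), TF b φ → Continuous c → MemLp (fun x => c x * deriv φ x) 2 μ :=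
    fun φ c h hc => ((hc.mul h.contd).memLp_of_hasCompactSupport (μ := volume) h.cptd.mul_left).restrict _
  have m0 : ∀ (φ : ℝ → ℝ) (c : ℝ → ℝ), TF b φ → Continuous c → MemLp (fun x => c x * φ x) 2 μ :=
    fun φ c h hc => ((hc.mul h.cont).memLp_of_hasCompactSupport (μ := volume) h.cpt.mul_left).restrict _
  obtain ⟨G, hG, hGv, hGs, -⟩ := L2_complete (μ := μ) (fun n x => sp x * deriv (f n) x)
    (fun n => m1 _ _ (hfT n) hspc) (by
      intro η hη
      obtain ⟨N, hN⟩ := hcauE η hη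
      refine ⟨N, fun n hn k hk => ?_⟩
      refine le_trans (le_of_eq ?_) ((le_add_of_nonneg_right (hwn fun x => f n x - f k x)).trans (hN n hn k hk))
      refine integral_congr_ae (Eventually.of_forall fun x => ?_)
      simp only
      rw [(hfT n).deriv_sub' (hfT k), ← hspsq]; ring)
  obtain ⟨H, hH, -, hHs, nh, hnh, hHae⟩ := L2_complete (μ := μ) (fun n x => sw x * f n x)
    (fun n => m0 _ _ (hfT n) hswc) (by
      intro η hη
      obtain ⟨N, hN⟩ := hcauE η hη
      refine ⟨N, fun n hn k hk => ?_⟩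
      refine le_trans (le_of_eq ?_) ((le_add_of_nonneg_left (hpn fun x => f n x - f k x)).trans (hN n hn k hk))
      refine integral_congr_ae (Eventually.of_forall fun x => ?_)
      simp only
      rw [← hswsq]; ring)
  obtain ⟨J, hJ, hJv, hJs, nj, hnj, hJae⟩ := L2_complete (μ := μ) f
    (fun n => by simpa using m0 _ (fun _ => 1) (hfT n) continuous_const) hcau
  set g : ℝ → ℝ := (Ioi b).indicator (fun x => G x / sp x) with hg
  have hspi : ∀ x, 1 / sp x ≤ 1 / √c0 := fun x =>
    one_div_le_one_div_of_le (Real.sqrt_pos.2 hc0) (Real.sqrt_le_sqrt (hpc x))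
  have hGsp : MemLp (fun x => G x / sp x) 2 μ := by
    refine hG.of_le_mul (c := 1 / √c0)
      (hG.1.mul (hspc.inv₀ fun x => (hsp0 x).ne').aestronglyMeasurable) ?_
    refine Eventually.of_forall fun x => ?_
    rw [norm_div, Real.norm_of_nonneg (hsp0 x).le, div_eq_mul_one_div, mul_comm]
    exact mul_le_mul_of_nonneg_right (hspi x) (norm_nonneg _)
  have hgL : MemLp g 2 volume := (memLp_indicator_iff_restrict measurableSet_Ioi).2 hGsp
  have hgl : LocallyIntegrable g := hgL.locallyIntegrable (by norm_num)
  have hgi : ∀ x y, IntervalIntegrable g volume x y := fun x y =>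
    (hgl.integrableOn_isCompact isCompact_uIcc).intervalIntegrable
  set f0 : ℝ → ℝ := fun x => ∫ t in b..x, g t with hf0
  have hf0c : Continuous f0 := intervalIntegral.continuous_primitive hgi b
  have hlf0 : ∀ x, Tendsto (fun n => f n x) atTop (𝓝 (f0 x)) := by
    intro x
    rcases le_or_gt x b with hx | hx
    · have h1 : f0 x = 0 := by
        refine intervalIntegral.integral_zero_ae (Eventually.of_forall fun t ht => ?_)
        rw [hg, indicator_of_notMem]
        have := ht.2
        rw [max_eq_left hx] at this
        simpa using this
      simp only [(hfT _).zero hx, h1]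
      exact tendsto_const_nhds
    · have hv : MemLp ((Ioc b x).indicator fun t => 1 / sp t) 2 μ := by
        refine MemLp.restrict _ ?_
        rw [memLp_indicator_iff_restrict measurableSet_Ioc]
        refine MemLp.of_bound
          ((continuous_const.div hspc fun x => (hsp0 x).ne').aestronglyMeasurable) (1 / √c0) ?_
        refine Eventually.of_forall fun t => ?_
        rw [Real.norm_of_nonneg (one_div_pos.2 (hsp0 t)).le]
        exact hspi t
      have h1 := hGv _ hv
      have hcv : ∀ u : ℝ → ℝ, ∫ t, u t * (Ioc b x).indicator (fun t => 1 / sp t) t ∂μ =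
          ∫ t in b..x, u t / sp t := by
        intro u
        rw [intervalIntegral.integral_of_le hx.le, ← integral_indicator measurableSet_Ioc, hμ,
          setIntegral_eq_integral_of_forall_compl_eq_zero]
        · refine integral_congr_ae (Eventually.of_forall fun t => ?_)
          by_cases ht : t ∈ Ioc b x
          · simp only [indicator_of_mem ht]; ring
          · simp only [indicator_of_notMem ht]; ring
        · intro t ht
          rw [indicator_of_notMem (fun hh => ht hh.1), mul_zero]
      simp only [hcv] at h1
      have h2 : ∀ n, ∫ t in b..x, sp t * deriv (f n) t / sp t = f n x := by
        intro n
        have : ∀ t, sp t * deriv (f n) t / sp t = deriv (f n) t := fun t => by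
          field_simp [(hsp0 t).ne']
        simp only [this]
        rw [intervalIntegral.integral_deriv_eq_sub (fun x _ => (hfT n).diff x)
          ((hfT n).contd.intervalIntegrable _ _), (hfT n).zero le_rfl, sub_zero]
      simp only [h2] at h1
      have h3 : ∫ t in b..x, G t / sp t = f0 x := by
        rw [hf0]
        simp only
        rw [intervalIntegral.integral_of_le hx.le, intervalIntegral.integral_of_le hx.le]
        refine setIntegral_congr_fun measurableSet_Ioc fun t ht => ?_
        simp only [hg]
        rw [indicator_of_mem (show t ∈ Ioi b from ht.1)]
      rwa [h3] at h1
  have hHf : ∀ᵐ x ∂μ, H x = sw x * f0 x := by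
    filter_upwards [hHae] with x hx
    exact tendsto_nhds_unique hx (((hlf0 x).comp hnh.tendsto_atTop).const_mul _)
  have hJf : ∀ᵐ x ∂μ, J x = f0 x := by
    filter_upwards [hJae] with x hx
    exact tendsto_nhds_unique hx ((hlf0 x).comp hnj.tendsto_atTop)
  have hGg : ∀ᵐ x ∂μ, G x = sp x * g x := by
    refine (ae_restrict_iff' measurableSet_Ioi).2 (Eventually.of_forall fun x hx => ?_)
    rw [hg, indicator_of_mem hx]
    field_simp [(hsp0 x).ne']
  have hI1 : ∫ x in Ioi b, f0 x ^ 2 = 1 := by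
    have e : (fun n => ∫ x, f n x ^ 2 ∂μ) = fun _ => (1:ℝ) := funext hfI
    rw [e] at hJs
    rw [tendsto_nhds_unique tendsto_const_nhds hJs]
    refine integral_congr_ae ?_
    filter_upwards [hJf] with x hx
    rw [hx]
  have hi0 : Integrable (fun x => f0 x ^ 2) μ := by
    refine hJ.integrable_sq.congr ?_
    filter_upwards [hJf] with x hx
    rw [hx]
  have hig : Integrable (fun x => p x * g x ^ 2) μ := by
    refine hG.integrable_sq.congr ?_
    filter_upwards [hGg] with x hx
    rw [hx, ← hspsq]; ring
  have hiw : Integrable (fun x => w x * f0 x ^ 2) μ := by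
    refine hH.integrable_sq.congr ?_
    filter_upwards [hHf] with x hx
    rw [hx, ← hswsq]; ring
  have hEn : (∫ x, p x * g x ^ 2 ∂μ) + ∫ x, w x * f0 x ^ 2 ∂μ = K := by
    have h1 : ∫ x, p x * g x ^ 2 ∂μ = ∫ x, G x ^ 2 ∂μ := by
      refine integral_congr_ae ?_
      filter_upwards [hGg] with x hx
      rw [hx, ← hspsq]; ring
    have h2 : ∫ x, w x * f0 x ^ 2 ∂μ = ∫ x, H x ^ 2 ∂μ := by
      refine integral_congr_ae ?_
      filter_upwards [hHf] with x hx
      rw [hx, ← hswsq]; ring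
    rw [h1, h2]
    refine tendsto_nhds_unique (hGs.add hHs) ?_
    have h3 : ∀ n, (∫ x, (sp x * deriv (f n) x) ^ 2 ∂μ) + ∫ x, (sw x * f n x) ^ 2 ∂μ =
        QF b p W (f n) + K := by
      intro n
      have := hE _ (hfT n)
      rw [hfI, mul_one] at this
      rw [← this]
      simp only [mul_pow, hspsq, hswsq, hμ]
    simp only [h3]
    simpa using hfQ0.add_const K
  have hiE : Integrable (fun x => p x * g x ^ 2 + W x * f0 x ^ 2) μ := by
    have := (hig.add hiw).sub (hi0.const_mul K)
    refine this.congr (Eventually.of_forall fun x => ?_)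
    simp only [hw, Pi.add_apply, Pi.sub_apply]; ring
  have hE0 : ∫ x, (p x * g x ^ 2 + W x * f0 x ^ 2) ∂μ = 0 := by
    have h1 : ∫ x, (p x * g x ^ 2 + W x * f0 x ^ 2) ∂μ =
        ∫ x, ((p x * g x ^ 2 + w x * f0 x ^ 2) - K * f0 x ^ 2) ∂μ := by
      refine integral_congr_ae (Eventually.of_forall fun x => ?_)
      simp only [hw]; ring
    have h2 : Integrable (fun x => p x * g x ^ 2 + w x * f0 x ^ 2) μ := hig.add hiw
    rw [h1, integral_sub h2 (hi0.const_mul K), integral_add hig hiw, hEn, integral_const_mul, hI1]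
    ring
  have hweak : ∀ φ, TF b φ → (∫ x, p x * g x * deriv φ x) + ∫ x, W x * f0 x * φ x = 0 := by
    intro φ hφ
    have h1 : Tendsto (fun n => BF b p W (f n) φ) atTop (𝓝 0) := by
      have h2 : Tendsto (fun n => √(QF b p W (f n) * QF b p W φ)) atTop (𝓝 0) := by
        have := (hfQ0.mul_const (QF b p W φ)).sqrt
        simpa using this
      refine squeeze_zero_norm (fun n => ?_) h2
      exact Real.abs_le_sqrt (BF_sq_le hp hW hpos (hfT n) hφ)
    have h2 : ∀ n, BF b p W (f n) φ = (∫ x, (sp x * deriv (f n) x) * (sp x * deriv φ x) ∂μ) +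
        ∫ x, f n x * (W x * φ x) ∂μ := by
      intro n
      unfold BF
      rw [integral_add ((hfT n).int11 hφ hp) ((hfT n).int00 hφ hW)]
      congr 1
      · refine integral_congr_ae (Eventually.of_forall fun x => ?_)
        simp only; rw [← hspsq]; ring
      · refine integral_congr_ae (Eventually.of_forall fun x => ?_)
        simp only; ring
    simp only [h2] at h1
    have h3 := tendsto_nhds_unique h1 ((hGv _ (m1 _ _ hφ hspc)).add (hJv _ (m0 _ _ hφ hW)))
    rw [h3]
    congr 1
    · rw [← setIntegral_eq_integral_of_forall_compl_eq_zero (s := Ioi b)]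
      · refine integral_congr_ae ?_
        filter_upwards [hGg] with x hx
        rw [hx, ← hspsq]; ring
      · intro x hx
        rw [hφ.zerod (by simpa using hx), mul_zero]
    · rw [← setIntegral_eq_integral_of_forall_compl_eq_zero (s := Ioi b)]
      · refine integral_congr_ae ?_
        filter_upwards [hJf] with x hx
        rw [hx]; ring
      · intro x hx
        rw [hφ.zero (by simpa using hx), mul_zero]
  have hWf : Continuous fun x => W x * f0 x := hW.mul hf0c
  set F : ℝ → ℝ := fun x => ∫ t in b..x, W t * f0 t with hF
  have hFd : ∀ x, HasDerivAt F (W x * f0 x) x := fun x =>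
    intervalIntegral.integral_hasDerivAt_right (hWf.intervalIntegrable _ _)
      (hWf.stronglyMeasurableAtFilter _ _) hWf.continuousAt
  have hFc : Continuous F := continuous_iff_continuousAt.2 fun x => (hFd x).continuousAt
  have hpg : LocallyIntegrable (fun x => p x * g x) := hgl.continuous_mul hp
  obtain ⟨c, hc⟩ := duBois b (fun x => p x * g x - F x) (hpg.sub hFc.locallyIntegrable) (by
    intro φ hφ
    have i1 : Integrable (fun x => p x * g x * deriv φ x) := by
      simpa using hpg.integrable_smul_right_of_hasCompactSupport hφ.contd hφ.cptd
    have i2 : Integrable (fun x => F x * deriv φ x) :=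
      (hFc.mul hφ.contd).integrable_of_hasCompactSupport hφ.cptd.mul_left
    have i3 : Integrable (fun x => W x * f0 x * φ x) :=
      (hWf.mul hφ.cont).integrable_of_hasCompactSupport hφ.cpt.mul_left
    have i4 : Integrable (fun x => F x * φ x) :=
      (hFc.mul hφ.cont).integrable_of_hasCompactSupport hφ.cpt.mul_left
    have hparts := integral_mul_deriv_eq_deriv_mul_of_integrable (u := F) (v := φ)
      (u' := fun x => W x * f0 x) (v' := deriv φ) (fun x _ => hFd x)
      (fun x _ => (hφ.diff x).hasDerivAt) i2 i3 i4
    simp only [sub_mul]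
    rw [integral_sub i1 i2, hparts]
    linarith [hweak φ hφ])
  have hqc : Continuous fun x => (F x + c) / p x :=
    (hFc.add continuous_const).div hp fun x => (hp0 x).ne'
  have hgq : ∀ᵐ x, x ∈ Ioi b → g x = (F x + c) / p x := by
    filter_upwards [hc] with x hx hxb
    rw [eq_div_iff (hp0 x).ne']
    linarith [hx hxb]
  set f1 : ℝ → ℝ := fun x => ∫ t in b..x, (F t + c) / p t with hf1
  have hf1d : ∀ x, HasDerivAt f1 ((F x + c) / p x) x := fun x =>
    intervalIntegral.integral_hasDerivAt_right (hqc.intervalIntegrable _ _)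
      (hqc.stronglyMeasurableAtFilter _ _) hqc.continuousAt
  have hf10 : ∀ x ∈ Ioi b, f1 x = f0 x := by
    intro x hx
    refine intervalIntegral.integral_congr_ae ?_
    filter_upwards [hgq] with t ht ht2
    rw [uIoc_of_le (le_of_lt hx)] at ht2
    exact (ht ht2.1).symm
  have hEeq : (fun x => p x * g x ^ 2 + W x * f0 x ^ 2) =ᵐ[μ]
      fun x => p x * (deriv f1 x) ^ 2 + W x * f1 x ^ 2 := by
    refine (ae_restrict_iff' measurableSet_Ioi).2 ?_
    filter_upwards [hgq] with x hx hxb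
    rw [hx hxb, hf10 x hxb, (hf1d x).deriv]
  refine ⟨f1, fun x => F x + c, by simp [hf1], hf1d, fun x hx => ?_, ?_, hiE.congr hEeq, ?_⟩
  · rw [hf10 x hx]
    exact (hFd x).add_const c
  · rw [← hI1]
    exact setIntegral_congr_fun measurableSet_Ioi fun x hx => by simp only [hf10 x hx]
  · rw [← hE0]
    exact (integral_congr_ae hEeq).symm

lemma QF_const {b ν : ℝ} {p W φ : ℝ → ℝ} (hp : Continuous p) (hW : Continuous W) (h : TF b φ) :
    QF b p (fun x => W x - ν) φ = QF b p W φ - ν * ∫ x in Ioi b, φ x ^ 2 := by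
  unfold QF
  have e1 : IntegrableOn (fun x => p x * deriv φ x ^ 2 + W x * φ x ^ 2) (Ioi b) :=
    (h.int11s hp).add (h.int00s hW)
  rw [← integral_const_mul, ← integral_sub e1 (h.int2.const_mul ν)]
  refine integral_congr_ae (Eventually.of_forall fun x => ?_)
  simp only; ring

lemma QF_scale {b t : ℝ} {p W φ : ℝ → ℝ} (h : TF b φ) :
    QF b p W (fun x => t * φ x) = t ^ 2 * QF b p W φ := by
  unfold QF
  rw [← integral_const_mul]
  refine integral_congr_ae (Eventually.of_forall fun x => ?_)
  simp only [h.deriv_smul']; ring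

lemma TF.normalize {b : ℝ} {φ : ℝ → ℝ} (h : TF b φ) (hpos : 0 < ∫ x in Ioi b, φ x ^ 2) (p W : ℝ → ℝ) :
    ∃ ψ, TF b ψ ∧ (∫ x in Ioi b, ψ x ^ 2 = 1) ∧
      QF b p W φ = (∫ x in Ioi b, φ x ^ 2) * QF b p W ψ := by
  set I := ∫ x in Ioi b, φ x ^ 2 with hI
  have hs : (√I)⁻¹ ^ 2 = I⁻¹ := by rw [inv_pow, Real.sq_sqrt hpos.le]
  refine ⟨fun x => (√I)⁻¹ * φ x, h.smul _, ?_, ?_⟩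
  · simp only [mul_pow, hs]
    rw [integral_const_mul, ← hI, inv_mul_cancel₀ hpos.ne']
  · rw [QF_scale h, hs, mul_inv_cancel_left₀ hpos.ne']

lemma TF.sq_pos {b : ℝ} {φ : ℝ → ℝ} (h : TF b φ) (hne : φ ≠ 0) : 0 < ∫ x in Ioi b, φ x ^ 2 := by
  rw [setIntegral_eq_integral_of_forall_compl_eq_zero]
  · refine Continuous.integral_pos_of_hasCompactSupport_nonneg_nonzero (h.cont.pow 2) ?_
      (fun x => sq_nonneg _) (x := (Function.ne_iff.1 hne).choose) ?_
    · have e : (fun x => φ x ^ 2) = φ * φ := by funext x; simp [pow_two]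
      exact e ▸ h.cpt.mul_left (f := φ)
    · exact pow_ne_zero 2 (Function.ne_iff.1 hne).choose_spec
  · intro x hx
    rw [h.zero (by simpa using hx)]; simp

section final
variable (M a : ℝ) (m : ℤ) (ω lam μ ε : ℝ)

/-- The left end point. -/
noncomputable def bb : ℝ := rPlus M a + ε
/-- Extended `Δ`. -/
noncomputable def pp (x : ℝ) : ℝ := Delta M a (max x (bb M a ε))
/-- Extended `V / Δ`. -/
noncomputable def WW (x : ℝ) : ℝ :=
  Vpot M a m ω lam μ (max x (bb M a ε)) / Delta M a (max x (bb M a ε))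

lemma Delta_cont : Continuous (Delta M a) := by unfold Delta; fun_prop

lemma Vpot_cont : Continuous (Vpot M a m ω lam μ) := by
  have := Delta_cont M a
  unfold Vpot; fun_prop

lemma pp_cont : Continuous (pp M a ε) :=
  (Delta_cont M a).comp (continuous_id.max continuous_const)

variable {M a m ω lam μ ε}

lemma Delta_ge (hε : 0 < ε) {x : ℝ} (hx : bb M a ε ≤ x) : ε ^ 2 ≤ Delta M a x := by
  unfold bb rPlus at hx
  unfold Delta rPlus rMinus
  have := Real.sqrt_nonneg (M ^ 2 - a ^ 2)
  rw [pow_two]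
  apply mul_le_mul <;> linarith

lemma pp_ge (hε : 0 < ε) (x : ℝ) : ε ^ 2 ≤ pp M a ε x := Delta_ge hε (le_max_right _ _)

lemma pp_eq {x : ℝ} (hx : x ∈ Ioi (bb M a ε)) : pp M a ε x = Delta M a x := by
  unfold pp; rw [max_eq_left (le_of_lt hx)]

lemma WW_eq {x : ℝ} (hx : x ∈ Ioi (bb M a ε)) :
    WW M a m ω lam μ ε x = Vpot M a m ω lam μ x / Delta M a x := by
  unfold WW; rw [max_eq_left (le_of_lt hx)]

lemma WW_cont (hε : 0 < ε) : Continuous (WW M a m ω lam μ ε) :=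
  ((Vpot_cont M a m ω lam μ).comp (continuous_id.max continuous_const)).div (pp_cont M a ε)
    fun x => ((pow_pos hε 2).trans_le (pp_ge hε x)).ne'

lemma quartic_nonneg {A4 A3 A2 A1 A0 x : ℝ} (h4 : 0 < A4) (hx1 : 1 ≤ x)
    (hx : (|A3| + |A2| + |A1| + |A0|) / A4 ≤ x) :
    0 ≤ A4 * x ^ 4 + A3 * x ^ 3 + A2 * x ^ 2 + A1 * x + A0 := by
  rw [div_le_iff₀ h4] at hx
  have x2 : x ^ 2 ≤ x ^ 3 := pow_le_pow_right₀ hx1 (by norm_num)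
  have x1 : x ≤ x ^ 3 := by simpa using pow_le_pow_right₀ hx1 (show 1 ≤ 3 by norm_num)
  have x0 : 1 ≤ x ^ 3 := one_le_pow₀ hx1
  have x3 : 0 ≤ x ^ 3 := by linarith
  have e3 : -(|A3| * x ^ 3) ≤ A3 * x ^ 3 := by nlinarith [neg_abs_le A3]
  have e2 : -(|A2| * x ^ 3) ≤ A2 * x ^ 2 := by nlinarith [neg_abs_le A2, abs_nonneg A2, sq_nonneg x]
  have e1 : -(|A1| * x ^ 3) ≤ A1 * x := by nlinarith [neg_abs_le A1, abs_nonneg A1]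
  have e0 : -(|A0| * x ^ 3) ≤ A0 := by nlinarith [neg_abs_le A0, abs_nonneg A0]
  have := mul_le_mul_of_nonneg_right hx x3
  nlinarith

lemma WW_tendsto (ha : |a| < M) (hμ : ω ^ 2 < μ ^ 2) (hε : 0 < ε) :
    Tendsto (WW M a m ω lam μ ε) atTop atTop := by
  set c := (μ ^ 2 - ω ^ 2) / 2 with hc
  have hc0 : 0 < c := by rw [hc]; linarith
  have hsq : Real.sqrt (M ^ 2 - a ^ 2) ^ 2 = M ^ 2 - a ^ 2 := by
    refine Real.sq_sqrt ?_
    have := sq_lt_sq' (by linarith [abs_nonneg a]) ha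
    rw [sq_abs] at this
    linarith
  have hD : ∀ x, Delta M a x = x ^ 2 - 2 * M * x + a ^ 2 := by
    intro x
    unfold Delta rPlus rMinus
    linear_combination -hsq
  have hlow : Tendsto (fun x : ℝ => c * x ^ 2) atTop atTop :=
    (tendsto_pow_atTop (by norm_num)).const_mul_atTop hc0
  refine tendsto_atTop_mono' _ ?_ hlow
  set L := lam + a ^ 2 * ω ^ 2 with hL
  set A3 := -2 * M * μ ^ 2 + 2 * c * M
  set A2 := -2 * a ^ 2 * ω ^ 2 + L + a ^ 2 * μ ^ 2 - c * a ^ 2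
  set A1 := 4 * M * a * m * ω - 2 * M * L
  set A0 := -ω ^ 2 * a ^ 4 - a ^ 2 * m ^ 2 + a ^ 2 * L
  filter_upwards [eventually_gt_atTop (bb M a ε), eventually_ge_atTop 1,
    eventually_ge_atTop ((|A3| + |A2| + |A1| + |A0|) / c)] with x h1 h2 h3
  have h4 := quartic_nonneg hc0 h2 h3
  have hDp : 0 < Delta M a x := (pow_pos hε 2).trans_le (Delta_ge hε (le_of_lt h1))
  rw [WW_eq h1, le_div_iff₀ hDp]
  have h5 : Vpot M a m ω lam μ x - c * x ^ 2 * Delta M a x =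
      c * x ^ 4 + A3 * x ^ 3 + A2 * x ^ 2 + A1 * x + A0 := by
    unfold Vpot
    rw [hD, ← hL]
    simp only [A3, A2, A1, A0, hc]
    ring
  linarith

lemma WW_bdd (ha : |a| < M) (hμ : ω ^ 2 < μ ^ 2) (hε : 0 < ε) :
    ∃ K, ∀ x, -K ≤ WW M a m ω lam μ ε x := by
  obtain ⟨R, hR⟩ := (tendsto_atTop.1 (WW_tendsto (m := m) (lam := lam) ha hμ hε) 0).exists_forall_of_atTop
  obtain ⟨k, hk⟩ := (isCompact_Icc (a := bb M a ε) (b := R)).bddBelow_image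
    (WW_cont (M := M) (a := a) (m := m) (ω := ω) (lam := lam) (μ := μ) hε).continuousOn
  refine ⟨|k|, fun x => ?_⟩
  have hx : WW M a m ω lam μ ε x = WW M a m ω lam μ ε (max x (bb M a ε)) := by
    unfold WW; simp
  rw [hx]
  rcases le_total (max x (bb M a ε)) R with h | h
  · have := hk (mem_image_of_mem _ ⟨le_max_right _ _, h⟩)
    linarith [neg_abs_le k]
  · linarith [hR _ h, abs_nonneg k]

/-- Admissible complex test functions. -/
lemma cplx {h : ℝ → ℂ} {b : ℝ} (h1 : ContDiff ℝ (⊤ : ℕ∞) h) (h2 : HasCompactSupport h)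
    (h3 : tsupport h ⊆ Ioi b) :
    TF b (fun x => (h x).re) ∧ TF b (fun x => (h x).im) ∧
    (∀ x, ‖h x‖ ^ 2 = (h x).re ^ 2 + (h x).im ^ 2) ∧
    (∀ x, ‖deriv h x‖ ^ 2 = deriv (fun x => (h x).re) x ^ 2 + deriv (fun x => (h x).im) x ^ 2) := by
  have hd : ∀ x, HasDerivAt h (deriv h x) x := fun x =>
    ((h1.differentiable (by simp)) x).hasDerivAt
  have hre : ∀ x, deriv (fun x => (h x).re) x = (deriv h x).re := fun x =>
    (Complex.reCLM.hasFDerivAt.comp_hasDerivAt x (hd x)).deriv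
  have him : ∀ x, deriv (fun x => (h x).im) x = (deriv h x).im := fun x =>
    (Complex.imCLM.hasFDerivAt.comp_hasDerivAt x (hd x)).deriv
  have hn : ∀ z : ℂ, ‖z‖ ^ 2 = z.re ^ 2 + z.im ^ 2 := fun z => by
    rw [Complex.sq_norm, Complex.normSq_apply]; ring
  refine ⟨⟨Complex.reCLM.contDiff.comp h1, h2.comp_left (g := Complex.re) rfl, ?_⟩,
    ⟨Complex.imCLM.contDiff.comp h1, h2.comp_left (g := Complex.im) rfl, ?_⟩,
    fun x => hn _, fun x => by rw [hn, hre, him]⟩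
  · exact (tsupport_comp_subset (g := Complex.re) rfl h).trans h3
  · exact (tsupport_comp_subset (g := Complex.im) rfl h).trans h3

lemma Lag_eq (hε : 0 < ε) {h : ℝ → ℂ} (h1 : ContDiff ℝ (⊤ : ℕ∞) h) (h2 : HasCompactSupport h)
    (h3 : tsupport h ⊆ Ioi (bb M a ε)) :
    Lag M a m ω lam μ ε h =
      QF (bb M a ε) (pp M a ε) (WW M a m ω lam μ ε) (fun x => (h x).re) +
      QF (bb M a ε) (pp M a ε) (WW M a m ω lam μ ε) (fun x => (h x).im) := by
  obtain ⟨t1, t2, e1, e2⟩ := cplx h1 h2 h3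
  have hW := WW_cont (M := M) (a := a) (m := m) (ω := ω) (lam := lam) (μ := μ) hε
  have hp := pp_cont M a ε
  unfold QF Lag
  have i1 : IntegrableOn (fun x => pp M a ε x * deriv (fun x => (h x).re) x ^ 2 +
      WW M a m ω lam μ ε x * (h x).re ^ 2) (Ioi (bb M a ε)) := (t1.int11s hp).add (t1.int00s hW)
  have i2 : IntegrableOn (fun x => pp M a ε x * deriv (fun x => (h x).im) x ^ 2 +
      WW M a m ω lam μ ε x * (h x).im ^ 2) (Ioi (bb M a ε)) := (t2.int11s hp).add (t2.int00s hW)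
  refine Eq.trans ?_ (integral_add i1 i2)
  refine setIntegral_congr_fun measurableSet_Ioi fun x hx => ?_
  simp only [e1, e2, pp_eq (M := M) (a := a) (ε := ε) hx, WW_eq (M := M) (a := a) (ε := ε) hx]
  ring

lemma norm_eq {b : ℝ} {h : ℝ → ℂ} (h1 : ContDiff ℝ (⊤ : ℕ∞) h) (h2 : HasCompactSupport h)
    (h3 : tsupport h ⊆ Ioi b) :
    ∫ x in Ioi b, ‖h x‖ ^ 2 =
      (∫ x in Ioi b, (h x).re ^ 2) + ∫ x in Ioi b, (h x).im ^ 2 := by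
  obtain ⟨t1, t2, e1, e2⟩ := cplx h1 h2 h3
  rw [← integral_add t1.int2 t2.int2]
  simp only [e1]

lemma mem_LagVals (hε : 0 < ε) {φ : ℝ → ℝ} (hφ : TF (bb M a ε) φ)
    (hI : ∫ x in Ioi (bb M a ε), φ x ^ 2 = 1) :
    QF (bb M a ε) (pp M a ε) (WW M a m ω lam μ ε) φ ∈ LagVals M a m ω lam μ ε := by
  have h1 : ContDiff ℝ (⊤ : ℕ∞) (fun x => (φ x : ℂ)) := Complex.ofRealCLM.contDiff.comp hφ.smooth
  have h2 : HasCompactSupport (fun x => (φ x : ℂ)) := hφ.cpt.comp_left (g := fun x : ℝ => (x : ℂ)) rfl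
  have h3 : tsupport (fun x => (φ x : ℂ)) ⊆ Ioi (bb M a ε) :=
    (tsupport_comp_subset (g := fun x : ℝ => (x : ℂ)) rfl φ).trans hφ.supp
  refine ⟨fun x => (φ x : ℂ), h1, h2, h3, ?_, ?_⟩
  · have e : ∀ x, ‖(φ x : ℂ)‖ ^ 2 = φ x ^ 2 := fun x => by simp
    simp only [e]
    exact hI
  · rw [Lag_eq hε h1 h2 h3]
    simp [QF]

end final

/-- the infimum `ν_μ^{(ε)}` is finite and attained by a minimizer which
solves the Euler–Lagrange equation. -/
theorem stmt7 (M a : ℝ) (hM : 0 < M) (ha : |a| < M) (m : ℤ)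
    (ω lam μ ε : ℝ) (hω : ω ≠ 0) (hsup : a * m - 2 * M * rPlus M a * ω = 0)
    (hlam : (|m| : ℝ) * (|m| + 1) ≤ lam + a ^ 2 * ω ^ 2)
    (hμ : ω ^ 2 < μ ^ 2) (hε : 0 < ε) :
    (LagVals M a m ω lam μ ε).Nonempty ∧ BddBelow (LagVals M a m ω lam μ ε) ∧
    ∃ f : ℝ → ℝ,
      ContinuousOn f (Ici (rPlus M a + ε)) ∧
      f (rPlus M a + ε) = 0 ∧
      ContDiffOn ℝ 2 f (Ioi (rPlus M a + ε)) ∧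
      (∫ r in Ioi (rPlus M a + ε), (f r) ^ 2) = 1 ∧
      (∫ r in Ioi (rPlus M a + ε),
        (Delta M a r * (deriv f r) ^ 2
          + Vpot M a m ω lam μ r / Delta M a r * (f r) ^ 2))
        = sInf (LagVals M a m ω lam μ ε) ∧
      ∀ r ∈ Ioi (rPlus M a + ε),
        Delta M a r * deriv (fun s => Delta M a s * deriv f s) r
          - Vpot M a m ω lam μ r * f r
          + sInf (LagVals M a m ω lam μ ε) * Delta M a r * f r = 0 := by
  change (LagVals M a m ω lam μ ε).Nonempty ∧ BddBelow (LagVals M a m ω lam μ ε) ∧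
    ∃ f : ℝ → ℝ,
      ContinuousOn f (Ici (bb M a ε)) ∧
      f (bb M a ε) = 0 ∧
      ContDiffOn ℝ 2 f (Ioi (bb M a ε)) ∧
      (∫ r in Ioi (bb M a ε), (f r) ^ 2) = 1 ∧
      (∫ r in Ioi (bb M a ε),
        (Delta M a r * (deriv f r) ^ 2
          + Vpot M a m ω lam μ r / Delta M a r * (f r) ^ 2))
        = sInf (LagVals M a m ω lam μ ε) ∧
      ∀ r ∈ Ioi (bb M a ε),
        Delta M a r * deriv (fun s => Delta M a s * deriv f s) r
          - Vpot M a m ω lam μ r * f r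
          + sInf (LagVals M a m ω lam μ ε) * Delta M a r * f r = 0
  set b := bb M a ε with hb
  set p := pp M a ε with hpd
  set W := WW M a m ω lam μ ε with hWd
  have hp : Continuous p := pp_cont M a ε
  have hW : Continuous W := WW_cont hε
  have hp0 : ∀ x, 0 < p x := fun x => (pow_pos hε 2).trans_le (pp_ge hε x)
  obtain ⟨K, hK⟩ : ∃ K, ∀ x, -K ≤ W x := WW_bdd ha hμ hε
  have hQK : ∀ φ, TF b φ → -K * (∫ x in Ioi b, φ x ^ 2) ≤ QF b p W φ := by
    intro φ hφ
    have h1 := QF_shift (K := K) hp hW hφ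
    have h2 : 0 ≤ ∫ x in Ioi b, p x * deriv φ x ^ 2 :=
      integral_nonneg fun x => mul_nonneg (hp0 x).le (sq_nonneg _)
    have h3 : 0 ≤ ∫ x in Ioi b, (W x + K) * φ x ^ 2 :=
      integral_nonneg fun x => mul_nonneg (by linarith [hK x]) (sq_nonneg _)
    linarith
  have hne : (LagVals M a m ω lam μ ε).Nonempty := by
    obtain ⟨φ, hφ, hφ1⟩ := TF.exists_unit b
    obtain ⟨ψ, hψ, hψ1, -⟩ := hφ.normalize (hφ.sq_pos (by rintro rfl; simp at hφ1)) p W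
    exact ⟨_, mem_LagVals hε hψ hψ1⟩
  have hbdd : BddBelow (LagVals M a m ω lam μ ε) := by
    refine ⟨-K, ?_⟩
    rintro x ⟨h, h1, h2, h3, h4, rfl⟩
    have h3' : tsupport h ⊆ Ioi b := h3
    have h4' : ∫ r in Ioi b, ‖h r‖ ^ 2 = 1 := h4
    obtain ⟨t1, t2, -, -⟩ := cplx h1 h2 h3'
    rw [norm_eq h1 h2 h3'] at h4'
    rw [Lag_eq hε h1 h2 h3']
    have := hQK _ t1
    have := hQK _ t2
    have e : -K = -K * (∫ x in Ioi b, (h x).re ^ 2) + -K * (∫ x in Ioi b, (h x).im ^ 2) := by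
      rw [← mul_add, h4', mul_one]
    rw [e]
    linarith
  refine ⟨hne, hbdd, ?_⟩
  set ν := sInf (LagVals M a m ω lam μ ε) with hν
  have hW1 : Continuous fun x => W x - ν := hW.sub continuous_const
  have hpos : ∀ φ, TF b φ → 0 ≤ QF b p (fun x => W x - ν) φ := by
    intro φ hφ
    by_cases h0 : φ = 0
    · subst h0; simp [QF]
    · have hI := hφ.sq_pos h0
      obtain ⟨ψ, hψ, hψ1, hψ2⟩ := hφ.normalize hI p (fun x => W x - ν)
      rw [hψ2]
      refine mul_nonneg hI.le ?_
      rw [QF_const hp hW hψ, hψ1, mul_one, sub_nonneg]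
      exact csInf_le hbdd (mem_LagVals hε hψ hψ1)
  have hseq : ∀ η > 0, ∃ φ, TF b φ ∧ (∫ x in Ioi b, φ x ^ 2 = 1) ∧
      QF b p (fun x => W x - ν) φ < η := by
    intro η hη
    obtain ⟨x, ⟨h, h1, h2, h3, h4, rfl⟩, hx⟩ := exists_lt_of_csInf_lt hne
      (show sInf (LagVals M a m ω lam μ ε) < ν + η / 2 by rw [← hν]; linarith)
    have h3' : tsupport h ⊆ Ioi b := h3
    have h4' : ∫ r in Ioi b, ‖h r‖ ^ 2 = 1 := h4
    obtain ⟨t1, t2, -, -⟩ := cplx h1 h2 h3'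
    rw [norm_eq h1 h2 h3'] at h4'
    rw [Lag_eq hε h1 h2 h3'] at hx
    have key : ∀ φ, TF b φ → 1 / 2 ≤ ∫ x in Ioi b, φ x ^ 2 →
        QF b p (fun x => W x - ν) φ < η / 2 → ∃ φ, TF b φ ∧ (∫ x in Ioi b, φ x ^ 2 = 1) ∧
          QF b p (fun x => W x - ν) φ < η := by
      intro φ hφ hI hQ
      obtain ⟨ψ, hψ, hψ1, hψ2⟩ := hφ.normalize (by linarith) p (fun x => W x - ν)
      refine ⟨ψ, hψ, hψ1, ?_⟩
      rw [hψ2] at hQ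
      have := mul_le_mul_of_nonneg_right hI (hpos ψ hψ)
      linarith
    have q1 := QF_const (ν := ν) hp hW t1
    have q2 := QF_const (ν := ν) hp hW t2
    have p1 := hpos _ t1
    have p2 := hpos _ t2
    have hsum : QF b p (fun x => W x - ν) (fun x => (h x).re) +
        QF b p (fun x => W x - ν) (fun x => (h x).im) < η / 2 := by
      have e : ν = ν * (∫ x in Ioi b, (h x).re ^ 2) + ν * (∫ x in Ioi b, (h x).im ^ 2) := by
        rw [← mul_add, h4', mul_one]
      rw [q1, q2]
      linarith
    rcases le_total (1 / 2) (∫ x in Ioi b, (h x).re ^ 2) with hh | hh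
    · exact key _ t1 hh (by linarith)
    · exact key _ t2 (by linarith) (by linarith)
  obtain ⟨f, F, hfb, hfd, hFd, hfI, hfi, hf0⟩ := core b (ε ^ 2) (|K + ν + 1|) p (fun x => W x - ν) hp
    (pow_pos hε 2) (fun x => pp_ge hε x) hW1
    (tendsto_atTop_add_const_right _ (-ν) (WW_tendsto ha hμ hε)) (abs_nonneg _)
    (fun x => by linarith [hK x, le_abs_self (K + ν + 1)]) hpos hseq
  have hfc : Continuous f := continuous_iff_continuousAt.2 fun x => (hfd x).continuousAt
  refine ⟨f, hfc.continuousOn, hfb, ?_, hfI, ?_, ?_⟩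
  · have hF1 : ContDiffOn ℝ 1 F (Ioi b) := by
      rw [show (1 : WithTop ℕ∞) = 0 + 1 by norm_num, contDiffOn_succ_iff_deriv_of_isOpen isOpen_Ioi]
      refine ⟨fun x hx => (hFd x hx).differentiableAt.differentiableWithinAt, by simp, ?_⟩
      rw [contDiffOn_zero]
      exact (hW1.mul hfc).continuousOn.congr fun x hx => (hFd x hx).deriv
    have hD1 : ContDiff ℝ 1 (Delta M a) := by unfold Delta; fun_prop
    rw [show (2 : WithTop ℕ∞) = 1 + 1 by norm_num, contDiffOn_succ_iff_deriv_of_isOpen isOpen_Ioi]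
    refine ⟨fun x _ => (hfd x).differentiableAt.differentiableWithinAt, by simp, ?_⟩
    refine (hF1.div hD1.contDiffOn fun x hx => ?_).congr fun x hx => ?_
    · rw [← pp_eq hx]; exact (hp0 x).ne'
    · rw [(hfd x).deriv, hpd, pp_eq hx]; rfl
  · have hi2 : IntegrableOn (fun x => f x ^ 2) (Ioi b) := by
      by_contra hh
      rw [integral_undef hh] at hfI
      exact zero_ne_one hfI
    have e : ∫ r in Ioi b, (Delta M a r * (deriv f r) ^ 2
          + Vpot M a m ω lam μ r / Delta M a r * (f r) ^ 2) =
        ∫ x in Ioi b, ((p x * (deriv f x) ^ 2 + (W x - ν) * f x ^ 2) + ν * f x ^ 2) := by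
      refine setIntegral_congr_fun measurableSet_Ioi fun x hx => ?_
      simp only [hpd, hWd]
      rw [pp_eq hx, WW_eq hx]; ring
    rw [e, integral_add hfi (hi2.const_mul ν), hf0, integral_const_mul, hfI]
    ring
  · intro r hr
    have hev : (fun s => Delta M a s * deriv f s) =ᶠ[𝓝 r] F := by
      filter_upwards [isOpen_Ioi.mem_nhds hr] with s hs
      rw [(hfd s).deriv, ← pp_eq hs]
      exact mul_div_cancel₀ _ (hp0 s).ne'
    rw [hev.deriv_eq, (hFd r hr).deriv]
    have hD : Delta M a r ≠ 0 := by rw [← pp_eq hr]; exact (hp0 r).ne'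
    simp only [hWd]
    rw [WW_eq hr]
    field_simp
    ring
end

section
/- Let ω ∈ ℝ \ {0} satisfy a·m − 2·M·r₊·ω = 0 and let λ ∈ ℝ satisfy λ + a²·ω² ≥ |m|·(|m|+1). Then there exists δ > 0 such that for every real μ with ω² < μ² < ω² + δ there exist a real number ν ≤ 0 and a nonzero function f : (r₊, ∞) → ℂ satisfying Δ·(Δ·f')' − V·f + ν·Δ·f = 0 on (r₊, ∞), such that f extends to a C¹ function on [r₊, ∞) and f decays exponentially at infinity. Moreover ν may be taken equal to ν_μ := inf{ ∫_{r₊}^{∞} ( Δ·|f'|² + (V/Δ)·|f|² ) dr : f smooth, compactly supported in (r₊, ∞), ∫ |f|² dr = 1 }, which is a non-decreasing function of μ². -/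
open Real Set MeasureTheory Filter Topology ComplexConjugate

/-- `ν_μ`: the infimum of the Lagrangian `∫_{r₊}^∞ (Δ |f'|² + (V/Δ)|f|²)` over smooth test
functions compactly supported in `(r₊, ∞)` of unit `L²` norm. -/
noncomputable def nuMu (M a : ℝ) (m : ℤ) (ω lam μ : ℝ) : ℝ :=
  sInf {x : ℝ | ∃ f : ℝ → ℂ, ContDiff ℝ (⊤ : ℕ∞) f ∧ HasCompactSupport f ∧
    tsupport f ⊆ Ioi (rPlus M a) ∧
    (∫ r in Ioi (rPlus M a), ‖f r‖ ^ 2) = 1 ∧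
    x = ∫ r in Ioi (rPlus M a),
      (Delta M a r * ‖deriv f r‖ ^ 2
        + Vpot M a m ω lam μ r / Delta M a r * ‖f r‖ ^ 2)}

/-- averaged flux operator -/
noncomputable def gop (d : ℝ) (q : ℝ → ℝ) (u : ℝ × ℝ → ℝ) (z : ℝ × ℝ) : ℝ :=
  (|z.2| + d)⁻¹ * ∫ θ in (0:ℝ)..1, (q (z.2 * θ) - z.1) * u (z.1, z.2 * θ)

/-- weight exponent -/
noncomputable def phi (d C : ℝ) (z : ℝ × ℝ) : ℝ :=
  (2 / d) * (C * (z.2 + z.2 ^ 3 / 3) + |z.1| * z.2)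

lemma gop_cont (d : ℝ) (hd : 0 < d) (q : ℝ → ℝ) (hq : Continuous q) (u : ℝ × ℝ → ℝ)
    (hu : Continuous u) : Continuous (gop d q u) := by
  unfold gop
  apply Continuous.mul
  · apply Continuous.inv₀
    · fun_prop
    · intro z; positivity
  · apply intervalIntegral.continuous_parametric_intervalIntegral_of_continuous' (f := fun (z : ℝ × ℝ) θ => (q (z.2 * θ) - z.1) * u (z.1, z.2 * θ))
    simp only [Function.uncurry_def]
    fun_prop

lemma phi_cont (d C : ℝ) : Continuous (phi d C) := by
  unfold phi; fun_prop

lemma phi_mono (d C : ℝ) (hd : 0 < d) (hC : 0 ≤ C) (ν x y : ℝ) (hx : 0 ≤ x) (hxy : x ≤ y) :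
    phi d C (ν, x) ≤ phi d C (ν, y) := by
  unfold phi
  simp only
  gcongr

lemma phi_deriv (d C ν x : ℝ) : HasDerivAt (fun x => phi d C (ν, x))
    ((2 / d) * (C * (1 + x ^ 2) + |ν|)) x := by
  unfold phi
  simp only
  have h1 : HasDerivAt (fun x : ℝ => x) 1 x := hasDerivAt_id x
  have := ((((h1.add ((h1.pow 3).div_const 3)).const_mul C).add (h1.const_mul |ν|)).const_mul (2/d))
  exact this.congr_deriv (by push_cast; ring)

lemma gop_sub (d : ℝ) (q : ℝ → ℝ) (hq : Continuous q) (u v : ℝ × ℝ → ℝ)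
    (hu : Continuous u) (hv : Continuous v) (z : ℝ × ℝ) :
    gop d q u z - gop d q v z = gop d q (fun z => u z - v z) z := by
  unfold gop
  rw [← mul_sub, ← intervalIntegral.integral_sub]
  · congr 1
    apply intervalIntegral.integral_congr
    intro θ _
    simp only; ring
  · apply Continuous.intervalIntegrable; fun_prop
  · apply Continuous.intervalIntegrable; fun_prop

lemma gop_bound (d : ℝ) (hd : 0 < d) (q : ℝ → ℝ) (C : ℝ) (hC0 : 0 ≤ C)
    (hC : ∀ x, |q x| ≤ C * (1 + x ^ 2)) (u : ℝ × ℝ → ℝ) (H ν : ℝ) (hH : 0 ≤ H)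
    (hb : ∀ x, |u (ν, x)| ≤ exp (phi d C (ν, x)) * H) (s : ℝ) (hs : 0 ≤ s) :
    |gop d q u (ν, s)| ≤ (1 / 2) * H * (exp (phi d C (ν, s)) * ((2 / d) * (C * (1 + s ^ 2) + |ν|))) := by
  unfold gop
  simp only
  have h1 : ‖∫ θ in (0:ℝ)..1, (q (s * θ) - ν) * u (ν, s * θ)‖ ≤
      ((C * (1 + s ^ 2) + |ν|) * (exp (phi d C (ν, s)) * H)) * |1 - 0| := by
    apply intervalIntegral.norm_integral_le_of_norm_le_const
    intro θ hθ
    rw [uIoc_of_le (by norm_num)] at hθ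
    have h0 : 0 ≤ s * θ := mul_nonneg hs hθ.1.le
    have h1 : s * θ ≤ s := mul_le_of_le_one_right hs hθ.2
    rw [norm_mul]
    have e1 : ‖q (s * θ) - ν‖ ≤ C * (1 + s ^ 2) + |ν| := by
      calc ‖q (s * θ) - ν‖ ≤ ‖q (s * θ)‖ + ‖ν‖ := norm_sub_le _ _
        _ ≤ C * (1 + (s * θ) ^ 2) + |ν| := by
          have := hC (s * θ)
          simpa using this
        _ ≤ _ := by gcongr
    have e2 : ‖u (ν, s * θ)‖ ≤ exp (phi d C (ν, s)) * H := by
      calc ‖u (ν, s * θ)‖ ≤ _ := hb _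
        _ ≤ _ := by
          gcongr
          exact phi_mono d C hd hC0 _ _ _ h0 h1
    exact mul_le_mul e1 e2 (norm_nonneg _) (by positivity)
  rw [abs_mul, abs_of_pos (by positivity : 0 < (|s| + d)⁻¹)]
  have h2 : (|s| + d)⁻¹ ≤ d⁻¹ := by gcongr; linarith [abs_nonneg s]
  calc _ ≤ d⁻¹ * (((C * (1 + s ^ 2) + |ν|) * (exp (phi d C (ν, s)) * H)) * |1 - 0|) := by
        apply mul_le_mul h2 h1 (abs_nonneg _) (by positivity)
    _ = _ := by
      simp; field_simp

lemma gop_int_bound (d : ℝ) (hd : 0 < d) (q : ℝ → ℝ) (hq : Continuous q) (C : ℝ) (hC0 : 0 ≤ C)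
    (hC : ∀ x, |q x| ≤ C * (1 + x ^ 2)) (u : ℝ × ℝ → ℝ) (hu : Continuous u) (H ν : ℝ) (hH : 0 ≤ H)
    (hb : ∀ x, |u (ν, x)| ≤ exp (phi d C (ν, x)) * H) (x : ℝ) (hx : 0 ≤ x) :
    exp (-phi d C (ν, x)) * |∫ s in (0:ℝ)..x, gop d q u (ν, s)| ≤ (1 / 2) * H := by
  have hderiv : ∀ s ∈ uIcc 0 x, HasDerivAt (fun s => exp (phi d C (ν, s)))
      (exp (phi d C (ν, s)) * ((2 / d) * (C * (1 + s ^ 2) + |ν|))) s := fun s _ =>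
    (phi_deriv d C ν s).exp
  have hp : Continuous fun s : ℝ => phi d C (ν, s) := (phi_cont d C).comp (by fun_prop)
  have hci : IntervalIntegrable (fun s => exp (phi d C (ν, s)) * ((2 / d) * (C * (1 + s ^ 2) + |ν|)))
      volume 0 x := by
    apply Continuous.intervalIntegrable
    fun_prop
  have hF := intervalIntegral.integral_eq_sub_of_hasDerivAt hderiv hci
  have h1 : ‖∫ s in (0:ℝ)..x, gop d q u (ν, s)‖ ≤ ∫ s in (0:ℝ)..x,
      (1 / 2) * H * (exp (phi d C (ν, s)) * ((2 / d) * (C * (1 + s ^ 2) + |ν|))) := by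
    apply intervalIntegral.norm_integral_le_of_norm_le hx
    · refine Eventually.of_forall fun s hs => ?_
      exact gop_bound d hd q C hC0 hC u H ν hH hb s hs.1.le
    · exact hci.const_mul _
  rw [intervalIntegral.integral_const_mul, hF] at h1
  have h0 : 0 ≤ exp (phi d C (ν, 0)) := (exp_pos _).le
  calc exp (-phi d C (ν, x)) * |∫ s in (0:ℝ)..x, gop d q u (ν, s)|
      ≤ exp (-phi d C (ν, x)) * ((1 / 2) * H * (exp (phi d C (ν, x)))) := by
        gcongr
        refine h1.trans ?_
        gcongr
        linarith
    _ = (1 / 2) * H := by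
      rw [exp_neg]; field_simp

lemma gop_intcont (d : ℝ) (hd : 0 < d) (q : ℝ → ℝ) (hq : Continuous q) (u : ℝ × ℝ → ℝ)
    (hu : Continuous u) : Continuous (fun z : ℝ × ℝ => ∫ s in (0:ℝ)..z.2, gop d q u (z.1, s)) := by
  have := gop_cont d hd q hq u hu
  apply intervalIntegral.continuous_parametric_intervalIntegral_of_continuous (f := fun (z : ℝ × ℝ) s => gop d q u (z.1, s))
  · simp only [Function.uncurry_def]
    fun_prop
  · fun_prop

open BoundedContinuousFunction in
lemma ode_fix (d : ℝ) (hd : 0 < d) (q : ℝ → ℝ) (hq : Continuous q) (C : ℝ) (hC0 : 0 ≤ C)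
    (hC : ∀ x, |q x| ≤ C * (1 + x ^ 2)) : ∃ u : ℝ × ℝ → ℝ, Continuous u ∧
    ∀ ν x, 0 ≤ x → u (ν, x) = 1 + ∫ s in (0:ℝ)..x, gop d q u (ν, s) := by
  let U : ((ℝ × ℝ) →ᵇ ℝ) → ℝ × ℝ → ℝ := fun h z => exp (phi d C z) * h z
  have hpc := phi_cont d C
  have hU : ∀ h, Continuous (U h) := fun h => by
    have := h.continuous
    simp only [U]; fun_prop
  have hUb : ∀ (h : (ℝ × ℝ) →ᵇ ℝ) ν x, |U h (ν, x)| ≤ exp (phi d C (ν, x)) * ‖h‖ := fun h ν x => by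
    simp only [U]
    rw [abs_mul, abs_of_pos (exp_pos _)]
    gcongr
    exact h.norm_coe_le_norm _
  let Tf : ((ℝ × ℝ) →ᵇ ℝ) → ℝ × ℝ → ℝ := fun h z =>
    exp (-phi d C (z.1, |z.2|)) * (1 + ∫ s in (0:ℝ)..|z.2|, gop d q (U h) (z.1, s))
  have hT : ∀ h, Continuous (Tf h) := fun h => by
    have h1 := gop_intcont d hd q hq (U h) (hU h)
    have h2 : Continuous (fun z : ℝ × ℝ => ∫ s in (0:ℝ)..|z.2|, gop d q (U h) (z.1, s)) :=
      h1.comp (g := fun z : ℝ × ℝ => ∫ s in (0:ℝ)..z.2, gop d q (U h) (z.1, s)) (f := fun z : ℝ × ℝ => (z.1, |z.2|)) (by fun_prop)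
    simp only [Tf]
    fun_prop
  have hphi0 : ∀ ν x, 0 ≤ x → exp (-phi d C (ν, x)) ≤ 1 := fun ν x hx => by
    rw [exp_le_one_iff]
    have : 0 ≤ phi d C (ν, x) := by unfold phi; positivity
    linarith
  have hTb : ∀ h z, ‖Tf h z‖ ≤ 1 + 1 / 2 * ‖h‖ := fun h z => by
    have h1 := gop_int_bound d hd q hq C hC0 hC (U h) (hU h) ‖h‖ z.1 (norm_nonneg _) (hUb h z.1)
      |z.2| (abs_nonneg _)
    have h2 := hphi0 z.1 |z.2| (abs_nonneg _)
    simp only [Tf]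
    rw [mul_add, mul_one]
    refine (norm_add_le _ _).trans ?_
    rw [norm_mul, Real.norm_eq_abs, Real.norm_eq_abs, abs_of_pos (exp_pos _)]
    exact add_le_add h2 h1
  let T : ((ℝ × ℝ) →ᵇ ℝ) → ((ℝ × ℝ) →ᵇ ℝ) := fun h =>
    BoundedContinuousFunction.ofNormedAddCommGroup (Tf h) (hT h) _ (hTb h)
  have hcon : ContractingWith (1 / 2) T := by
    refine ⟨by
      rw [← NNReal.coe_lt_coe]; norm_num, ?_⟩
    apply LipschitzWith.of_dist_le_mul
    intro h h'
    rw [BoundedContinuousFunction.dist_le (by positivity)]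
    intro z
    have e : T h z - T h' z = exp (-phi d C (z.1, |z.2|)) *
        ∫ s in (0:ℝ)..|z.2|, gop d q (U (h - h')) (z.1, s) := by
      have e1 : ∀ s, gop d q (U (h - h')) (z.1, s) =
          gop d q (U h) (z.1, s) - gop d q (U h') (z.1, s) := fun s => by
        rw [gop_sub d q hq _ _ (hU h) (hU h')]
        congr 1
        ext y
        simp only [U, BoundedContinuousFunction.coe_sub, Pi.sub_apply]
        ring
      simp only [T, BoundedContinuousFunction.coe_ofNormedAddCommGroup, Tf, e1]
      have hg : ∀ h, IntervalIntegrable (fun s => gop d q (U h) (z.1, s)) volume 0 |z.2| := fun h => by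
        apply Continuous.intervalIntegrable
        exact (gop_cont d hd q hq _ (hU h)).comp (by fun_prop)
      rw [intervalIntegral.integral_sub (hg h) (hg h')]
      ring
    rw [dist_eq_norm, dist_eq_norm, e, norm_mul, Real.norm_eq_abs, Real.norm_eq_abs, abs_of_pos (exp_pos _)]
    have := gop_int_bound d hd q hq C hC0 hC (U (h - h')) (hU _) ‖h - h'‖ z.1 (norm_nonneg _) (hUb _ z.1)
      |z.2| (abs_nonneg _)
    simpa using this
  let h := hcon.fixedPoint T
  have hfix : T h = h := hcon.fixedPoint_isFixedPt
  refine ⟨U h, hU h, fun ν x hx => ?_⟩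
  have : h (ν, x) = Tf h (ν, x) := by
    conv_lhs => rw [← hfix]
    rfl
  simp only [U] at this ⊢
  rw [this]
  simp only [Tf, abs_of_nonneg hx, U]
  rw [← mul_assoc, ← exp_add]
  simp

/-- Regular solutions with parameter. -/
structure Sol (p d : ℝ) (q : ℝ → ℝ) (F G : ℝ → ℝ → ℝ) : Prop where
  cF : Continuous (Function.uncurry F)
  cG : Continuous (Function.uncurry G)
  F0 : ∀ ν, F ν p = 1
  dF : ∀ ν r, HasDerivAt (F ν) (G ν r) r
  dG : ∀ ν r, p < r → HasDerivAt (fun s => (s - p) * (s - p + d) * G ν s) ((q r - ν) * F ν r) r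

lemma ode_sol (p d : ℝ) (hd : 0 < d) (q : ℝ → ℝ) (hq : ContinuousOn q (Ici p)) (C : ℝ) (hC0 : 0 ≤ C)
    (hC : ∀ r, p ≤ r → |q r| ≤ C * (1 + (r - p) ^ 2)) : ∃ F G, Sol p d q F G := by
  let Q : ℝ → ℝ := fun x => q (p + max x 0)
  have hQ : Continuous Q := by
    apply hq.comp_continuous (by fun_prop)
    intro x; simp
  have hQC : ∀ x, |Q x| ≤ C * (1 + x ^ 2) := fun x => by
    refine (hC _ (by simp)).trans ?_
    gcongr ?_ * (1 + ?_)
    rw [add_sub_cancel_left]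
    rcases le_total x 0 with h | h
    · rw [max_eq_right h]; simp; positivity
    · rw [max_eq_left h]
  obtain ⟨u, hu, hue⟩ := ode_fix d hd Q hQ C hC0 hQC
  have hg := gop_cont d hd Q hQ u hu
  let G : ℝ → ℝ → ℝ := fun ν r => gop d Q u (ν, r - p)
  have hI := gop_intcont d hd Q hQ u hu
  let F : ℝ → ℝ → ℝ := fun ν r => 1 + ∫ s in (0:ℝ)..(r - p), gop d Q u (ν, s)
  have hFu : ∀ ν r, p ≤ r → F ν r = u (ν, r - p) := fun ν r h => (hue ν (r - p) (by linarith)).symm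
  refine ⟨F, G, ?_, ?_, ?_, ?_, ?_⟩
  · have h2 : Continuous (fun z : ℝ × ℝ => ∫ s in (0:ℝ)..(z.2 - p), gop d Q u (z.1, s)) :=
      hI.comp (g := fun z : ℝ × ℝ => ∫ s in (0:ℝ)..z.2, gop d Q u (z.1, s)) (f := fun z : ℝ × ℝ => (z.1, z.2 - p)) (by fun_prop)
    simp only [F, Function.uncurry_def]
    fun_prop
  · simp only [G, Function.uncurry_def]
    fun_prop
  · intro ν; simp [F]
  · intro ν r
    have hc : Continuous (fun s => gop d Q u (ν, s)) := by fun_prop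
    have h1 : HasDerivAt (fun x => ∫ s in (0:ℝ)..x, gop d Q u (ν, s)) (gop d Q u (ν, r - p)) (r - p) :=
      intervalIntegral.integral_hasDerivAt_right (hc.intervalIntegrable _ _)
        (hc.stronglyMeasurableAtFilter _ _) hc.continuousAt
    have h2 := (h1.comp_sub_const r p).const_add 1
    exact h2
  · intro ν r hr
    have hc : Continuous (fun s => (Q s - ν) * u (ν, s)) := by fun_prop
    have h1 : HasDerivAt (fun x => ∫ s in (0:ℝ)..x, (Q s - ν) * u (ν, s)) ((Q (r - p) - ν) * u (ν, r - p)) (r - p) :=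
      intervalIntegral.integral_hasDerivAt_right (hc.intervalIntegrable _ _)
        (hc.stronglyMeasurableAtFilter _ _) hc.continuousAt
    have h2 := (h1.comp_sub_const r p)
    have h3 : Q (r - p) = q r := by
      simp only [Q]; rw [max_eq_left (by linarith)]; congr 1; ring
    rw [hFu ν r hr.le, ← h3]
    refine h2.congr_of_eventuallyEq ?_
    filter_upwards [lt_mem_nhds hr] with s hs
    simp only [G, gop]
    rw [abs_of_pos (by linarith)]
    have : s - p + d ≠ 0 := by linarith
    have h4 := intervalIntegral.mul_integral_comp_mul_left (f := fun x => (Q x - ν) * u (ν, x)) (a := 0) (b := 1) (s - p)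
    simp only [mul_zero, mul_one] at h4
    rw [← h4]
    field_simp

lemma pos_of_step (f : ℝ → ℝ) (a : ℝ) (hf : Continuous f) (ha : 0 < f a)
    (h : ∀ c > a, (∀ x ∈ Ico a c, 0 < f x) → 0 < f c) : ∀ x, a ≤ x → 0 < f x := by
  intro b hab
  by_contra hb
  have hne : (Icc a b ∩ {x | f x ≤ 0}).Nonempty := ⟨b, ⟨hab, le_rfl⟩, not_lt.mp hb⟩
  have hcomp : IsCompact (Icc a b ∩ {x | f x ≤ 0}) :=
    isCompact_Icc.inter_right (isClosed_le hf continuous_const)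
  obtain ⟨c, ⟨hc1, hc2⟩, hc3⟩ := hcomp.exists_isLeast hne
  have hac : a < c := by
    rcases eq_or_lt_of_le hc1.1 with h1 | h1
    · subst h1; exact absurd ha (not_lt.mpr hc2)
    · exact h1
  have := h c hac (fun x hx => by
    by_contra hx2
    have := hc3 ⟨⟨hx.1, hx.2.le.trans hc1.2⟩, not_lt.mp hx2⟩
    exact absurd hx.2 (not_lt.mpr this))
  exact absurd this (not_lt.mpr hc2)

section
variable {p d : ℝ} {q : ℝ → ℝ} {F G : ℝ → ℝ → ℝ}

lemma Sol.contF (S : Sol p d q F G) (ν : ℝ) : Continuous (F ν) :=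
  S.cF.comp (by fun_prop : Continuous fun r : ℝ => (ν, r))

lemma Sol.contG (S : Sol p d q F G) (ν : ℝ) : Continuous (G ν) :=
  S.cG.comp (by fun_prop : Continuous fun r : ℝ => (ν, r))

lemma Sol.contF' (S : Sol p d q F G) (r : ℝ) : Continuous (fun ν => F ν r) :=
  S.cF.comp (by fun_prop : Continuous fun ν : ℝ => (ν, r))

lemma Sol.contG' (S : Sol p d q F G) (r : ℝ) : Continuous (fun ν => G ν r) :=
  S.cG.comp (by fun_prop : Continuous fun ν : ℝ => (ν, r))

lemma Sol.contP (S : Sol p d q F G) (ν : ℝ) :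
    Continuous (fun s => (s - p) * (s - p + d) * G ν s) := by
  have := S.contG ν
  fun_prop

lemma Sol.extend (S : Sol p d q F G) (hd : 0 < d) (ν b : ℝ) (hb : p ≤ b) (hF : 0 < F ν b)
    (hP : 0 ≤ (b - p) * (b - p + d) * G ν b) (hq : ∀ r, b ≤ r → ν ≤ q r) :
    ∀ r, b ≤ r → 0 < F ν r := by
  apply pos_of_step _ _ (S.contF ν) hF
  intro c hc hpos
  have hmono : MonotoneOn (fun s => (s - p) * (s - p + d) * G ν s) (Icc b c) := by
    apply monotoneOn_of_hasDerivWithinAt_nonneg (convex_Icc b c) (S.contP ν).continuousOn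
      (f' := fun r => (q r - ν) * F ν r)
    · intro x hx
      rw [interior_Icc] at hx
      exact (S.dG ν x (by linarith [hx.1])).hasDerivWithinAt
    · intro x hx
      rw [interior_Icc] at hx
      exact mul_nonneg (by linarith [hq x hx.1.le]) (hpos x ⟨hx.1.le, hx.2⟩).le
  have hmF : MonotoneOn (F ν) (Icc b c) := by
    apply monotoneOn_of_hasDerivWithinAt_nonneg (convex_Icc b c) (S.contF ν).continuousOn
      (f' := G ν)
    · intro x hx
      exact (S.dF ν x).hasDerivWithinAt
    · intro x hx
      rw [interior_Icc] at hx
      have h1 := hmono ⟨le_rfl, hc.le⟩ ⟨hx.1.le, hx.2.le⟩ hx.1.le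
      have h2 : 0 < (x - p) * (x - p + d) := mul_pos (by linarith [hx.1]) (by linarith [hx.1])
      exact nonneg_of_mul_nonneg_right (hP.trans h1) h2
  exact hF.trans_le (hmF ⟨le_rfl, hc.le⟩ ⟨hc.le, le_rfl⟩ hc.le)

lemma Sol.nodouble (S : Sol p d q F G) (hd : 0 < d) (hq : ContinuousOn q (Ici p)) (ν b : ℝ) (hb : p < b)
    (hF : F ν b = 0) (hG : G ν b = 0) : False := by
  have h0 : ∀ᶠ x in 𝓝[>] p, 0 < F ν x ∧ x < b := by
    have h1 : ∀ᶠ x in 𝓝 p, 0 < F ν x :=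
      (S.contF ν).continuousAt.eventually (lt_mem_nhds (by rw [S.F0]; norm_num))
    have h2 : ∀ᶠ x in 𝓝 p, x < b := gt_mem_nhds hb
    exact (h1.and h2).filter_mono nhdsWithin_le_nhds
  obtain ⟨e, ⟨he1, he2⟩, he3⟩ := (h0.and self_mem_nhdsWithin).exists
  have he3 : p < e := he3
  let D : ℝ → ℝ := fun s => (s - p) * (s - p + d)
  have hDpos : ∀ x ∈ Icc e b, 0 < D x := fun x hx =>
    mul_pos (by linarith [hx.1]) (by linarith [hx.1])
  have hcont : ContinuousOn (fun x => (D x)⁻¹ + |q x - ν|) (Icc e b) := by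
    apply ContinuousOn.add
    · apply ContinuousOn.inv₀
      · simp only [D]; fun_prop
      · intro x hx; exact (hDpos x hx).ne'
    · apply ContinuousOn.abs
      apply ContinuousOn.sub _ continuousOn_const
      exact hq.mono (fun x hx => by simp only [mem_Ici]; linarith [hx.1])
  obtain ⟨K, hK⟩ := isCompact_Icc.exists_bound_of_continuousOn hcont
  let P : ℝ → ℝ := fun s => (s - p) * (s - p + d) * G ν s
  have hmono : MonotoneOn (fun x => (F ν x ^ 2 + P x ^ 2) * exp (K * x)) (Icc e b) := by
    apply monotoneOn_of_hasDerivWithinAt_nonneg (convex_Icc e b)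
      (f' := fun x => (2 * F ν x * G ν x + 2 * P x * ((q x - ν) * F ν x)) * exp (K * x) +
        (F ν x ^ 2 + P x ^ 2) * (exp (K * x) * K))
    · have h1 := S.contF ν
      have h2 := S.contP ν
      apply Continuous.continuousOn
      simp only [P]
      fun_prop
    · intro x hx
      rw [interior_Icc] at hx
      have h1 := (S.dF ν x).pow 2
      have h2 := (S.dG ν x (by linarith [hx.1])).pow 2
      have h3 : HasDerivAt (fun x => exp (K * x)) (exp (K * x) * K) x := by
        have := ((hasDerivAt_id x).const_mul K).exp
        simpa using this
      have h4 := (h1.add h2).mul h3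
      refine (h4.congr_deriv ?_).hasDerivWithinAt
      simp only [P, Pi.add_apply, Pi.pow_apply]
      push_cast
      ring
    · intro x hx
      rw [interior_Icc] at hx
      have hx' : x ∈ Icc e b := ⟨hx.1.le, hx.2.le⟩
      have hD := hDpos x hx'
      have hK' := hK x hx'
      rw [Real.norm_eq_abs, abs_of_nonneg (by positivity)] at hK'
      have hGP : G ν x = (D x)⁻¹ * P x := by
        show G ν x = (D x)⁻¹ * (D x * G ν x)
        rw [inv_mul_cancel_left₀ hD.ne']
      have : (2 * F ν x * G ν x + 2 * P x * ((q x - ν) * F ν x)) * exp (K * x) +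
        (F ν x ^ 2 + P x ^ 2) * (exp (K * x) * K) =
        ((2 * F ν x * P x) * ((D x)⁻¹ + (q x - ν)) + (F ν x ^ 2 + P x ^ 2) * K) * exp (K * x) := by
        rw [hGP]; ring
      rw [this]
      apply mul_nonneg _ (exp_pos _).le
      have a1 : |(2 * F ν x * P x) * ((D x)⁻¹ + (q x - ν))| ≤ (F ν x ^ 2 + P x ^ 2) * K := by
        rw [abs_mul]
        apply mul_le_mul
        · rw [abs_le]; constructor <;> nlinarith [sq_nonneg (F ν x - P x), sq_nonneg (F ν x + P x)]
        · refine (abs_add_le _ _).trans ?_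
          rw [abs_of_pos (inv_pos.mpr hD)]; exact hK'
        · positivity
        · positivity
      linarith [(abs_le.mp a1).1]
  have h1 := hmono ⟨le_rfl, he2.le⟩ ⟨he2.le, le_rfl⟩ he2.le
  simp only [P, hF, hG] at h1
  have h2 : 0 < (F ν e ^ 2 + ((e - p) * (e - p + d) * G ν e) ^ 2) * exp (K * e) := by positivity
  simp at h1
  linarith

lemma Sol.pos_of_nonneg (S : Sol p d q F G) (hd : 0 < d) (hq : ContinuousOn q (Ici p)) (ν : ℝ)
    (h : ∀ r, p ≤ r → 0 ≤ F ν r) : ∀ r, p ≤ r → 0 < F ν r := by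
  intro r hr
  rcases eq_or_lt_of_le hr with h1 | h1
  · rw [← h1, S.F0]; norm_num
  refine lt_of_le_of_ne (h r hr) (fun h2 => ?_)
  have hmin : IsLocalMin (F ν) r := by
    filter_upwards [lt_mem_nhds h1] with s hs
    rw [← h2]; exact h s hs.le
  exact S.nodouble hd hq ν r h1 h2.symm (hmin.hasDerivAt_eq_zero (S.dF ν r))

lemma Sol.exists_crit (S : Sol p d q F G) (hd : 0 < d) (hq : ContinuousOn q (Ici p)) (k K : ℝ) (hk : 0 < k)
    (hqk : ∀ r, p ≤ r → k * ((r - p) * (r - p + d)) - K ≤ q r)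
    (hbdd : BddAbove {ν | ∀ r, p ≤ r → 0 < F ν r}) :
    ∃ ν R, p < R ∧ (∀ r, p ≤ r → 0 < F ν r) ∧ (∀ r, R ≤ r → G ν r ≤ 0) ∧
      (∀ r, R ≤ r → k / 2 * ((r - p) * (r - p + d)) ≤ q r - ν) := by
  set A := {ν | ∀ r, p ≤ r → 0 < F ν r} with hA
  have hne : A.Nonempty := by
    refine ⟨-K, S.extend hd (-K) p le_rfl (by rw [S.F0]; norm_num) (by simp) ?_⟩
    intro r hr
    have := hqk r hr
    have h2 : 0 ≤ k * ((r - p) * (r - p + d)) := by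
      have : 0 ≤ r - p := by linarith
      positivity
    linarith
  set ν := sSup A with hν
  have hpos : ∀ r, p ≤ r → 0 < F ν r := by
    apply S.pos_of_nonneg hd hq
    intro r hr
    have hc : IsClosed {ν | 0 ≤ F ν r} := isClosed_le continuous_const (S.contF' r)
    have hsub : A ⊆ {ν | 0 ≤ F ν r} := fun ν' h => (h r hr).le
    exact (hc.closure_subset_iff.mpr hsub) (csSup_mem_closure hne hbdd)
  have hcoer : ∃ R, p < R ∧ ∀ r, R ≤ r → k / 2 * ((r - p) * (r - p + d)) + 1 ≤ q r - ν := by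
    refine ⟨p + 1 + (2 / (k * d)) * (|K| + |ν| + 1), by
      have : 0 ≤ (2 / (k * d)) * (|K| + |ν| + 1) := by positivity
      linarith, fun r hr => ?_⟩
    have h0 : 0 ≤ (2 / (k * d)) * (|K| + |ν| + 1) := by positivity
    have h1 := hqk r (by linarith)
    have h2 : (2 / (k * d)) * (|K| + |ν| + 1) ≤ r - p := by linarith
    rw [div_mul_eq_mul_div, div_le_iff₀ (by positivity)] at h2
    have h3 : k * (d * (r - p)) ≤ k * ((r - p) * (r - p + d)) := by
      apply mul_le_mul_of_nonneg_left _ hk.le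
      nlinarith [sq_nonneg (r - p)]
    have := le_abs_self K
    have := le_abs_self ν
    nlinarith
  obtain ⟨R, hR, hco⟩ := hcoer
  have hDR : ∀ r, R ≤ r → 0 < (r - p) * (r - p + d) := fun r hr =>
    mul_pos (by linarith) (by linarith)
  refine ⟨ν, R, hR, hpos, ?_, fun r hr => by linarith [hco r hr]⟩
  intro b hb
  by_contra hG
  rw [not_le] at hG
  have e1 : ∀ᶠ ν' in 𝓝 ν, ∀ r ∈ Icc p b, 0 < F ν' r := by
    apply isCompact_Icc.eventually_forall_of_forall_eventually
    intro r hr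
    have : 0 < Function.uncurry F (ν, r) := hpos r hr.1
    exact S.cF.continuousAt.eventually (lt_mem_nhds this)
  have e2 : ∀ᶠ ν' in 𝓝 ν, 0 < G ν' b := (S.contG' b).continuousAt.eventually (lt_mem_nhds hG)
  have e3 : ∀ᶠ ν' in 𝓝 ν, ν' < ν + 1 := gt_mem_nhds (by linarith)
  have e4 := ((e1.and (e2.and e3)).filter_mono (nhdsWithin_le_nhds (s := Ioi ν))).and self_mem_nhdsWithin
  obtain ⟨ν', ⟨h1, h2, h3⟩, h4⟩ := e4.exists
  have h4 : ν < ν' := h4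
  have hmem : ν' ∈ A := by
    intro r hr
    rcases le_total r b with h5 | h5
    · exact h1 r ⟨hr, h5⟩
    · refine S.extend hd ν' b (by linarith) (h1 b ⟨by linarith, le_rfl⟩)
        (mul_nonneg (hDR b hb).le h2.le) ?_ r h5
      intro s hs
      have := hco s (by linarith)
      have := hDR s (by linarith)
      nlinarith
  have := le_csSup hbdd hmem
  linarith

lemma Sol.decay (S : Sol p d q F G) (hd : 0 < d) (k : ℝ) (hk : 0 < k) (ν R : ℝ) (hR : p < R)
    (hpos : ∀ r, p ≤ r → 0 < F ν r) (hG : ∀ r, R ≤ r → G ν r ≤ 0)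
    (hco : ∀ r, R ≤ r → k * ((r - p) * (r - p + d)) ≤ q r - ν) :
    ∃ C c : ℝ, 0 < C ∧ 0 < c ∧ ∀ r, p ≤ r → |F ν r| + |G ν r| ≤ C * exp (-c * r) := by
  obtain ⟨c, hc, hck⟩ : ∃ c : ℝ, 0 < c ∧ c ^ 2 = k := ⟨√k, sqrt_pos.mpr hk, sq_sqrt hk.le⟩
  have hD : ∀ r, R ≤ r → 0 < (r - p) * (r - p + d) := fun r hr =>
    mul_pos (by linarith) (by linarith)
  have hcF := S.contF ν
  have hcG := S.contG ν
  have hdecF : AntitoneOn (F ν) (Ici R) := by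
    apply antitoneOn_of_hasDerivWithinAt_nonpos (convex_Ici R) hcF.continuousOn (f' := G ν)
    · intro x _; exact (S.dF ν x).hasDerivWithinAt
    · intro x hx; rw [interior_Ici] at hx; exact hG x (le_of_lt hx)
  have hincP : MonotoneOn (fun s => (s - p) * (s - p + d) * G ν s) (Ici R) := by
    apply monotoneOn_of_hasDerivWithinAt_nonneg (convex_Ici R) (S.contP ν).continuousOn
      (f' := fun r => (q r - ν) * F ν r)
    · intro x hx; rw [interior_Ici, mem_Ioi] at hx; exact (S.dG ν x (by linarith)).hasDerivWithinAt
    · intro x hx; rw [interior_Ici, mem_Ioi] at hx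
      have := hD x hx.le
      have := hco x hx.le
      exact mul_nonneg (le_trans (by positivity) this) (hpos x (by linarith)).le
  have hdG : ∀ r, R ≤ r → HasDerivAt (G ν)
      (((q r - ν) * F ν r - (2 * (r - p) + d) * G ν r) / ((r - p) * (r - p + d))) r := by
    intro r hr
    have h1 := S.dG ν r (by linarith)
    have h2 : HasDerivAt (fun s => (s - p) * (s - p + d)) (2 * (r - p) + d) r := by
      have h3 := (hasDerivAt_id r).sub_const p
      have h4 := h3.mul (h3.add_const d)
      exact h4.congr_deriv (by simp; ring)
    have h3 := h1.div h2 (hD r hr).ne'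
    have h4 := h3.congr_deriv (g' := (((q r - ν) * F ν r - (2 * (r - p) + d) * G ν r) / ((r - p) * (r - p + d)))) (by
      have := (hD r hr).ne'
      generalize hDD : (r - p) * (r - p + d) = D at *
      field_simp)
    refine h4.congr_of_eventuallyEq ?_
    filter_upwards [lt_mem_nhds (show p < r by linarith)] with s hs
    have : (s - p) * (s - p + d) ≠ 0 := (mul_pos (by linarith) (by linarith)).ne'
    simp only [Pi.div_apply]
    rw [mul_div_cancel_left₀ _ this]
  have hexp : ∀ (b x : ℝ), HasDerivAt (fun x => exp (b * x)) (exp (b * x) * b) x := fun b x => by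
    have := ((hasDerivAt_id x).const_mul b).exp
    simpa using this
  have hincu : MonotoneOn (fun x => (G ν x + c * F ν x) * exp (-c * x)) (Ici R) := by
    apply monotoneOn_of_hasDerivWithinAt_nonneg (convex_Ici R)
      (f' := fun r => ((((q r - ν) * F ν r - (2 * (r - p) + d) * G ν r) / ((r - p) * (r - p + d)))
        + c * G ν r) * exp (-c * r) + (G ν r + c * F ν r) * (exp (-c * r) * (-c)))
    · apply Continuous.continuousOn; fun_prop
    · intro x hx; rw [interior_Ici, mem_Ioi] at hx
      have h1 := ((hdG x hx.le).add ((S.dF ν x).const_mul c)).mul (hexp (-c) x)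
      exact h1.hasDerivWithinAt
    · intro x hx; rw [interior_Ici, mem_Ioi] at hx
      have h1 : k * F ν x ≤ ((q x - ν) * F ν x - (2 * (x - p) + d) * G ν x) / ((x - p) * (x - p + d)) := by
        rw [le_div_iff₀ (hD x hx.le)]
        have h2 := hG x hx.le
        have h3 := mul_le_mul_of_nonneg_right (hco x hx.le) (hpos x (by linarith)).le
        have h4 : 0 ≤ (2 * (x - p) + d) * (-G ν x) := mul_nonneg (by linarith) (by linarith)
        linarith
      rw [← hck] at h1
      have : 0 ≤ (((q x - ν) * F ν x - (2 * (x - p) + d) * G ν x) / ((x - p) * (x - p + d)) - c ^ 2 * F ν x) * exp (-c * x) :=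
        mul_nonneg (by linarith) (exp_pos _).le
      linarith
  have hu : ∀ r, R ≤ r → G ν r + c * F ν r ≤ 0 := by
    intro r hr
    by_contra hcon
    rw [not_le] at hcon
    set u0 := G ν r + c * F ν r with hu0
    have hF0 := hpos r (by linarith)
    set s := r + F ν r / u0 with hs
    have hrs : r ≤ s := by
      have : 0 ≤ F ν r / u0 := by positivity
      linarith
    have h1 := hincu (mem_Ici.mpr hr) (mem_Ici.mpr (hr.trans hrs)) hrs
    simp only at h1
    rw [← hu0] at h1
    have h2 : u0 * exp (c * (s - r)) ≤ G ν s + c * F ν s := by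
      have h5 := mul_le_mul_of_nonneg_right h1 (exp_pos (c * s)).le
      rw [mul_assoc, mul_assoc, ← exp_add, ← exp_add] at h5
      have e1 : -c * r + c * s = c * (s - r) := by ring
      have e2 : -c * s + c * s = 0 := by ring
      rw [e1, e2, exp_zero, mul_one] at h5
      exact h5
    have h3 := add_one_le_exp (c * (s - r))
    have h4 := hdecF (mem_Ici.mpr hr) (mem_Ici.mpr (hr.trans hrs)) hrs
    have h5 := hG s (hr.trans hrs)
    have h6 : u0 * (s - r) = F ν r := by rw [hs]; field_simp; ring
    have h7 := mul_le_mul_of_nonneg_left h3 hcon.le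
    have h8 := mul_le_mul_of_nonneg_left h4 hc.le
    nlinarith
  have hdece : AntitoneOn (fun x => F ν x * exp (c * x)) (Ici R) := by
    apply antitoneOn_of_hasDerivWithinAt_nonpos (convex_Ici R)
      (f' := fun r => G ν r * exp (c * r) + F ν r * (exp (c * r) * c))
    · apply Continuous.continuousOn; fun_prop
    · intro x hx
      exact ((S.dF ν x).mul (hexp c x)).hasDerivWithinAt
    · intro x hx; rw [interior_Ici, mem_Ioi] at hx
      have := mul_nonneg (by linarith [hu x hx.le] : 0 ≤ -(G ν x + c * F ν x)) (exp_pos (c * x)).le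
      linarith
  have hFd : ∀ r, R ≤ r → F ν r ≤ F ν R * exp (c * R) * exp (-c * r) := by
    intro r hr
    have h1 := hdece (mem_Ici.mpr le_rfl) (mem_Ici.mpr hr) hr
    simp only at h1
    have h5 := mul_le_mul_of_nonneg_right h1 (exp_pos (-c * r)).le
    rw [mul_assoc (F ν r), ← exp_add] at h5
    have e2 : c * r + -c * r = 0 := by ring
    rwa [e2, exp_zero, mul_one] at h5
  have hGd : ∀ r, R + 1 ≤ r → |G ν r| ≤ F ν (r - 1) := by
    intro r hr
    obtain ⟨ξ, hξ, hξe⟩ := exists_hasDerivAt_eq_slope (F ν) (G ν) (show r - 1 < r by linarith)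
      hcF.continuousOn (fun x _ => S.dF ν x)
    have e : r - (r - 1) = 1 := by ring
    rw [e, div_one] at hξe
    have hξR : R ≤ ξ := by linarith [hξ.1]
    have h1 := hincP (mem_Ici.mpr hξR) (mem_Ici.mpr (hξR.trans hξ.2.le)) hξ.2.le
    simp only at h1
    have h2 := hG ξ hξR
    have h3 : (ξ - p) * (ξ - p + d) ≤ (r - p) * (r - p + d) :=
      mul_le_mul (by linarith [hξ.2]) (by linarith [hξ.2]) (by linarith) (by linarith)
    have h4 : (r - p) * (r - p + d) * G ν ξ ≤ (r - p) * (r - p + d) * G ν r :=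
      le_trans (mul_le_mul_of_nonpos_right h3 h2) h1
    have h5 := le_of_mul_le_mul_left h4 (hD r (by linarith))
    rw [abs_of_nonpos (hG r (by linarith))]
    have := hpos r (by linarith)
    linarith
  obtain ⟨B, hB⟩ := (isCompact_Icc (a := p) (b := R + 1)).exists_bound_of_continuousOn
    (f := fun r => (|F ν r| + |G ν r|) * exp (c * r)) (by apply Continuous.continuousOn; fun_prop)
  have hFR := hpos R hR.le
  refine ⟨|B| + F ν R * exp (c * R) + F ν R * exp (c * R) * exp c, c, by positivity, hc, ?_⟩
  intro r hr
  rcases le_total r (R + 1) with h | h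
  · have h1 := hB r ⟨hr, h⟩
    rw [Real.norm_eq_abs, abs_of_nonneg (by positivity)] at h1
    have h5 := mul_le_mul_of_nonneg_right h1 (exp_pos (-c * r)).le
    rw [mul_assoc, ← exp_add] at h5
    have e2 : c * r + -c * r = 0 := by ring
    rw [e2, exp_zero, mul_one] at h5
    refine h5.trans ?_
    gcongr
    have := le_abs_self B
    have : 0 ≤ F ν R * exp (c * R) + F ν R * exp (c * R) * exp c := by positivity
    linarith
  · have h1 := hFd r (by linarith)
    have h2 := hGd r h
    have h3 := hFd (r - 1) (by linarith)
    have e : exp (-c * (r - 1)) = exp c * exp (-c * r) := by rw [← exp_add]; congr 1; ring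
    rw [e] at h3
    rw [abs_of_pos (hpos r hr)]
    have : 0 ≤ |B| * exp (-c * r) := by positivity
    nlinarith
end

/-- Test functions. -/
structure TestFn (p : ℝ) (f : ℝ → ℂ) : Prop where
  smooth : ContDiff ℝ (⊤ : ℕ∞) f
  comp : HasCompactSupport f
  supp : tsupport f ⊆ Ioi p

/-- The energy. -/
noncomputable def energy (p d : ℝ) (q : ℝ → ℝ) (f : ℝ → ℂ) : ℝ :=
  ∫ r in Ioi p, ((r - p) * (r - p + d) * ‖deriv f r‖ ^ 2 + q r * ‖f r‖ ^ 2)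

lemma setInt_eq_interval (p α β : ℝ) (h : ℝ → ℝ) (hp : p ≤ α) (hab : α ≤ β)
    (h0 : ∀ r, r ∉ Ioc α β → h r = 0) : ∫ r in Ioi p, h r = ∫ r in α..β, h r := by
  rw [intervalIntegral.integral_of_le hab]
  apply setIntegral_eq_of_subset_of_forall_sdiff_eq_zero measurableSet_Ioi
  · intro x hx; exact lt_of_le_of_lt hp hx.1
  · intro x hx; exact h0 x hx.2

lemma energy_eq (p d α β : ℝ) (q : ℝ → ℝ) (f : ℝ → ℂ) (hp : p ≤ α) (hab : α ≤ β)
    (h : tsupport f ⊆ Icc α β) (hα : f α = 0) (hα' : deriv f α = 0) :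
    energy p d q f = ∫ r in α..β, ((r - p) * (r - p + d) * ‖deriv f r‖ ^ 2 + q r * ‖f r‖ ^ 2) := by
  apply setInt_eq_interval p α β _ hp hab
  intro r hr
  by_cases h1 : r = α
  · subst h1; simp [hα, hα']
  · have h2 : r ∉ tsupport f := fun h2 => by
      have := h h2
      exact hr ⟨lt_of_le_of_ne this.1 (Ne.symm h1), this.2⟩
    have h3 : r ∉ tsupport (deriv f) := fun h3 => h2 (tsupport_deriv_subset h3)
    simp [image_eq_zero_of_notMem_tsupport h2, image_eq_zero_of_notMem_tsupport h3]

lemma mass_eq (p α β : ℝ) (f : ℝ → ℂ) (hp : p ≤ α) (hab : α ≤ β)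
    (h : tsupport f ⊆ Icc α β) (hα : f α = 0) :
    ∫ r in Ioi p, ‖f r‖ ^ 2 = ∫ r in α..β, ‖f r‖ ^ 2 := by
  apply setInt_eq_interval p α β _ hp hab
  intro r hr
  by_cases h1 : r = α
  · subst h1; simp [hα]
  · have h2 : r ∉ tsupport f := fun h2 => by
      have := h h2
      exact hr ⟨lt_of_le_of_ne this.1 (Ne.symm h1), this.2⟩
    simp [image_eq_zero_of_notMem_tsupport h2]

lemma TestFn.cont {p : ℝ} {f : ℝ → ℂ} (T : TestFn p f) : Continuous f := T.smooth.continuous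

lemma TestFn.contD {p : ℝ} {f : ℝ → ℂ} (T : TestFn p f) : Continuous (deriv f) :=
  T.smooth.continuous_deriv (by simp)

lemma TestFn.hasD {p : ℝ} {f : ℝ → ℂ} (T : TestFn p f) (r : ℝ) : HasDerivAt f (deriv f r) r :=
  ((T.smooth.differentiable (by simp)) r).hasDerivAt

lemma TestFn.interval {p : ℝ} {f : ℝ → ℂ} (T : TestFn p f) : ∃ α β, p < α ∧ α < β ∧
    tsupport f ⊆ Icc α β ∧ f α = 0 ∧ deriv f α = 0 ∧ f β = 0 := by
  obtain ⟨α, β, h1, h2, h3⟩ : ∃ α β, p < α ∧ α < β ∧ tsupport f ⊆ Ioo α β := by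
    rcases (tsupport f).eq_empty_or_nonempty with h | h
    · exact ⟨p + 1, p + 2, by linarith, by linarith, by rw [h]; exact empty_subset _⟩
    · have hc : IsCompact (tsupport f) := T.comp
      obtain ⟨x, hx, hx'⟩ := hc.exists_isLeast h
      obtain ⟨y, hy, hy'⟩ := hc.exists_isGreatest h
      have hpx : p < x := T.supp hx
      have hxy : x ≤ y := hx' hy
      refine ⟨(p + x) / 2, y + 1, by linarith, by linarith, fun z hz => ⟨?_, ?_⟩⟩
      · have := hx' hz; linarith
      · have := hy' hz; linarith
  have ha : α ∉ tsupport f := fun h => lt_irrefl _ (h3 h).1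
  have hb : β ∉ tsupport f := fun h => lt_irrefl _ (h3 h).2
  exact ⟨α, β, h1, h2, h3.trans Ioo_subset_Icc_self, image_eq_zero_of_notMem_tsupport ha,
    image_eq_zero_of_notMem_tsupport (fun h => ha (tsupport_deriv_subset h)),
    image_eq_zero_of_notMem_tsupport hb⟩

lemma energy_contOn {p d α β : ℝ} {q : ℝ → ℝ} {f : ℝ → ℂ} (T : TestFn p f) (hp : p < α)
    (hq : ContinuousOn q (Ici p)) :
    ContinuousOn (fun r => (r - p) * (r - p + d) * ‖deriv f r‖ ^ 2 + q r * ‖f r‖ ^ 2) (Icc α β) := by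
  have h1 := T.cont
  have h2 := T.contD
  have h3 : ContinuousOn q (Icc α β) := hq.mono fun x hx => hp.le.trans hx.1
  fun_prop

lemma energy_int {p d α β : ℝ} {q : ℝ → ℝ} {f : ℝ → ℂ} (T : TestFn p f) (hp : p < α) (hab : α ≤ β)
    (hq : ContinuousOn q (Ici p)) :
    IntervalIntegrable (fun r => (r - p) * (r - p + d) * ‖deriv f r‖ ^ 2 + q r * ‖f r‖ ^ 2)
      volume α β := by
  apply ContinuousOn.intervalIntegrable
  rw [uIcc_of_le hab]
  exact energy_contOn T hp hq

lemma energy_mono {p d : ℝ} {q₁ q₂ : ℝ → ℝ} {f : ℝ → ℂ} (T : TestFn p f)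
    (hq₁ : ContinuousOn q₁ (Ici p)) (hq₂ : ContinuousOn q₂ (Ici p)) (h : ∀ r, p ≤ r → q₁ r ≤ q₂ r) :
    energy p d q₁ f ≤ energy p d q₂ f := by
  obtain ⟨α, β, h1, h2, h3, h4, h5, h6⟩ := T.interval
  rw [energy_eq p d α β q₁ f h1.le h2.le h3 h4 h5, energy_eq p d α β q₂ f h1.le h2.le h3 h4 h5]
  apply intervalIntegral.integral_mono_on h2.le (energy_int T h1 h2.le hq₁) (energy_int T h1 h2.le hq₂)
  intro x hx
  have := h x (by linarith [hx.1])
  gcongr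

lemma energy_smul {p d : ℝ} {q : ℝ → ℝ} {f : ℝ → ℂ} (T : TestFn p f) (s : ℝ) :
    TestFn p (fun r => (s : ℂ) * f r) ∧ energy p d q (fun r => (s : ℂ) * f r) = s ^ 2 * energy p d q f ∧
    ∫ r in Ioi p, ‖(s : ℂ) * f r‖ ^ 2 = s ^ 2 * ∫ r in Ioi p, ‖f r‖ ^ 2 := by
  refine ⟨⟨?_, ?_, ?_⟩, ?_, ?_⟩
  · exact contDiff_const.mul T.smooth
  · exact T.comp.mul_left (f' := f) (f := fun _ => (s : ℂ))
  · exact (closure_mono (Function.support_const_smul_subset (s : ℂ) f)).trans T.supp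
  · unfold energy
    rw [← integral_const_mul]
    congr 1
    ext r
    rw [deriv_const_mul _ ((T.hasD r).differentiableAt)]
    simp only [norm_mul, mul_pow, Complex.norm_real, Real.norm_eq_abs, sq_abs]
    ring
  · rw [← integral_const_mul]
    congr 1
    ext r
    simp only [norm_mul, mul_pow, Complex.norm_real, Real.norm_eq_abs, sq_abs]

lemma normalise {p d : ℝ} {q : ℝ → ℝ} {f : ℝ → ℂ} (T : TestFn p f)
    (hN : 0 < ∫ r in Ioi p, ‖f r‖ ^ 2) : ∃ g, TestFn p g ∧ ∫ r in Ioi p, ‖g r‖ ^ 2 = 1 ∧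
    energy p d q g = energy p d q f / ∫ r in Ioi p, ‖f r‖ ^ 2 := by
  set N := ∫ r in Ioi p, ‖f r‖ ^ 2
  have hs : ((√N)⁻¹) ^ 2 = N⁻¹ := by rw [inv_pow, sq_sqrt hN.le]
  obtain ⟨h1, h2, h3⟩ := energy_smul (d := d) (q := q) T (√N)⁻¹
  refine ⟨_, h1, ?_, ?_⟩
  · rw [h3, hs]; exact inv_mul_cancel₀ hN.ne'
  · rw [h2, hs]; field_simp

def energySet (p d : ℝ) (q : ℝ → ℝ) : Set ℝ :=
  {x | ∃ f : ℝ → ℂ, TestFn p f ∧ ∫ r in Ioi p, ‖f r‖ ^ 2 = 1 ∧ x = energy p d q f}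

section
variable {p d : ℝ} {q : ℝ → ℝ} {F G : ℝ → ℝ → ℝ}

lemma Sol.picone (S : Sol p d q F G) (hd : 0 < d) (hq : ContinuousOn q (Ici p)) (ν : ℝ)
    (hpos : ∀ r, p ≤ r → 0 < F ν r) (f : ℝ → ℂ) (T : TestFn p f) :
    ν * ∫ r in Ioi p, ‖f r‖ ^ 2 ≤ energy p d q f := by
  obtain ⟨α, β, h1, h2, h3, h4, h5, h6⟩ := T.interval
  rw [energy_eq p d α β q f h1.le h2.le h3 h4 h5, mass_eq p α β f h1.le h2.le h3 h4,
    ← intervalIntegral.integral_const_mul]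
  let P : ℝ → ℝ := fun s => (s - p) * (s - p + d) * G ν s
  let H' : ℝ → ℝ := fun r => (((q r - ν) * F ν r) * F ν r - P r * G ν r) / (F ν r) ^ 2 * ‖f r‖ ^ 2 +
    P r / F ν r * (2 * inner ℝ (f r) (deriv f r))
  have hFp : ∀ r ∈ Icc α β, 0 < F ν r := fun r hr => hpos r (by linarith [hr.1])
  have hcF := S.contF ν
  have hcG := S.contG ν
  have hcP : Continuous P := S.contP ν
  have hcf := T.cont
  have hcf' := T.contD
  have hqq : ContinuousOn q (Icc α β) := hq.mono fun x hx => h1.le.trans hx.1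
  have hH : ∀ r ∈ uIcc α β, HasDerivAt (fun r => P r / F ν r * ‖f r‖ ^ 2) (H' r) r := by
    intro r hr
    rw [uIcc_of_le h2.le] at hr
    have e1 := S.dG ν r (by linarith [hr.1])
    have e2 := e1.div (S.dF ν r) (hFp r hr).ne'
    exact e2.mul (T.hasD r).norm_sq
  have hcH' : ContinuousOn H' (Icc α β) := by
    have e1 : ContinuousOn (fun r => (F ν r)⁻¹) (Icc α β) :=
      hcF.continuousOn.inv₀ (fun r hr => (hFp r hr).ne')
    have e2 : Continuous (fun r => inner ℝ (f r) (deriv f r)) := hcf.inner hcf'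
    simp only [H', div_eq_mul_inv, ← inv_pow]
    fun_prop
  have hiH : IntervalIntegrable H' volume α β := by
    apply ContinuousOn.intervalIntegrable; rwa [uIcc_of_le h2.le]
  have hInt := intervalIntegral.integral_eq_sub_of_hasDerivAt hH hiH
  simp only [h4, h6, norm_zero] at hInt
  have him : IntervalIntegrable (fun r => ν * ‖f r‖ ^ 2) volume α β := by
    apply Continuous.intervalIntegrable; fun_prop
  have key : ∫ r in α..β, (ν * ‖f r‖ ^ 2 + H' r) ≤
      ∫ r in α..β, ((r - p) * (r - p + d) * ‖deriv f r‖ ^ 2 + q r * ‖f r‖ ^ 2) := by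
    apply intervalIntegral.integral_mono_on h2.le (him.add hiH) (energy_int T h1 h2.le hq)
    intro r hr
    have hF := hFp r hr
    have hD : 0 ≤ (r - p) * (r - p + d) := mul_nonneg (by linarith [hr.1]) (by linarith [hr.1])
    have e := norm_sub_sq_real (deriv f r) ((G ν r / F ν r) • f r)
    rw [inner_smul_right, norm_smul, real_inner_comm, mul_pow, Real.norm_eq_abs, sq_abs] at e
    have e2 : 0 ≤ (r - p) * (r - p + d) * ‖deriv f r - (G ν r / F ν r) • f r‖ ^ 2 := by positivity
    rw [e] at e2
    have e3 : (r - p) * (r - p + d) * (‖deriv f r‖ ^ 2 - 2 * (G ν r / F ν r * inner ℝ (f r) (deriv f r)) +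
        (G ν r / F ν r) ^ 2 * ‖f r‖ ^ 2) = ((r - p) * (r - p + d) * ‖deriv f r‖ ^ 2 + q r * ‖f r‖ ^ 2) -
        (ν * ‖f r‖ ^ 2 + H' r) + 2 * 0 := by
      simp only [H', P]
      field_simp
      ring
    rw [e3] at e2
    linarith
  rw [intervalIntegral.integral_add him hiH, hInt] at key
  simpa using key

lemma Sol.smooth (S : Sol p d q F G) (hd : 0 < d) (hq : ContDiffOn ℝ (⊤ : ℕ∞) q (Ioi p)) (ν : ℝ) :
    ContDiffOn ℝ (⊤ : ℕ∞) (F ν) (Ioi p) := by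
  let P : ℝ → ℝ := fun s => (s - p) * (s - p + d) * G ν s
  have hder : ∀ r ∈ Ioi p, deriv (F ν) r = P r / ((r - p) * (r - p + d)) := by
    intro r hr
    rw [mem_Ioi] at hr
    rw [(S.dF ν r).deriv]
    have : (r - p) * (r - p + d) ≠ 0 := (mul_pos (by linarith) (by linarith)).ne'
    simp only [P]
    rw [mul_div_cancel_left₀ _ this]
  have hderP : ∀ r ∈ Ioi p, deriv P r = (q r - ν) * F ν r := fun r hr => (S.dG ν r hr).deriv
  have key : ∀ n : ℕ, ContDiffOn ℝ n (F ν) (Ioi p) ∧ ContDiffOn ℝ n P (Ioi p) := by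
    intro n
    induction n with
    | zero =>
      simp only [CharP.cast_eq_zero, contDiffOn_zero]
      exact ⟨(S.contF ν).continuousOn, (S.contP ν).continuousOn⟩
    | succ n ih =>
      have hqn : ContDiffOn ℝ n q (Ioi p) := hq.of_le (by exact_mod_cast le_top)
      push_cast
      rw [contDiffOn_succ_iff_deriv_of_isOpen isOpen_Ioi, contDiffOn_succ_iff_deriv_of_isOpen isOpen_Ioi]
      refine ⟨⟨fun r hr => (S.dF ν r).differentiableAt.differentiableWithinAt, by simp, ?_⟩,
        fun r hr => (S.dG ν r hr).differentiableAt.differentiableWithinAt, by simp, ?_⟩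
      · refine ContDiffOn.congr ?_ hder
        apply ih.2.div
        · apply ContDiff.contDiffOn; fun_prop
        · intro r hr
          rw [mem_Ioi] at hr
          exact (mul_pos (by linarith) (by linarith)).ne'
      · refine ContDiffOn.congr ?_ hderP
        exact (hqn.sub contDiffOn_const).mul ih.1
  exact contDiffOn_infty.mpr fun n => (key n).1
end

section
variable {p d : ℝ} {q : ℝ → ℝ} {F G : ℝ → ℝ → ℝ}

/-- the basic bump -/
lemma exists_bump : ∃ (χ : ℝ → ℝ) (B : ℝ), ContDiff ℝ (⊤ : ℕ∞) χ ∧ (∀ x, |x| ≤ 1 → χ x = 1) ∧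
    (∀ x, 2 ≤ |x| → χ x = 0) ∧ 0 ≤ B ∧ ∀ x, |deriv χ x| ≤ B := by
  let b : ContDiffBump (0 : ℝ) := ⟨1, 2, by norm_num, by norm_num⟩
  have hs : ContDiff ℝ (⊤ : ℕ∞) (b : ℝ → ℝ) := b.contDiff
  obtain ⟨B, hB⟩ := (hs.continuous_deriv (by simp)).bounded_above_of_compact_support
    (b.hasCompactSupport.deriv)
  refine ⟨b, B, hs, fun x hx => b.one_of_mem_closedBall (by simpa using hx),
    fun x hx => b.zero_of_le_dist (by simpa using hx), (norm_nonneg _).trans (hB 0), fun x => hB x⟩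

lemma Sol.cutoff (S : Sol p d q F G) (hd : 0 < d) (hq : ContinuousOn q (Ici p))
    (hqs : ContDiffOn ℝ (⊤ : ℕ∞) q (Ioi p)) (ν D : ℝ) (hD0 : 0 ≤ D)
    (hD : ∀ r, p ≤ r → F ν r ^ 2 * (r - p + d) ≤ D) (χ : ℝ → ℝ) (B : ℝ)
    (hχ : ContDiff ℝ (⊤ : ℕ∞) χ) (hχ1 : ∀ x, |x| ≤ 1 → χ x = 1) (hχ0 : ∀ x, 2 ≤ |x| → χ x = 0)
    (hB0 : 0 ≤ B) (hB : ∀ x, |deriv χ x| ≤ B) (n : ℕ) (hn : 1 ≤ n) :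
    ∃ g, TestFn p g ∧ energy p d q g ≤ ν * (∫ r in Ioi p, ‖g r‖ ^ 2) + 4 * B ^ 2 * D / n ∧
      ∫ r in (p + exp (-1))..(p + exp 1), F ν r ^ 2 ≤ ∫ r in Ioi p, ‖g r‖ ^ 2 := by
  have hn0 : (0:ℝ) < n := by exact_mod_cast hn
  have hn1 : (1:ℝ) ≤ n := by exact_mod_cast hn
  let φ : ℝ → ℝ := fun r => χ (log (r - p) / n)
  let φ' : ℝ → ℝ := fun r => deriv χ (log (r - p) / n) * ((r - p)⁻¹ / n)
  let g0 : ℝ → ℝ := fun r => if p < r then φ r * F ν r else 0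
  let g : ℝ → ℂ := fun r => (g0 r : ℂ)
  set α := p + exp (-2 * n) with hα
  set β := p + exp (2 * n) with hβ
  have hpα : p < α := by have := exp_pos (-2 * (n:ℝ)); linarith
  have hαβ : α < β := by
    have : exp (-2 * (n:ℝ)) < exp (2 * n) := exp_lt_exp.mpr (by linarith)
    linarith
  have hlogα : log (α - p) = -2 * n := by rw [hα, add_sub_cancel_left, log_exp]
  have hlogβ : log (β - p) = 2 * n := by rw [hβ, add_sub_cancel_left, log_exp]
  have hφ0 : ∀ r, p < r → r ∉ Ioo α β → φ r = 0 := by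
    intro r hr h
    apply hχ0
    rw [abs_div, abs_of_pos hn0, le_div_iff₀ hn0, le_abs']
    rw [mem_Ioo, not_and_or, not_lt, not_lt] at h
    rcases h with h | h
    · left; have := log_le_log (by linarith) (sub_le_sub_right h p)
      linarith
    · right; have := log_le_log (by linarith) (sub_le_sub_right h p)
      linarith
  have hg0 : ∀ r, r ∉ Ioo α β → g r = 0 := by
    intro r h
    by_cases hr : p < r
    · simp [g, g0, hφ0 r hr h]
    · simp [g, g0, hr]
  have hsupp : tsupport g ⊆ Icc α β := by
    apply closure_minimal _ isClosed_Icc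
    intro r hr
    by_contra h
    exact hr (hg0 r (fun h' => h (Ioo_subset_Icc_self h')))
  have hdφ : ∀ r, p < r → HasDerivAt φ (φ' r) r := by
    intro r hr
    have e1 : HasDerivAt (fun r => log (r - p) / n) ((r - p)⁻¹ / n) r := by
      have := (((hasDerivAt_id r).sub_const p).log (by simp; linarith)).div_const (n:ℝ)
      simpa using this
    have e2 : HasDerivAt χ (deriv χ (log (r - p) / n)) (log (r - p) / n) :=
      ((hχ.differentiable (by simp)) _).hasDerivAt
    exact e2.comp r e1
  have hev : ∀ r, p < r → g0 =ᶠ[𝓝 r] fun r => φ r * F ν r := by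
    intro r hr
    filter_upwards [lt_mem_nhds hr] with s hs
    simp [g0, hs]
  have hdg : ∀ r, p < r → HasDerivAt g ((φ' r * F ν r + φ r * G ν r : ℝ) : ℂ) r := by
    intro r hr
    exact (((hdφ r hr).mul (S.dF ν r)).congr_of_eventuallyEq (hev r hr)).ofReal_comp
  have hsm := S.smooth hd hqs ν
  have hφs : ∀ r, p < r → ContDiffAt ℝ (⊤ : ℕ∞) φ r := by
    intro r hr
    have e1 : ContDiffAt ℝ (⊤ : ℕ∞) (fun r => log (r - p) / n) r := by
      apply ContDiffAt.div_const
      apply ContDiffAt.log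
      · fun_prop
      · linarith
    exact hχ.contDiffAt.comp r e1
  have hgs : ContDiff ℝ (⊤ : ℕ∞) g := by
    rw [contDiff_iff_contDiffAt]
    intro r
    by_cases hr : r ∈ tsupport g
    swap
    · exact (contDiffAt_const (c := (0:ℂ))).congr_of_eventuallyEq
        (notMem_tsupport_iff_eventuallyEq.mp hr)
    have hr' : p < r := hpα.trans_le (hsupp hr).1
    have e1 : ContDiffAt ℝ (⊤ : ℕ∞) g0 r :=
      ((hφs r hr').mul (hsm.contDiffAt (Ioi_mem_nhds hr'))).congr_of_eventuallyEq (hev r hr')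
    exact Complex.ofRealCLM.contDiff.contDiffAt.comp r e1
  have T : TestFn p g := ⟨hgs, HasCompactSupport.of_support_subset_isCompact isCompact_Icc
    (subset_closure.trans hsupp), hsupp.trans fun r hr => hpα.trans_le hr.1⟩
  have hgα : g α = 0 := hg0 α (by simp)
  have hχ'2 : deriv χ (-2) = 0 := by
    have hc : Continuous (deriv χ) := hχ.continuous_deriv (by simp)
    have h1 : ∀ x ∈ Iio (-2 : ℝ), deriv χ x = 0 := by
      intro x hx
      have : χ =ᶠ[𝓝 x] fun _ => 0 := by
        filter_upwards [gt_mem_nhds hx] with y hy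
        apply hχ0; rw [abs_of_neg (by linarith)]; linarith
      rw [this.deriv_eq]; simp
    have h2 : IsClosed {x | deriv χ x = 0} := isClosed_eq hc continuous_const
    have h3 : closure (Iio (-2:ℝ)) ⊆ {x | deriv χ x = 0} := h2.closure_subset_iff.mpr h1
    rw [closure_Iio] at h3
    exact h3 (by simp)
  have hφα : φ α = 0 := hφ0 α hpα (by simp)
  have hφβ : φ β = 0 := hφ0 β (hpα.trans hαβ) (by simp)
  have hg'α : deriv g α = 0 := by
    rw [(hdg α hpα).deriv, hφα]
    simp only [φ', hlogα]
    rw [mul_div_assoc, div_self hn0.ne', mul_one, hχ'2]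
    simp
  refine ⟨g, T, ?_, ?_⟩
  · rw [energy_eq p d α β q g hpα.le hαβ.le hsupp hgα hg'α, mass_eq p α β g hpα.le hαβ.le hsupp hgα]
    have hnorm : ∀ r, p < r → ‖g r‖ ^ 2 = (φ r * F ν r) ^ 2 := by
      intro r hr
      simp only [g, g0, hr, if_true, Complex.norm_real, Real.norm_eq_abs, sq_abs]
    have hnorm' : ∀ r, p < r → ‖deriv g r‖ ^ 2 = (φ' r * F ν r + φ r * G ν r) ^ 2 := by
      intro r hr
      rw [(hdg r hr).deriv, Complex.norm_real, Real.norm_eq_abs, sq_abs]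
    let P : ℝ → ℝ := fun s => (s - p) * (s - p + d) * G ν s
    let H' : ℝ → ℝ := fun r => ((q r - ν) * F ν r) * (φ r ^ 2 * F ν r) +
      P r * (2 * φ r * φ' r * F ν r + φ r ^ 2 * G ν r)
    have hH : ∀ r ∈ uIcc α β, HasDerivAt (fun r => P r * (φ r ^ 2 * F ν r)) (H' r) r := by
      intro r hr
      rw [uIcc_of_le hαβ.le] at hr
      have hpr : p < r := hpα.trans_le hr.1
      have e := (S.dG ν r hpr).mul (((hdφ r hpr).pow 2).mul (S.dF ν r))
      refine e.congr_deriv ?_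
      simp [H', P]
    have hcF := S.contF ν
    have hcG := S.contG ν
    have hcP : Continuous P := S.contP ν
    have hcχ' : Continuous (deriv χ) := hχ.continuous_deriv (by simp)
    have hne : ∀ r ∈ Icc α β, r - p ≠ 0 := fun r hr => by linarith [hr.1]
    have hclog : ContinuousOn (fun r => log (r - p) / n) (Icc α β) :=
      (ContinuousOn.log (by fun_prop) hne).div_const _
    have hcφ : ContinuousOn φ (Icc α β) := hχ.continuous.comp_continuousOn hclog
    have hcinv : ContinuousOn (fun r => (r - p)⁻¹) (Icc α β) := ContinuousOn.inv₀ (by fun_prop) hne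
    have hcφ' : ContinuousOn φ' (Icc α β) :=
      (hcχ'.comp_continuousOn hclog).mul (hcinv.div_const _)
    have hqq : ContinuousOn q (Icc α β) := hq.mono fun x hx => hpα.le.trans hx.1
    have hiH : IntervalIntegrable H' volume α β := by
      apply ContinuousOn.intervalIntegrable; rw [uIcc_of_le hαβ.le]
      simp only [H']
      fun_prop
    have hInt := intervalIntegral.integral_eq_sub_of_hasDerivAt hH hiH
    simp only [hφα, hφβ] at hInt
    have him : IntervalIntegrable (fun r => ν * ‖g r‖ ^ 2) volume α β := by
      have := T.cont
      apply Continuous.intervalIntegrable; fun_prop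
    have hii : IntervalIntegrable (fun r => B ^ 2 * D / n ^ 2 * (r - p)⁻¹) volume α β := by
      apply ContinuousOn.intervalIntegrable; rw [uIcc_of_le hαβ.le]
      fun_prop
    have key : ∫ r in α..β, ((r - p) * (r - p + d) * ‖deriv g r‖ ^ 2 + q r * ‖g r‖ ^ 2) ≤
        ∫ r in α..β, (ν * ‖g r‖ ^ 2 + H' r + B ^ 2 * D / n ^ 2 * (r - p)⁻¹) := by
      apply intervalIntegral.integral_mono_on hαβ.le (energy_int T hpα hαβ.le hq) ((him.add hiH).add hii)
      intro r hr
      have hpr : p < r := hpα.trans_le hr.1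
      rw [hnorm r hpr, hnorm' r hpr]
      have e1 : (r - p) * (r - p + d) * (φ' r * F ν r + φ r * G ν r) ^ 2 + q r * (φ r * F ν r) ^ 2 =
        ν * (φ r * F ν r) ^ 2 + H' r + (r - p) * (r - p + d) * (φ' r * F ν r) ^ 2 := by
        simp only [H', P]; ring
      rw [e1]
      have hrp : 0 < r - p := by linarith
      have e2 : (r - p) * (r - p + d) * (φ' r * F ν r) ^ 2 =
          (deriv χ (log (r - p) / n)) ^ 2 * (F ν r ^ 2 * (r - p + d)) / n ^ 2 * (r - p)⁻¹ := by
        simp only [φ']; field_simp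
      have e3 : (deriv χ (log (r - p) / n)) ^ 2 ≤ B ^ 2 := by
        rw [← sq_abs]
        have := hB (log (r - p) / n)
        gcongr
      have e4 := hD r hpr.le
      have e5 : 0 ≤ F ν r ^ 2 * (r - p + d) := mul_nonneg (sq_nonneg _) (by linarith)
      rw [e2]
      gcongr
    have hli : ∫ r in α..β, (r - p)⁻¹ = 4 * n := by
      have hd1 : ∀ r ∈ uIcc α β, HasDerivAt (fun r => log (r - p)) ((r - p)⁻¹) r := by
        intro r hr
        rw [uIcc_of_le hαβ.le] at hr
        have := (((hasDerivAt_id r).sub_const p).log (by simpa using hne r hr))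
        simpa using this
      rw [intervalIntegral.integral_eq_sub_of_hasDerivAt hd1 (by
        apply ContinuousOn.intervalIntegrable; rw [uIcc_of_le hαβ.le]; exact hcinv), hlogα, hlogβ]
      ring
    rw [intervalIntegral.integral_add (him.add hiH) hii, intervalIntegral.integral_add him hiH, hInt,
      intervalIntegral.integral_const_mul, intervalIntegral.integral_const_mul, hli] at key
    refine key.trans (le_of_eq ?_)
    field_simp
    ring
  · rw [mass_eq p α β g hpα.le hαβ.le hsupp hgα]
    have hcg := T.cont
    have hab : exp (-1) ≤ exp 1 := exp_le_exp.mpr (by norm_num)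
    have e1 : ∫ r in (p + exp (-1))..(p + exp 1), F ν r ^ 2 =
        ∫ r in (p + exp (-1))..(p + exp 1), ‖g r‖ ^ 2 := by
      apply intervalIntegral.integral_congr
      intro r hr
      rw [uIcc_of_le (by linarith)] at hr
      have h0 : exp (-1) ≤ r - p := by linarith [hr.1]
      have h1 : r - p ≤ exp 1 := by linarith [hr.2]
      have hpos : 0 < r - p := (exp_pos _).trans_le h0
      have hpr : p < r := by linarith
      have : φ r = 1 := by
        apply hχ1
        have l1 := (le_log_iff_exp_le hpos).mpr h0
        have l2 := (log_le_iff_le_exp hpos).mpr h1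
        rw [abs_div, abs_of_pos hn0, div_le_one hn0]
        rw [abs_le]; constructor <;> linarith
      simp [g, g0, hpr, this]
    rw [e1]
    apply intervalIntegral.integral_mono_interval
    · have : exp (-2 * (n:ℝ)) ≤ exp (-1) := exp_le_exp.mpr (by linarith)
      linarith
    · linarith
    · have : exp 1 ≤ exp (2 * (n:ℝ)) := exp_le_exp.mpr (by linarith)
      linarith
    · exact Eventually.of_forall fun r => by positivity
    · apply Continuous.intervalIntegrable; fun_prop

lemma Sol.le_of_lower (S : Sol p d q F G) (hd : 0 < d) (hq : ContinuousOn q (Ici p))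
    (hqs : ContDiffOn ℝ (⊤ : ℕ∞) q (Ioi p)) (ν D ν₀ : ℝ) (hD0 : 0 ≤ D)
    (hpos : ∀ r, p ≤ r → 0 < F ν r)
    (hD : ∀ r, p ≤ r → F ν r ^ 2 * (r - p + d) ≤ D)
    (hlow : ∀ g, TestFn p g → ν₀ * (∫ r in Ioi p, ‖g r‖ ^ 2) ≤ energy p d q g) : ν₀ ≤ ν := by
  obtain ⟨χ, B, hχ, hχ1, hχ0, hB0, hB⟩ := exists_bump
  by_contra hlt
  rw [not_le] at hlt
  set c0 := ∫ r in (p + exp (-1))..(p + exp 1), F ν r ^ 2 with hc0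
  have hc0p : 0 < c0 := by
    have hab : exp (-1) < exp 1 := exp_lt_exp.mpr (by norm_num)
    have := S.contF ν
    apply intervalIntegral.intervalIntegral_pos_of_pos_on
    · apply Continuous.intervalIntegrable; fun_prop
    · intro r hr
      have := hpos r (by linarith [hr.1, exp_pos (-1)])
      positivity
    · linarith
  obtain ⟨n, hn⟩ := exists_nat_gt (4 * B ^ 2 * D / ((ν₀ - ν) * c0))
  have hpp : 0 < (ν₀ - ν) * c0 := mul_pos (by linarith) hc0p
  have hn0 : (0:ℝ) < n := lt_of_le_of_lt (by positivity) hn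
  have hn1 : 1 ≤ n := by
    have : 0 < n := by exact_mod_cast hn0
    exact this
  obtain ⟨g, T, h1, h2⟩ := S.cutoff hd hq hqs ν D hD0 hD χ B hχ hχ1 hχ0 hB0 hB n hn1
  have h3 := hlow g T
  rw [div_lt_iff₀ hpp] at hn
  have h4 : 4 * B ^ 2 * D / n < (ν₀ - ν) * c0 := by
    rw [div_lt_iff₀ hn0]; linarith
  have h5 := mul_le_mul_of_nonneg_left h2 (sub_nonneg.mpr hlt.le)
  nlinarith

/-- Main abstract theorem. -/
theorem ground_state (p d : ℝ) (q : ℝ → ℝ) (hd : 0 < d) (hq : ContinuousOn q (Ici p))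
    (hqs : ContDiffOn ℝ (⊤ : ℕ∞) q (Ioi p)) (C : ℝ) (hC0 : 0 ≤ C)
    (hC : ∀ r, p ≤ r → |q r| ≤ C * (1 + (r - p) ^ 2)) (k K : ℝ) (hk : 0 < k)
    (hqk : ∀ r, p ≤ r → k * ((r - p) * (r - p + d)) - K ≤ q r)
    (hne : (energySet p d q).Nonempty) :
    BddBelow (energySet p d q) ∧ ∃ f f' : ℝ → ℝ, (∀ r, p ≤ r → 0 < f r) ∧ Continuous f' ∧
      (∀ r, HasDerivAt f (f' r) r) ∧
      (∀ r, p < r → HasDerivAt (fun s => (s - p) * (s - p + d) * f' s)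
        ((q r - sInf (energySet p d q)) * f r) r) ∧
      ∃ C c : ℝ, 0 < C ∧ 0 < c ∧ ∀ r, p ≤ r → |f r| + |f' r| ≤ C * exp (-c * r) := by
  obtain ⟨F, G, S⟩ := ode_sol p d hd q hq C hC0 hC
  have hlow : ∀ ν, (∀ r, p ≤ r → 0 < F ν r) → ∀ x ∈ energySet p d q, ν ≤ x := by
    rintro ν h x ⟨f, T, h1, rfl⟩
    have := S.picone hd hq ν h f T
    rwa [h1, mul_one] at this
  have hbdd : BddAbove {ν | ∀ r, p ≤ r → 0 < F ν r} := by
    obtain ⟨x, hx⟩ := hne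
    exact ⟨x, fun ν h => hlow ν h x hx⟩
  obtain ⟨ν, R, hR, hpos, hG, hco⟩ := S.exists_crit hd hq k K hk hqk hbdd
  have hBB : BddBelow (energySet p d q) := ⟨ν, fun x hx => hlow ν hpos x hx⟩
  obtain ⟨C', c, hC', hc, hdec⟩ := S.decay hd (k / 2) (by positivity) ν R hR hpos hG hco
  have hν1 : ν ≤ sInf (energySet p d q) := le_csInf hne (hlow ν hpos)
  have hν2 : sInf (energySet p d q) ≤ ν := by
    apply S.le_of_lower hd hq hqs ν ((C' * exp (-c * p)) * (C' * exp (-c * p) * (d + 1 / c))) _ (by positivity) hpos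
    · intro r hr
      have h1 := hdec r hr
      have h2 : F ν r ≤ C' * exp (-c * r) := by
        have := le_abs_self (F ν r)
        have := abs_nonneg (G ν r)
        linarith
      have h3 := (hpos r hr).le
      have hx : 0 ≤ r - p := by linarith
      have e : exp (-c * r) = exp (-c * p) * exp (-(c * (r - p))) := by
        rw [← exp_add]; congr 1; ring
      have h4 : exp (-(c * (r - p))) ≤ 1 := exp_le_one_iff.mpr (by
        have : 0 ≤ c * (r - p) := by positivity
        linarith)
      have h5 : exp (-(c * (r - p))) * (r - p) ≤ 1 / c := by
        rw [exp_neg, le_div_iff₀ hc, inv_mul_eq_div, div_mul_eq_mul_div, div_le_one (exp_pos _)]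
        linarith [add_one_le_exp (c * (r - p))]
      have h6 : F ν r ≤ C' * exp (-c * p) := by
        refine h2.trans ?_
        rw [e, ← mul_assoc]
        exact mul_le_of_le_one_right (by positivity) h4
      have h7 : F ν r * (r - p + d) ≤ C' * exp (-c * p) * (d + 1 / c) := by
        calc F ν r * (r - p + d) ≤ C' * exp (-c * r) * (r - p + d) := by gcongr
          _ = C' * exp (-c * p) * (exp (-(c * (r - p))) * d + exp (-(c * (r - p))) * (r - p)) := by
            rw [e]; ring
          _ ≤ _ := by
            gcongr
            exact mul_le_of_le_one_left hd.le h4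
      rw [sq, mul_assoc]
      exact mul_le_mul h6 h7 (by positivity) (by positivity)
    · intro g T
      rcases (integral_nonneg (μ := volume.restrict (Ioi p)) (f := fun r => ‖g r‖ ^ 2) (fun r => by positivity)).lt_or_eq with h | h
      · obtain ⟨g', T', h1, h2⟩ := normalise (d := d) (q := q) T h
        have := csInf_le hBB ⟨g', T', h1, rfl⟩
        rw [h2, le_div_iff₀ h] at this
        exact this
      · have := S.picone hd hq ν hpos g T
        rw [← h, mul_zero] at this ⊢
        exact this
  have hν : sInf (energySet p d q) = ν := le_antisymm hν2 hν1
  refine ⟨hBB, F ν, G ν, hpos, S.contG ν, S.dF ν, ?_, C', c, hC', hc, hdec⟩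
  rw [hν]
  exact S.dG ν

lemma exists_negative (p d A b : ℝ) (q : ℝ → ℝ) (hd : 0 < d) (hb : 0 < b) (hq : ContinuousOn q (Ici p))
    (hqA : ∀ r, p ≤ r → q r ≤ A - b * (r - p)) :
    ∃ f, TestFn p f ∧ ∫ r in Ioi p, ‖f r‖ ^ 2 = 1 ∧ energy p d q f < 0 := by
  obtain ⟨χ, B, hχ, hχ1, hχ0, hB0, hB⟩ := exists_bump
  obtain ⟨R, hR1, hRA, hR⟩ : ∃ R : ℝ, 1 ≤ R ∧ A ≤ b * R ∧ 4 * (5 * (5 + d) * B ^ 2) + A - b * R < 0 := by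
    refine ⟨1 + (|A| + 4 * (5 * (5 + d) * B ^ 2)) / b, ?_, ?_, ?_⟩
    · have : 0 ≤ (|A| + 4 * (5 * (5 + d) * B ^ 2)) / b := by positivity
      linarith
    · rw [mul_add b, mul_div_cancel₀ _ hb.ne']
      have := le_abs_self A
      have : 0 ≤ 4 * (5 * (5 + d) * B ^ 2) := by positivity
      linarith
    · rw [mul_add b, mul_div_cancel₀ _ hb.ne']
      have := le_abs_self A
      linarith
  have hR0 : 0 < R := by linarith
  let g0 : ℝ → ℝ := fun r => χ ((r - p) / R - 3)
  let g : ℝ → ℂ := fun r => (g0 r : ℂ)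
  have hgs : ContDiff ℝ (⊤ : ℕ∞) g := by
    apply Complex.ofRealCLM.contDiff.comp
    apply hχ.comp
    fun_prop
  have hz : ∀ r, r ∉ Ioo (p + R) (p + 5 * R) → g r = 0 := by
    intro r h
    have : χ ((r - p) / R - 3) = 0 := by
      apply hχ0
      rw [le_abs']
      rw [mem_Ioo, not_and_or, not_lt, not_lt] at h
      rcases h with h | h
      · left
        have : (r - p) / R ≤ 1 := by rw [div_le_one hR0]; linarith
        linarith
      · right
        have : 5 ≤ (r - p) / R := by rw [le_div_iff₀ hR0]; linarith
        linarith
    simp [g, g0, this]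
  have hsupp : tsupport g ⊆ Icc (p + R) (p + 5 * R) := by
    apply closure_minimal _ isClosed_Icc
    intro r hr
    by_contra h
    exact hr (hz r (fun h' => h (Ioo_subset_Icc_self h')))
  have T : TestFn p g := ⟨hgs, HasCompactSupport.of_support_subset_isCompact isCompact_Icc
    (subset_closure.trans hsupp), hsupp.trans fun r hr => lt_of_lt_of_le (by linarith) hr.1⟩
  have hdg : ∀ r, HasDerivAt g ((deriv χ ((r - p) / R - 3) * (1 / R) : ℝ) : ℂ) r := by
    intro r
    have e1 : HasDerivAt (fun r => (r - p) / R - 3) (1 / R) r :=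
      (((hasDerivAt_id r).sub_const p).div_const R).sub_const 3
    have e2 : HasDerivAt χ (deriv χ ((r - p) / R - 3)) ((r - p) / R - 3) :=
      ((hχ.differentiable (by simp)) _).hasDerivAt
    exact (e2.comp r e1).ofReal_comp
  have hle : p + R / 2 ≤ p + 5 * R := by linarith
  have hsupp' : tsupport g ⊆ Icc (p + R / 2) (p + 5 * R) :=
    hsupp.trans (Icc_subset_Icc (by linarith) le_rfl)
  have hnot : p + R / 2 ∉ tsupport g := fun h => by have := (hsupp h).1; linarith
  have hgα := image_eq_zero_of_notMem_tsupport hnot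
  have hgα' : deriv g (p + R / 2) = 0 :=
    image_eq_zero_of_notMem_tsupport (fun h => hnot (tsupport_deriv_subset h))
  have hmass := mass_eq p (p + R / 2) (p + 5 * R) g (by linarith) hle hsupp' hgα
  have hen := energy_eq p d (p + R / 2) (p + 5 * R) q g (by linarith) hle hsupp' hgα hgα'
  have hcg := T.cont
  have hmassR : R ≤ ∫ r in Ioi p, ‖g r‖ ^ 2 := by
    rw [hmass]
    have e1 : ∫ r in (p + 2 * R)..(p + 4 * R), ‖g r‖ ^ 2 = ∫ r in (p + 2 * R)..(p + 4 * R), (1:ℝ) := by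
      apply intervalIntegral.integral_congr
      intro r hr
      rw [uIcc_of_le (by linarith)] at hr
      have : χ ((r - p) / R - 3) = 1 := by
        apply hχ1
        have h1 : 2 ≤ (r - p) / R := by rw [le_div_iff₀ hR0]; linarith [hr.1]
        have h2 : (r - p) / R ≤ 4 := by rw [div_le_iff₀ hR0]; linarith [hr.2]
        rw [abs_le]; constructor <;> linarith
      simp [g, g0, this]
    have e2 : ∫ r in (p + 2 * R)..(p + 4 * R), ‖g r‖ ^ 2 ≤ ∫ r in (p + R / 2)..(p + 5 * R), ‖g r‖ ^ 2 := by
      apply intervalIntegral.integral_mono_interval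
      · linarith
      · linarith
      · linarith
      · exact Eventually.of_forall fun r => by positivity
      · apply Continuous.intervalIntegrable; fun_prop
    rw [e1, intervalIntegral.integral_const, smul_eq_mul] at e2
    linarith
  have hee : energy p d q g ≤ (5 * (5 + d) * B ^ 2) * (p + 5 * R - (p + R)) + (A - b * R) * ∫ r in Ioi p, ‖g r‖ ^ 2 := by
    have hnot1 : g (p + R) = 0 := hz _ (by simp)
    have hmass := mass_eq p (p + R) (p + 5 * R) g (by linarith) (by linarith) hsupp hnot1
    have hd0 : deriv g (p + R) = 0 := by
      have hc := T.contD
      have h2 : IsClosed {x | deriv g x = 0} := isClosed_eq hc continuous_const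
      have h3 : closure (Iio (p + R)) ⊆ {x | deriv g x = 0} := h2.closure_subset_iff.mpr (fun x hx => by
        have hx' : x ∉ tsupport g := fun h => by
          have := (hsupp h).1
          have h4 : x < p + R := hx
          linarith
        exact image_eq_zero_of_notMem_tsupport (fun h => hx' (tsupport_deriv_subset h)))
      rw [closure_Iio] at h3
      exact h3 (by simp)
    rw [energy_eq p d (p + R) (p + 5 * R) q g (by linarith) (by linarith) hsupp hnot1 hd0, hmass,
      ← intervalIntegral.integral_const_mul]
    have hi1 : IntervalIntegrable (fun r => (5 * (5 + d) * B ^ 2)) volume (p + R) (p + 5 * R) :=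
      intervalIntegrable_const
    have hi2 : IntervalIntegrable (fun r => (A - b * R) * ‖g r‖ ^ 2) volume (p + R) (p + 5 * R) := by
      apply Continuous.intervalIntegrable; fun_prop
    have : (5 * (5 + d) * B ^ 2) * (p + 5 * R - (p + R)) = ∫ r in (p + R)..(p + 5 * R), (5 * (5 + d) * B ^ 2) := by
      rw [intervalIntegral.integral_const, smul_eq_mul]; ring
    rw [this, ← intervalIntegral.integral_add hi1 hi2]
    apply intervalIntegral.integral_mono_on (by linarith) (energy_int T (by linarith) (by linarith) hq) (hi1.add hi2)
    intro r hr
    have hr1 : R ≤ r - p := by linarith [hr.1]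
    have hr2 : r - p ≤ 5 * R := by linarith [hr.2]
    apply add_le_add
    · rw [(hdg r).deriv, Complex.norm_real, Real.norm_eq_abs, sq_abs]
      have e3 : (deriv χ ((r - p) / R - 3)) ^ 2 ≤ B ^ 2 := by
        rw [← sq_abs]
        have := hB ((r - p) / R - 3)
        gcongr
      have e4 : (r - p) * (r - p + d) ≤ (5 * R) * ((5 + d) * R) := by
        apply mul_le_mul hr2 _ (by linarith) (by linarith)
        nlinarith
      calc (r - p) * (r - p + d) * (deriv χ ((r - p) / R - 3) * (1 / R)) ^ 2
          ≤ ((5 * R) * ((5 + d) * R)) * (B ^ 2 * (1 / R) ^ 2) := by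
            rw [mul_pow]
            apply mul_le_mul e4 _ (by positivity) (by positivity)
            gcongr
        _ = _ := by field_simp
    · have := hqA r (by linarith)
      gcongr
      nlinarith
  have hneg : energy p d q g < 0 := by
    have := mul_le_mul_of_nonpos_left hmassR (by linarith : A - b * R ≤ 0)
    nlinarith
  obtain ⟨f, Tf, h1, h2⟩ := normalise (d := d) (q := q) T (by linarith)
  exact ⟨f, Tf, h1, by rw [h2]; exact div_neg_of_neg_of_pos hneg (by linarith)⟩
end


/-- The reduced potential. -/
noncomputable def qpot (p d A B E k r : ℝ) : ℝ := A + k * r ^ 2 - B * r - E * ((r - p) / (r - p + d))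

lemma frac_bd (d x : ℝ) (hd : 0 < d) (hx : 0 ≤ x) : 0 ≤ x / (x + d) ∧ x / (x + d) ≤ 1 :=
  ⟨by positivity, by rw [div_le_one (by positivity)]; linarith⟩

lemma qpot_cont (p d A B E k : ℝ) (hd : 0 < d) : ContinuousOn (qpot p d A B E k) (Ici p) := by
  unfold qpot
  have : ContinuousOn (fun r : ℝ => (r - p) / (r - p + d)) (Ici p) := by
    apply ContinuousOn.div (by fun_prop) (by fun_prop)
    intro r hr
    have : p ≤ r := hr
    linarith
  fun_prop

lemma qpot_smooth (p d A B E k : ℝ) (hd : 0 < d) :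
    ContDiffOn ℝ (⊤ : ℕ∞) (qpot p d A B E k) (Ioi p) := by
  unfold qpot
  have : ContDiffOn ℝ (⊤ : ℕ∞) (fun r : ℝ => (r - p) / (r - p + d)) (Ioi p) := by
    apply ContDiffOn.div (by fun_prop) (by fun_prop)
    intro r hr
    have : p < r := hr
    linarith
  fun_prop

lemma qpot_growth (p d A B E k : ℝ) (hd : 0 < d) (hB : 0 ≤ B) (hE : 0 ≤ E) :
    ∃ C, 0 ≤ C ∧ ∀ r, p ≤ r → |qpot p d A B E k r| ≤ C * (1 + (r - p) ^ 2) := by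
  refine ⟨|A| + E + B + (|k| + B) * (2 * p ^ 2 + 2), by positivity, ?_⟩
  intro r hr
  obtain ⟨h1, h2⟩ := frac_bd d (r - p) hd (by linarith)
  have e1 : |qpot p d A B E k r| ≤ |A| + |k| * r ^ 2 + B * |r| + E := by
    unfold qpot
    have a1 := abs_sub (A + k * r ^ 2 - B * r) (E * ((r - p) / (r - p + d)))
    have a2 := abs_sub (A + k * r ^ 2) (B * r)
    have a3 := abs_add_le A (k * r ^ 2)
    rw [abs_mul k, abs_of_nonneg (sq_nonneg r)] at a3
    rw [abs_mul B, abs_of_nonneg hB] at a2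
    rw [abs_of_nonneg (mul_nonneg hE h1)] at a1
    have a4 : E * ((r - p) / (r - p + d)) ≤ E * 1 := by gcongr
    linarith
  have e2 : |r| ≤ 1 + r ^ 2 := by
    rw [← sq_abs r]; nlinarith [sq_nonneg (|r| - 1), sq_nonneg |r|]
  have e3 : r ^ 2 ≤ (2 * p ^ 2 + 2) * (1 + (r - p) ^ 2) := by
    nlinarith [sq_nonneg (p - (r - p)), mul_nonneg (sq_nonneg p) (sq_nonneg (r - p))]
  have e4 : B * |r| ≤ B * (1 + r ^ 2) := by gcongr
  have e5 : (|k| + B) * r ^ 2 ≤ (|k| + B) * ((2 * p ^ 2 + 2) * (1 + (r - p) ^ 2)) := by gcongr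
  have e6 : 0 ≤ (|A| + E + B) * (r - p) ^ 2 := by positivity
  linarith

lemma qpot_coercive (p d A B E k : ℝ) (hd : 0 < d) (hE : 0 ≤ E) (hk : 0 < k) :
    ∃ K, ∀ r, p ≤ r → (k / 2) * ((r - p) * (r - p + d)) - K ≤ qpot p d A B E k r := by
  obtain ⟨c, hc⟩ : ∃ c, c = 2 * k * p - B - k * d / 2 := ⟨_, rfl⟩
  refine ⟨c ^ 2 / (2 * k) - (A + k * p ^ 2 - B * p - E), ?_⟩
  intro r hr
  obtain ⟨h1, h2⟩ := frac_bd d (r - p) hd (by linarith)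
  have a4 : E * ((r - p) / (r - p + d)) ≤ E * 1 := by gcongr
  obtain ⟨x, rfl⟩ : ∃ x, r = p + x := ⟨r - p, by ring⟩
  have e1 : k / 2 * x ^ 2 + c * x + c ^ 2 / (2 * k) = (k * x + c) ^ 2 / (2 * k) := by
    field_simp; ring
  have e2 : 0 ≤ (k * x + c) ^ 2 / (2 * k) := by positivity
  rw [← e1] at e2
  unfold qpot
  have e3 : c * x = (2 * k * p - B - k * d / 2) * x := by rw [hc]
  simp only [add_sub_cancel_left] at *
  nlinarith

lemma energy_add {p d : ℝ} {q : ℝ → ℝ} {f : ℝ → ℂ} (T : TestFn p f)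
    (hq : ContinuousOn q (Ici p)) : ∃ J, 0 ≤ J ∧ ∀ k : ℝ, ∀ q2 : ℝ → ℝ,
      (∀ r, q2 r = q r + k * r ^ 2) → energy p d q2 f = energy p d q f + k * J := by
  obtain ⟨α, β, h1, h2, h3, h4, h5, h6⟩ := T.interval
  refine ⟨∫ r in α..β, r ^ 2 * ‖f r‖ ^ 2,
    intervalIntegral.integral_nonneg h2.le (fun r _ => by positivity), ?_⟩
  intro k q2 hq2
  rw [energy_eq p d α β q f h1.le h2.le h3 h4 h5, energy_eq p d α β q2 f h1.le h2.le h3 h4 h5,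
    ← intervalIntegral.integral_const_mul, ← intervalIntegral.integral_add (energy_int T h1 h2.le hq)]
  · apply intervalIntegral.integral_congr
    intro r _
    simp only [hq2]; ring
  · have := T.cont
    apply Continuous.intervalIntegrable
    fun_prop

lemma sup_facts (M a : ℝ) (hM : 0 < M) (ha : |a| < M) :
    0 < rPlus M a - rMinus M a ∧ 0 < rPlus M a ∧ rPlus M a + rMinus M a = 2 * M ∧
    rPlus M a * rMinus M a = a ^ 2 := by
  have h : 0 < M ^ 2 - a ^ 2 := by
    have := sq_lt_sq' (by linarith [neg_abs_le a, abs_nonneg a]) ha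
    rw [sq_abs] at this; linarith
  have hs := Real.sqrt_pos.mpr h
  have hsq := Real.sq_sqrt h.le
  unfold rPlus rMinus
  refine ⟨by linarith, by linarith, by ring, by linarith⟩

lemma Delta_eq (M a r : ℝ) : Delta M a r =
    (r - rPlus M a) * (r - rPlus M a + (rPlus M a - rMinus M a)) := by
  unfold Delta; ring

lemma Vpot_eq (M a : ℝ) (hM : 0 < M) (ha : |a| < M) (m : ℤ) (ω lam : ℝ)
    (hsup : a * m - 2 * M * rPlus M a * ω = 0) (μ r : ℝ) (hr : rPlus M a < r) :
    Vpot M a m ω lam μ r = Delta M a r * qpot (rPlus M a) (rPlus M a - rMinus M a) lam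
      (2 * M * ω ^ 2) (4 * M ^ 2 * ω ^ 2) (μ ^ 2 - ω ^ 2) r := by
  obtain ⟨hd, hp, hs, hpr⟩ := sup_facts M a hM ha
  have h1 : a * m = 2 * M * rPlus M a * ω := by linarith
  have hX : Vpot M a m ω lam μ r = -(r ^ 2 + a ^ 2) ^ 2 * ω ^ 2 + 4 * M * (a * m) * r * ω - (a * m) ^ 2
    + Delta M a r * (lam + a ^ 2 * ω ^ 2 + μ ^ 2 * r ^ 2) := by unfold Vpot; ring
  rw [hX, h1, Delta_eq]
  unfold qpot
  generalize rPlus M a = p at *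
  generalize rMinus M a = n at *
  have hne : r - p + (p - n) ≠ 0 := by linarith
  have e : (r - p) * (r - p + (p - n)) * ((r - p) / (r - p + (p - n))) = (r - p) ^ 2 := by
    field_simp
  have hn : n = 2 * M - p := by linarith
  subst hn
  have ha2 : a ^ 2 = 2 * M * p - p ^ 2 := by linarith
  rw [mul_sub, mul_left_comm _ (4 * M ^ 2 * ω ^ 2), e, ha2]
  ring

lemma nuMu_eq (M a : ℝ) (hM : 0 < M) (ha : |a| < M) (m : ℤ) (ω lam : ℝ)
    (hsup : a * m - 2 * M * rPlus M a * ω = 0) (μ : ℝ) :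
    nuMu M a m ω lam μ = sInf (energySet (rPlus M a) (rPlus M a - rMinus M a)
      (qpot (rPlus M a) (rPlus M a - rMinus M a) lam
      (2 * M * ω ^ 2) (4 * M ^ 2 * ω ^ 2) (μ ^ 2 - ω ^ 2))) := by
  obtain ⟨hd, hp, hs, hpr⟩ := sup_facts M a hM ha
  have key : ∀ f : ℝ → ℂ, (∫ r in Ioi (rPlus M a),
      (Delta M a r * ‖deriv f r‖ ^ 2
        + Vpot M a m ω lam μ r / Delta M a r * ‖f r‖ ^ 2)) =
      energy (rPlus M a) (rPlus M a - rMinus M a)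
      (qpot (rPlus M a) (rPlus M a - rMinus M a) lam
      (2 * M * ω ^ 2) (4 * M ^ 2 * ω ^ 2) (μ ^ 2 - ω ^ 2)) f := by
    intro f
    unfold energy
    apply setIntegral_congr_fun measurableSet_Ioi
    intro r hr
    have hr' : rPlus M a < r := hr
    have hD : 0 < Delta M a r := by
      rw [Delta_eq]; exact mul_pos (by linarith) (by linarith)
    simp only
    rw [Vpot_eq M a hM ha m ω lam hsup μ r hr', mul_div_cancel_left₀ _ hD.ne', ← Delta_eq]
  unfold nuMu energySet
  congr 1
  ext x
  constructor
  · rintro ⟨f, h1, h2, h3, h4, h5⟩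
    exact ⟨f, ⟨h1, h2, h3⟩, h4, by rw [h5, key]⟩
  · rintro ⟨f, ⟨h1, h2, h3⟩, h4, h5⟩
    exact ⟨f, h1, h2, h3, h4, by rw [h5, key]⟩

/-- existence of bound states.  For `μ²` slightly above `ω²` there is `ν ≤ 0`
(namely `ν = ν_μ`, which is non-decreasing in `μ²`) and a nonzero solution of the modified
radial ODE `Δ(ΔR')' − V R + ν Δ R = 0` satisfying the mode boundary conditions. -/
theorem stmt8 (M a : ℝ) (hM : 0 < M) (ha : |a| < M) (m : ℤ)
    (ω lam : ℝ) (hω : ω ≠ 0) (hsup : a * m - 2 * M * rPlus M a * ω = 0)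
    (hlam : (|m| : ℝ) * (|m| + 1) ≤ lam + a ^ 2 * ω ^ 2) :
    ∃ δ > 0,
      (∀ μ : ℝ, ω ^ 2 < μ ^ 2 → μ ^ 2 < ω ^ 2 + δ →
        nuMu M a m ω lam μ ≤ 0 ∧
        ∃ f : ℝ → ℂ,
          (∃ r ∈ Ioi (rPlus M a), f r ≠ 0) ∧
          (∀ r ∈ Ioi (rPlus M a),
            (Delta M a r : ℂ) * deriv (fun s => (Delta M a s : ℂ) * deriv f s) r
              - (Vpot M a m ω lam μ r : ℂ) * f r
              + (nuMu M a m ω lam μ : ℂ) * (Delta M a r : ℂ) * f r = 0) ∧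
          ContDiffOn ℝ 1 f (Ici (rPlus M a)) ∧
          ExpDecay (rPlus M a) f) ∧
      (∀ μ₁ μ₂ : ℝ, ω ^ 2 < μ₁ ^ 2 → μ₁ ^ 2 < ω ^ 2 + δ →
        ω ^ 2 < μ₂ ^ 2 → μ₂ ^ 2 < ω ^ 2 + δ → μ₁ ^ 2 ≤ μ₂ ^ 2 →
        nuMu M a m ω lam μ₁ ≤ nuMu M a m ω lam μ₂) := by
  obtain ⟨hd, hp, hs, hpr⟩ := sup_facts M a hM ha
  have hω2 : 0 < ω ^ 2 := by positivity
  have hB : 0 < 2 * M * ω ^ 2 := by positivity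
  have hE : 0 ≤ 4 * M ^ 2 * ω ^ 2 := by positivity
  have hnu := nuMu_eq M a hM ha m ω lam hsup
  have hV := Vpot_eq M a hM ha m ω lam hsup
  have hDl := Delta_eq M a
  generalize 2 * M * ω ^ 2 = B at *
  generalize 4 * M ^ 2 * ω ^ 2 = E at *
  generalize rPlus M a - rMinus M a = d at *
  generalize rPlus M a = p at *
  obtain ⟨g, Tg, hg1, hg2⟩ := exists_negative p d (lam - B * p) B (qpot p d lam B E 0) hd hB
    (qpot_cont p d lam B E 0 hd) (by
      intro r hr
      obtain ⟨h1, -⟩ := frac_bd d (r - p) hd (by linarith)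
      have := mul_nonneg hE h1
      unfold qpot
      linarith)
  obtain ⟨J, hJ, hJe⟩ := energy_add (d := d) Tg (qpot_cont p d lam B E 0 hd)
  have hgk : ∀ k, energy p d (qpot p d lam B E k) g = energy p d (qpot p d lam B E 0) g + k * J :=
    fun k => hJe k _ (fun r => by unfold qpot; ring)
  have hmem : ∀ k, energy p d (qpot p d lam B E k) g ∈ energySet p d (qpot p d lam B E k) :=
    fun k => ⟨g, Tg, hg1, rfl⟩
  have hgr := fun k : ℝ => qpot_growth p d lam B E k hd hB.le hE
  have hco := fun (k : ℝ) (hk : 0 < k) => qpot_coercive p d lam B E k hd hE hk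
  choose Cf hC0 hC using hgr
  choose K hK using hco
  have GS := fun (k : ℝ) (hk : 0 < k) =>
    ground_state p d (qpot p d lam B E k) hd (qpot_cont _ _ _ _ _ _ hd)
      (qpot_smooth _ _ _ _ _ _ hd) (Cf k) (hC0 k) (hC k) (k / 2) (K k hk) (by positivity) (hK k hk)
      ⟨_, hmem k⟩
  refine ⟨-energy p d (qpot p d lam B E 0) g / (J + 1), div_pos (by linarith) (by linarith), ?_, ?_⟩
  · intro μ h1 h2
    obtain ⟨hbdd, f, f', hf1, hf2, hf3, hf4, C, c, hC, hc, hf5⟩ := GS (μ ^ 2 - ω ^ 2) (by linarith)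
    rw [← hnu] at hf4
    have hdf : ∀ r, HasDerivAt (fun r => (f r : ℂ)) ((f' r : ℝ) : ℂ) r :=
      fun r => (hf3 r).ofReal_comp
    have hdf' : deriv (fun r => (f r : ℂ)) = fun r => ((f' r : ℝ) : ℂ) :=
      funext fun r => (hdf r).deriv
    refine ⟨?_, fun r => (f r : ℂ), ⟨p + 1, by simp, ?_⟩, ?_, ?_, ?_⟩
    · rw [hnu]
      refine (csInf_le hbdd (hmem _)).trans ?_
      rw [hgk]
      have h3 : μ ^ 2 - ω ^ 2 < -energy p d (qpot p d lam B E 0) g / (J + 1) := by linarith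
      rw [lt_div_iff₀ (by linarith)] at h3
      nlinarith
    · exact Complex.ofReal_ne_zero.mpr (hf1 (p + 1) (by linarith)).ne'
    · intro r hr
      have hr' : p < r := hr
      have e1 : HasDerivAt (fun s => (Delta M a s : ℂ) * ((f' s : ℝ) : ℂ))
          (((qpot p d lam B E (μ ^ 2 - ω ^ 2) r - nuMu M a m ω lam μ) * f r : ℝ) : ℂ) r := by
        have := (hf4 r hr').ofReal_comp
        simpa [hDl] using this
      rw [hdf', e1.deriv, hV μ r hr']
      push_cast
      ring
    · apply ContDiff.contDiffOn
      rw [contDiff_one_iff_deriv, hdf']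
      exact ⟨fun r => (hdf r).differentiableAt, Complex.continuous_ofReal.comp hf2⟩
    · refine ⟨C, c, hC, hc, fun r hr => ?_⟩
      rw [hdf']
      simpa [Complex.norm_real] using hf5 r (by linarith)
  · intro μ₁ μ₂ h1 _ _ _ h5
    obtain ⟨hbdd, -⟩ := GS (μ₁ ^ 2 - ω ^ 2) (by linarith)
    rw [hnu, hnu]
    apply le_csInf ⟨_, hmem _⟩
    rintro x ⟨f, T, hf, rfl⟩
    refine (csInf_le hbdd ⟨f, T, hf, rfl⟩).trans ?_
    apply energy_mono T (qpot_cont _ _ _ _ _ _ hd) (qpot_cont _ _ _ _ _ _ hd)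
    intro r _
    unfold qpot
    have : (μ₁ ^ 2 - ω ^ 2) * r ^ 2 ≤ (μ₂ ^ 2 - ω ^ 2) * r ^ 2 := by gcongr
    linarith
end
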